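/- For every integer s ≥ 2, the holomorphic Horn cone Horn_hol^s(p,q) := {(x_1, …, x_{s+1}) ∈ (C_{p,q})^{s+1} : O_{x_{s+1}} ⊆ O_{x_1} + ⋯ + O_{x_s}} is a convex set, is stable under multiplication by every positive real scalar, and is closed in the subspace topology of (C_{p,q})^{s+1} ⊆ (ℝⁿ)^{s+1}. -/

import Mathlib

open Matrix Complex Pointwise

noncomputable def Ipq (p q : ℕ) : Matrix (Fin (p + q)) (Fin (p + q)) ℂ :=
  Matrix.diagonal fun i => if (i : ℕ) < p then 1 else -1

/-- The pseudo-unitary group `U(p,q)` as a set of matrices. -/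
def Upq (p q : ℕ) : Set (Matrix (Fin (p + q)) (Fin (p + q)) ℂ) :=
  {g | IsUnit g ∧ g * Ipq p q * g.conjTranspose = Ipq p q}

/-- The diagonal matrix with entries `i * x_k`. -/
noncomputable def dmat {n : ℕ} (x : Fin n → ℝ) : Matrix (Fin n) (Fin n) ℂ :=
  Matrix.diagonal fun i => Complex.I * (x i : ℂ)

/-- The holomorphic chamber `C_{p,q}`: `x_1 ≥ ⋯ ≥ x_p > x_{p+1} ≥ ⋯ ≥ x_{p+q}`. -/
def Chol (p q : ℕ) : Set (Fin (p + q) → ℝ) :=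
  {x | (∀ i j : Fin (p + q), (i : ℕ) ≤ (j : ℕ) → ((j : ℕ) < p ∨ p ≤ (i : ℕ)) → x j ≤ x i) ∧
       ∀ i j : Fin (p + q), (i : ℕ) < p → p ≤ (j : ℕ) → x j < x i}

/-- The adjoint orbit `O_x = {g d_x g⁻¹ : g ∈ U(p,q)}`. -/
def Orbit (p q : ℕ) (x : Fin (p + q) → ℝ) : Set (Matrix (Fin (p + q)) (Fin (p + q)) ℂ) :=
  {Y | ∃ g ∈ Upq p q, Y = g * dmat x * g⁻¹}

/-- The holomorphic Horn cone `Horn_hol^s(p,q)` as a set of `(s+1)`-tuples. -/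
def HornHolS (p q s : ℕ) : Set (Fin (s + 1) → Fin (p + q) → ℝ) :=
  {x | (∀ j, x j ∈ Chol p q) ∧
       Orbit p q (x (Fin.last s)) ⊆ ∑ j : Fin s, Orbit p q (x j.castSucc)}

namespace HolomorphicHorn

open scoped ComplexOrder

/-! ### Triangular matrices and Cholesky factors -/

theorem det_upper {n : ℕ} {U : Matrix (Fin n) (Fin n) ℂ} (hU : U.BlockTriangular id) :
    U.det = ∏ k, U k k := Matrix.det_of_isUpperTriangular hU

theorem isUnit_det_upper {n : ℕ} {U : Matrix (Fin n) (Fin n) ℂ} (hU : U.BlockTriangular id)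
    (h0 : ∀ k, U k k ≠ 0) : IsUnit U.det := by
  rw [det_upper hU, isUnit_iff_ne_zero]
  exact Finset.prod_ne_zero_iff.2 fun k _ => h0 k

theorem diag_ne_zero_of_isUnit {n : ℕ} {U : Matrix (Fin n) (Fin n) ℂ} (hU : U.BlockTriangular id)
    (h : IsUnit U.det) (k : Fin n) : U k k ≠ 0 := by
  rw [det_upper hU, isUnit_iff_ne_zero] at h
  exact Finset.prod_ne_zero_iff.1 h k (Finset.mem_univ k)

theorem upper_inv {n : ℕ} {U : Matrix (Fin n) (Fin n) ℂ} (hU : U.BlockTriangular id)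
    (h : IsUnit U.det) : (U⁻¹).BlockTriangular id := by
  let := Matrix.invertibleOfIsUnitDet U h
  exact Matrix.blockTriangular_inv_of_blockTriangular hU

/-- Cholesky factorisation. -/
theorem exists_cholesky {n : ℕ} {G : Matrix (Fin n) (Fin n) ℂ} (hG : G.PosDef) :
    ∃ U : Matrix (Fin n) (Fin n) ℂ, U.BlockTriangular id ∧ IsUnit U.det ∧ Uᴴ * U = G := by
  have hτ : ((LDL.lowerInv hG)ᴴ).BlockTriangular id := by
    intro i j hij
    rw [conjTranspose_apply, LDL.lowerInv_triangular hG (show j < i from hij), star_zero]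
  have hdet : IsUnit (LDL.lowerInv hG).det :=
    (Matrix.isUnit_iff_isUnit_det _).1 (isUnit_of_invertible _)
  have hdetτ : IsUnit ((LDL.lowerInv hG)ᴴ).det := by
    rw [det_conjTranspose]; exact hdet.star
  have hD : (diagonal (LDL.diagEntries hG) : Matrix (Fin n) (Fin n) ℂ).PosDef := by
    have h := LDL.diag_eq_lowerInv_conj hG
    rw [LDL.diag] at h
    rw [h]
    refine hG.mul_mul_conjTranspose_same ?_
    exact Matrix.vecMul_injective_of_isUnit ((Matrix.isUnit_iff_isUnit_det _).2 hdet)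
  rw [posDef_diagonal_iff] at hD
  set d := LDL.diagEntries hG with hd
  refine ⟨diagonal (fun k => ((Real.sqrt (d k).re : ℝ) : ℂ)) * ((LDL.lowerInv hG)ᴴ)⁻¹,
    ?_, ?_, ?_⟩
  · exact (blockTriangular_diagonal _).mul (upper_inv hτ hdetτ)
  · rw [det_mul, det_diagonal]
    refine IsUnit.mul ?_ ?_
    · rw [isUnit_iff_ne_zero]
      refine Finset.prod_ne_zero_iff.2 fun k _ => ?_
      have := (Complex.lt_def.1 (hD k)).1
      simp only [zero_re] at this
      exact_mod_cast (Real.sqrt_pos.2 this).ne'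
    · exact (Matrix.isUnit_nonsing_inv_det_iff).2 hdetτ
  · have h := LDL.lower_conj_diag hG
    rw [LDL.lower, LDL.diag] at h
    rw [conjTranspose_mul, diagonal_conjTranspose]
    rw [← conjTranspose_nonsing_inv, conjTranspose_conjTranspose, Matrix.mul_assoc,
      ← Matrix.mul_assoc (diagonal _), diagonal_mul_diagonal, ← Matrix.mul_assoc]
    rw [← hd] at h
    convert h using 4
    funext k
    have h1 := Complex.lt_def.1 (hD k)
    simp only [zero_re, zero_im] at h1
    apply Complex.ext
    · simp [← Complex.ofReal_mul, Real.mul_self_sqrt h1.1.le]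
    · simp [← h1.2]

/-- Quadratic form of a Gram matrix. -/
theorem star_dot_gram {m n : Type*} [Fintype m] [Fintype n] (U : Matrix m n ℂ) (v : n → ℂ) :
    star v ⬝ᵥ ((Uᴴ * U) *ᵥ v) = ∑ i, ((‖(U *ᵥ v) i‖ ^ 2 : ℝ) : ℂ) := by
  rw [← mulVec_mulVec, dotProduct_mulVec, ← star_mulVec]
  simp only [dotProduct, Pi.star_apply]
  refine Finset.sum_congr rfl fun i _ => ?_
  rw [RCLike.star_def, ← Complex.normSq_eq_conj_mul_self, Complex.normSq_eq_norm_sq]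

theorem gram_le_iff {m m' n : Type*} [Fintype m] [Fintype m'] [Fintype n]
    {U : Matrix m n ℂ} {U' : Matrix m' n ℂ}
    (h : (U'ᴴ * U' - Uᴴ * U).PosSemidef) (v : n → ℂ) :
    ∑ i, ‖(U *ᵥ v) i‖ ^ 2 ≤ ∑ i, ‖(U' *ᵥ v) i‖ ^ 2 := by
  have := h.dotProduct_mulVec_nonneg v
  rw [sub_mulVec, dotProduct_sub, star_dot_gram, star_dot_gram, sub_nonneg] at this
  exact_mod_cast this

theorem diag_norm_mono {n : ℕ} {U U' : Matrix (Fin n) (Fin n) ℂ} (hU : U.BlockTriangular id)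
    (hU' : U'.BlockTriangular id) (hd : IsUnit U'.det)
    (h : (U'ᴴ * U' - Uᴴ * U).PosSemidef) (k : Fin n) : ‖U k k‖ ≤ ‖U' k k‖ := by
  have hk := diag_ne_zero_of_isUnit hU' hd k
  set v : Fin n → ℂ := (U'⁻¹) *ᵥ (Pi.single k 1) with hv
  have hU'v : U' *ᵥ v = Pi.single k 1 := by
    rw [hv, mulVec_mulVec, mul_nonsing_inv _ hd, one_mulVec]
  have hvi : ∀ i, k < i → v i = 0 := by
    intro i hi
    rw [hv, mulVec_single_one]
    exact upper_inv hU' hd hi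
  have key : ∀ W : Matrix (Fin n) (Fin n) ℂ, W.BlockTriangular id → (W *ᵥ v) k = W k k * v k := by
    intro W hW
    rw [mulVec, dotProduct]
    refine Finset.sum_eq_single k (fun i _ hik => ?_) (by simp)
    rcases lt_or_gt_of_ne hik with h1 | h1
    · rw [hW (show id i < id k from h1), zero_mul]
    · rw [hvi i h1, mul_zero]
  have h1 := gram_le_iff h v
  rw [hU'v] at h1
  have h2 : ∑ i, ‖(Pi.single k (1:ℂ) : Fin n → ℂ) i‖ ^ 2 = 1 := by
    rw [Finset.sum_eq_single k] <;> simp +contextual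
  have h3 : ‖(U *ᵥ v) k‖ ^ 2 ≤ ∑ i, ‖(U *ᵥ v) i‖ ^ 2 :=
    Finset.single_le_sum (f := fun i => ‖(U *ᵥ v) i‖ ^ 2) (fun i _ => by positivity)
      (Finset.mem_univ k)
  have h4 : U' k k * v k = 1 := by
    rw [← key U' hU', hU'v, Pi.single_eq_same]
  rw [key U hU] at h3
  have h5 : ‖U k k * v k‖ ≤ 1 := by
    have := h3.trans (h1.trans h2.le)
    nlinarith [norm_nonneg (U k k * v k)]
  have h6 : ‖U' k k‖ * ‖v k‖ = 1 := by rw [← norm_mul, h4, norm_one]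
  rw [norm_mul] at h5
  have h7 : 0 < ‖v k‖ := by
    rcases (norm_nonneg (v k)).lt_or_eq with h | h
    · exact h
    · rw [← h] at h6; simp at h6
  nlinarith

/-! ### Flags, slopes and summation by parts -/

/-- The subspace of vectors supported on the first `k` coordinates. -/
def coordFlag (n k : ℕ) : Submodule ℂ (Fin n → ℂ) where
  carrier := {v | ∀ i : Fin n, k ≤ i → v i = 0}
  add_mem' := fun {v w} hv hw i hi => by simp [hv i hi, hw i hi]
  zero_mem' := fun i _ => rfl
  smul_mem' := fun c v hv i hi => by simp [hv i hi]

/-- The dimension of the intersection of `V` with the `k`-th step of the flag given by the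
columns of `g`. -/
noncomputable def flagDim {n : ℕ} (g : Matrix (Fin n) (Fin n) ℂ) (V : Submodule ℂ (Fin n → ℂ))
    (k : ℕ) : ℕ :=
  Module.finrank ℂ ↥(coordFlag n k ⊓ V.comap g.mulVecLin)

/-- The parabolic slope of `V` for the weight `a` along the flag of `g`. -/
noncomputable def slope {n : ℕ} (a : Fin n → ℝ) (g : Matrix (Fin n) (Fin n) ℂ)
    (V : Submodule ℂ (Fin n → ℂ)) : ℝ :=
  ∑ k : Fin n, a k * ((flagDim g V (k + 1) : ℝ) - flagDim g V k)

theorem flagDim_zero {n : ℕ} (g : Matrix (Fin n) (Fin n) ℂ) (V : Submodule ℂ (Fin n → ℂ)) :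
    flagDim g V 0 = 0 := by
  have : coordFlag n 0 = ⊥ := by
    rw [eq_bot_iff]
    intro v hv
    exact (Submodule.mem_bot ℂ).2 (funext fun i => hv i (Nat.zero_le _))
  rw [flagDim, this, bot_inf_eq, finrank_bot]

theorem coordFlag_top {n k : ℕ} (h : n ≤ k) : coordFlag n k = ⊤ := by
  rw [eq_top_iff]
  intro v _ i hi
  exact absurd (h.trans hi) (not_le.2 i.2)

theorem flagDim_last {n : ℕ} {g : Matrix (Fin n) (Fin n) ℂ} (hg : IsUnit g.det)
    (V : Submodule ℂ (Fin n → ℂ)) : flagDim g V n = Module.finrank ℂ V := by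
  rw [flagDim, coordFlag_top le_rfl, top_inf_eq]
  have hi : Function.Injective g.mulVecLin :=
    Matrix.mulVec_injective_of_isUnit ((Matrix.isUnit_iff_isUnit_det g).2 hg)
  let φ := LinearEquiv.ofInjectiveEndo g.mulVecLin hi
  exact LinearEquiv.finrank_eq (φ.ofSubmodule' V)

/-- Summation by parts: a weakly decreasing weight bounded below by `c`. -/
theorem abel_lower {n : ℕ} {a : Fin n → ℝ} (ha : Antitone a) {D : ℕ → ℝ} (h0 : D 0 = 0)
    (hD : ∀ k ≤ n, 0 ≤ D k) {c : ℝ} (hc : ∀ i, c ≤ a i) :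
    c * D n ≤ ∑ k : Fin n, a k * (D (k + 1) - D k) := by
  induction n generalizing c with
  | zero => simp [h0]
  | succ n ih =>
    rw [Fin.sum_univ_castSucc]
    have h1 := ih (a := fun i => a i.castSucc) (fun i j h => ha (by simpa using h))
      (fun k hk => hD k (by omega)) (c := a (Fin.last n)) (fun i => ha (Fin.le_last _))
    have h2 := hD (n + 1) le_rfl
    have h3 := hc (Fin.last n)
    simp only [Fin.val_castSucc, Fin.val_last] at h1 ⊢
    nlinarith [mul_le_mul_of_nonneg_right h3 h2]

theorem abel_le {n : ℕ} {a : Fin n → ℝ} (ha : Antitone a) {F F' : ℕ → ℝ} (h0 : F 0 = F' 0)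
    (hF : ∀ k ≤ n, F k ≤ F' k) (hn : F n = F' n ∨ ∀ i, 0 ≤ a i) :
    ∑ k : Fin n, a k * (F (k + 1) - F k) ≤ ∑ k : Fin n, a k * (F' (k + 1) - F' k) := by
  rw [← sub_nonneg, ← Finset.sum_sub_distrib]
  have key : ∀ k : Fin n, a k * (F' (k + 1) - F' k) - a k * (F (k + 1) - F k)
      = a k * ((F' - F) (k + 1) - (F' - F) k) := fun k => by simp only [Pi.sub_apply]; ring
  rw [Finset.sum_congr rfl fun k _ => key k]
  have h0' : (F' - F) 0 = 0 := by simp [h0]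
  have hD : ∀ k ≤ n, 0 ≤ (F' - F) k := fun k hk => by simp [hF k hk]
  rcases hn with hn | hn
  · rcases n with _ | n
    · simp
    · have := abel_lower ha h0' hD (c := a (Fin.last n)) (fun i => ha (Fin.le_last _))
      simpa [hn] using this
  · simpa using abel_lower ha h0' hD (c := 0) hn

/-- Passing to an ultrafilter limit of an entrywise bounded family of matrices. -/
theorem exists_tendsto_of_bounded {α m n : Type*} [Finite m] [Finite n] (𝒰 : Ultrafilter α)
    {f : α → Matrix m n ℂ} {B : ℝ} (h : ∀ᶠ x in (𝒰 : Filter α), ∀ i j, ‖f x i j‖ ≤ B) :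
    ∃ A, Filter.Tendsto f 𝒰 (nhds A) := by
  have hc : IsCompact (Set.pi Set.univ fun _ : m => Set.pi Set.univ fun _ : n =>
      Metric.closedBall (0 : ℂ) B) :=
    isCompact_univ_pi fun _ => isCompact_univ_pi fun _ => isCompact_closedBall 0 B
  obtain ⟨A, -, hA⟩ := hc.ultrafilter_le_nhds (𝒰.map f) (by
    rw [Filter.le_principal_iff]
    change ∀ᶠ x in (𝒰 : Filter α), f x ∈ _
    filter_upwards [h] with x hx i _ j _
    simpa using hx i j)
  exact ⟨A, hA⟩

theorem exists_tendsto_real_of_bounded {α m : Type*} [Finite m] (𝒰 : Ultrafilter α)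
    {f : α → m → ℝ} {B C : ℝ} (h : ∀ᶠ x in (𝒰 : Filter α), ∀ i, f x i ∈ Set.Icc B C) :
    ∃ A, Filter.Tendsto f 𝒰 (nhds A) := by
  have hc : IsCompact (Set.pi Set.univ fun _ : m => Set.Icc B C) :=
    isCompact_univ_pi fun _ => isCompact_Icc
  obtain ⟨A, -, hA⟩ := hc.ultrafilter_le_nhds (𝒰.map f) (by
    rw [Filter.le_principal_iff]
    change ∀ᶠ x in (𝒰 : Filter α), f x ∈ _
    filter_upwards [h] with x hx i _
    exact hx i)
  exact ⟨A, hA⟩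

theorem norm_sq_le_gram {m n : Type*} [Fintype m] (U : Matrix m n ℂ) (i : m) (j : n) :
    ‖U i j‖ ^ 2 ≤ ((Uᴴ * U) j j).re := by
  have : (Uᴴ * U) j j = ∑ i, ((‖U i j‖ ^ 2 : ℝ) : ℂ) := by
    rw [mul_apply]
    refine Finset.sum_congr rfl fun i _ => ?_
    rw [conjTranspose_apply, RCLike.star_def, ← Complex.normSq_eq_conj_mul_self,
      Complex.normSq_eq_norm_sq]
  rw [this, ← Complex.ofReal_sum, Complex.ofReal_re]
  exact Finset.single_le_sum (f := fun i => ‖U i j‖ ^ 2) (fun i _ => by positivity)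
      (Finset.mem_univ i)

/-- An orthonormal family of `d` vectors inside a subspace of dimension at least `d`. -/
theorem exists_frame {n d : ℕ} (W : Submodule ℂ (Fin n → ℂ)) (hd : d ≤ Module.finrank ℂ W) :
    ∃ X : Matrix (Fin n) (Fin d) ℂ, Xᴴ * X = 1 ∧ ∀ c, X *ᵥ c ∈ W := by
  let L := (WithLp.linearEquiv 2 ℂ (Fin n → ℂ))
  let W' : Submodule ℂ (EuclideanSpace ℂ (Fin n)) := W.comap L.toLinearMap
  have hr : Module.finrank ℂ W' = Module.finrank ℂ W :=
    LinearEquiv.finrank_eq (L.ofSubmodule' W)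
  let b := stdOrthonormalBasis ℂ W'
  let f : Fin d → Fin (Module.finrank ℂ W') := Fin.castLE (hr ▸ hd)
  refine ⟨Matrix.of fun i c => ((b (f c) : W') : EuclideanSpace ℂ (Fin n)) i, ?_, ?_⟩
  · ext c c'
    have h1 := orthonormal_iff_ite.1 b.orthonormal (f c) (f c')
    rw [Submodule.coe_inner, PiLp.inner_apply] at h1
    rw [mul_apply, one_apply]
    have : (f c = f c') ↔ c = c' := (Fin.castLE_injective _).eq_iff
    simp only [this] at h1
    rw [← h1]
    refine Finset.sum_congr rfl fun i _ => ?_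
    simp [mul_comm]
  · intro c
    have : (Matrix.of fun i c => ((b (f c) : W') : EuclideanSpace ℂ (Fin n)) i) *ᵥ c
        = ∑ t, c t • L ((b (f t) : W') : EuclideanSpace ℂ (Fin n)) := by
      ext i
      simp [mulVec, dotProduct, L, mul_comm]
    rw [this]
    exact Submodule.sum_mem _ fun t _ => Submodule.smul_mem _ _ (b (f t)).2

theorem le_finrank_of_frame {n d : ℕ} {W : Submodule ℂ (Fin n → ℂ)}
    {X : Matrix (Fin n) (Fin d) ℂ} {Y : Matrix (Fin d) (Fin n) ℂ}
    (hX : Y * X = 1) (h : ∀ c, X *ᵥ c ∈ W) :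
    d ≤ Module.finrank ℂ W := by
  let φ : (Fin d → ℂ) →ₗ[ℂ] W := X.mulVecLin.codRestrict W h
  have hinj : Function.Injective φ := by
    intro c c' hcc
    have h1 : X *ᵥ c = X *ᵥ c' := congrArg Subtype.val hcc
    have h2 := congrArg (Y *ᵥ ·) h1
    simpa [mulVec_mulVec, hX] using h2
  simpa using LinearMap.finrank_le_finrank_of_injective hinj

theorem finrank_range_of_frame {n d : ℕ} {X : Matrix (Fin n) (Fin d) ℂ}
    {Y : Matrix (Fin d) (Fin n) ℂ} (hX : Y * X = 1) :
    Module.finrank ℂ (LinearMap.range X.mulVecLin) = d := by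
  refine le_antisymm ?_ (le_finrank_of_frame hX fun c => ⟨c, rfl⟩)
  simpa using LinearMap.finrank_range_le X.mulVecLin

/-- A frame of full dimension spans. -/
theorem eq_range_of_frame {n d : ℕ} {W : Submodule ℂ (Fin n → ℂ)} {X : Matrix (Fin n) (Fin d) ℂ}
    {Y : Matrix (Fin d) (Fin n) ℂ}
    (hX : Y * X = 1) (h : ∀ c, X *ᵥ c ∈ W) (hd : Module.finrank ℂ W = d) :
    W = LinearMap.range X.mulVecLin := by
  symm
  refine Submodule.eq_of_le_of_finrank_eq ?_ ?_
  · rintro _ ⟨c, rfl⟩; exact h c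
  · rw [hd, finrank_range_of_frame hX]

section

/-! ### Semistability -/

/-- A datum assigns to each index a matrix whose diagonal blocks are frames of flags and whose
upper right block is the translation part; the lower left block plays no role. -/
abbrev Datum (p q : ℕ) (κ : Type) := κ → Matrix (Fin p ⊕ Fin q) (Fin p ⊕ Fin q) ℂ

variable {p q : ℕ} {κ : Type}

/-- A pair of subspaces is invariant when all differences of translation parts over the
indices of kind `false` map the second one to the first one. -/
def Inv (kind : κ → Bool) (e : Datum p q κ) (V : Submodule ℂ (Fin p → ℂ))
    (W : Submodule ℂ (Fin q → ℂ)) : Prop :=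
  ∀ i j, kind i = false → kind j = false → ∀ v ∈ W,
    ((e i).toBlocks₁₂ - (e j).toBlocks₁₂) *ᵥ v ∈ V

/-- The sum of the parabolic slopes of a pair of subspaces. -/
noncomputable def totalSlope [Fintype κ] (a : κ → Fin p → ℝ) (b : κ → Fin q → ℝ)
    (e : Datum p q κ) (V : Submodule ℂ (Fin p → ℂ)) (W : Submodule ℂ (Fin q → ℂ)) : ℝ :=
  ∑ j, (slope (a j) (e j).toBlocks₁₁ V + slope (b j) (e j).toBlocks₂₂ W)

/-- The diagonal blocks are invertible. -/
def IsFramed (e : Datum p q κ) : Prop :=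
  ∀ j, IsUnit (e j).toBlocks₁₁.det ∧ IsUnit (e j).toBlocks₂₂.det

/-- Semistability of a datum for given weights. -/
def Semistable [Fintype κ] (kind : κ → Bool) (a : κ → Fin p → ℝ) (b : κ → Fin q → ℝ)
    (e : Datum p q κ) : Prop :=
  IsFramed e ∧ ∀ V W, Inv kind e V W → totalSlope a b e V W ≤ 0

theorem mem_range_frame {n r : ℕ} {T : Matrix (Fin n) (Fin r) ℂ} (hT : Tᴴ * T = 1)
    {v : Fin n → ℂ} : v ∈ LinearMap.range T.mulVecLin ↔ (T * Tᴴ) *ᵥ v = v := by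
  constructor
  · rintro ⟨c, rfl⟩
    simp only [mulVecLin_apply, mulVec_mulVec]
    rw [Matrix.mul_assoc, hT, Matrix.mul_one]
  · intro h
    exact ⟨Tᴴ *ᵥ v, by rw [mulVecLin_apply, mulVec_mulVec, h]⟩

theorem range_frame_iff {n r d : ℕ} {T : Matrix (Fin n) (Fin r) ℂ} (hT : Tᴴ * T = 1)
    {X : Matrix (Fin n) (Fin d) ℂ} :
    (∀ c, X *ᵥ c ∈ LinearMap.range T.mulVecLin) ↔ T * Tᴴ * X = X := by
  simp only [mem_range_frame hT, mulVec_mulVec]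
  constructor
  · intro h
    exact Matrix.ext_of_mulVec_single fun i => h _
  · intro h c
    rw [h]

theorem frame_in_coordFlag_iff {n d k : ℕ} {X : Matrix (Fin n) (Fin d) ℂ} :
    (∀ c, X *ᵥ c ∈ coordFlag n k) ↔ ∀ i : Fin n, k ≤ i → ∀ t, X i t = 0 := by
  constructor
  · intro h i hi t
    have := h (Pi.single t 1) i hi
    simpa using this
  · intro h c i hi
    simp [mulVec, dotProduct, h i hi]

theorem norm_frame_le {n d : ℕ} {X : Matrix (Fin n) (Fin d) ℂ} (hX : Xᴴ * X = 1) (i : Fin n)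
    (j : Fin d) : ‖X i j‖ ≤ 1 := by
  have := norm_sq_le_gram X i j
  rw [hX, one_apply_eq, one_re] at this
  nlinarith [norm_nonneg (X i j)]

theorem tendsto_conjTranspose {α m n : Type*} {l : Filter α} {f : α → Matrix m n ℂ}
    {A : Matrix m n ℂ} (h : Filter.Tendsto f l (nhds A)) :
    Filter.Tendsto (fun x => (f x)ᴴ) l (nhds Aᴴ) :=
  (continuous_id.matrix_conjTranspose.tendsto A).comp h

theorem tendsto_mul {α m n k : Type*} [Fintype n] {l : Filter α} {f : α → Matrix m n ℂ}
    {g : α → Matrix n k ℂ} {A : Matrix m n ℂ} {B : Matrix n k ℂ}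
    (hf : Filter.Tendsto f l (nhds A)) (hg : Filter.Tendsto g l (nhds B)) :
    Filter.Tendsto (fun x => f x * g x) l (nhds (A * B)) := by
  refine tendsto_pi_nhds.2 fun i => tendsto_pi_nhds.2 fun j => ?_
  simp only [mul_apply]
  exact tendsto_finsetSum _ fun t _ => (tendsto_pi_nhds.1 (tendsto_pi_nhds.1 hf i) t).mul
    (tendsto_pi_nhds.1 (tendsto_pi_nhds.1 hg t) j)

/-- Flag dimensions are upper semicontinuous. -/
theorem le_flagDim_of_tendsto {α : Type*} (𝒰 : Ultrafilter α) {n r d k : ℕ}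
    {g : α → Matrix (Fin n) (Fin n) ℂ} {T : α → Matrix (Fin n) (Fin r) ℂ}
    {g₀ : Matrix (Fin n) (Fin n) ℂ} {T₀ : Matrix (Fin n) (Fin r) ℂ}
    (hg : Filter.Tendsto g 𝒰 (nhds g₀)) (hT : Filter.Tendsto T 𝒰 (nhds T₀))
    (h1 : ∀ x, (T x)ᴴ * T x = 1)
    (hd : ∀ x, d ≤ flagDim (g x) (LinearMap.range (T x).mulVecLin) k) :
    d ≤ flagDim g₀ (LinearMap.range T₀.mulVecLin) k := by
  choose X hX hXW using fun x => exists_frame _ (hd x)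
  obtain ⟨X₀, hX₀⟩ := exists_tendsto_of_bounded 𝒰
    (Filter.Eventually.of_forall fun x i j => norm_frame_le (hX x) i j)
  have h2 : T₀ᴴ * T₀ = 1 := by
    refine tendsto_nhds_unique (tendsto_mul (tendsto_conjTranspose hT) hT) ?_
    simp only [h1]; exact tendsto_const_nhds
  have h3 : X₀ᴴ * X₀ = 1 := by
    refine tendsto_nhds_unique (tendsto_mul (tendsto_conjTranspose hX₀) hX₀) ?_
    simp only [hX]; exact tendsto_const_nhds
  have h4 : T₀ * T₀ᴴ * (g₀ * X₀) = g₀ * X₀ := by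
    refine tendsto_nhds_unique
      (tendsto_mul (tendsto_mul hT (tendsto_conjTranspose hT)) (tendsto_mul hg hX₀)) ?_
    refine (tendsto_mul hg hX₀).congr fun x => ?_
    refine ((range_frame_iff (h1 x)).1 fun c => ?_).symm
    rw [← mulVec_mulVec]
    exact (hXW x c).2
  have h5 : ∀ i : Fin n, k ≤ i → ∀ t, X₀ i t = 0 := by
    intro i hi t
    have ht : Filter.Tendsto (fun x => X x i t) 𝒰 (nhds (X₀ i t)) :=
      (tendsto_pi_nhds.1 (tendsto_pi_nhds.1 hX₀ i)) t
    refine tendsto_nhds_unique ht ?_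
    refine tendsto_const_nhds.congr fun x => ?_
    exact (frame_in_coordFlag_iff.1 (fun c => (hXW x c).1) i hi t).symm
  refine le_finrank_of_frame h3 fun c => ⟨frame_in_coordFlag_iff.2 h5 c, ?_⟩
  have := (range_frame_iff h2).2 h4 c
  rwa [← mulVec_mulVec] at this

theorem map_mul_eq_one {n d : ℕ} (σ : ℂ →+* ℂ) {X : Matrix (Fin n) (Fin d) ℂ}
    {Y : Matrix (Fin d) (Fin n) ℂ} (h : Y * X = 1) : Y.map σ * X.map σ = 1 := by
  rw [← Matrix.map_mul, h, Matrix.map_one σ (map_zero σ) (map_one σ)]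

theorem map_mem_range {n r : ℕ} (σ : ℂ →+* ℂ) {X : Matrix (Fin n) (Fin r) ℂ} {v : Fin n → ℂ}
    (h : v ∈ LinearMap.range X.mulVecLin) :
    (σ ∘ v) ∈ LinearMap.range (X.map σ).mulVecLin := by
  obtain ⟨c, rfl⟩ := h
  refine ⟨σ ∘ c, ?_⟩
  ext i
  exact (RingHom.map_mulVec σ X c i).symm

theorem mulVec_mem_of_cols {n d : ℕ} {X : Matrix (Fin n) (Fin d) ℂ} {W : Submodule ℂ (Fin n → ℂ)}
    (h : ∀ t, (fun i => X i t) ∈ W) (c : Fin d → ℂ) : X *ᵥ c ∈ W := by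
  have : X *ᵥ c = ∑ t, c t • (fun i => X i t) := by
    ext i; simp [mulVec, dotProduct, mul_comm]
  rw [this]
  exact Submodule.sum_mem _ fun t _ => Submodule.smul_mem _ _ (h t)

/-- Applying a field endomorphism does not decrease flag dimensions. -/
theorem flagDim_le_map {n r : ℕ} (σ : ℂ →+* ℂ) (g : Matrix (Fin n) (Fin n) ℂ)
    (X : Matrix (Fin n) (Fin r) ℂ) (k : ℕ) :
    flagDim g (LinearMap.range X.mulVecLin) k
      ≤ flagDim (g.map σ) (LinearMap.range (X.map σ).mulVecLin) k := by
  obtain ⟨Y, hY, hYW⟩ := exists_frame (d := flagDim g (LinearMap.range X.mulVecLin) k)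
    (coordFlag n k ⊓ (LinearMap.range X.mulVecLin).comap g.mulVecLin) le_rfl
  refine le_finrank_of_frame (map_mul_eq_one σ hY) fun c => mulVec_mem_of_cols (fun t => ?_) c
  have h := hYW (Pi.single t 1)
  rw [mulVec_single_one] at h
  refine ⟨fun i hi => ?_, ?_⟩
  · have := h.1 i hi
    simp only [col_apply] at this
    simp [this]
  · have h2 := map_mem_range σ h.2
    have : (σ ∘ (g.mulVecLin (Y.col t))) = (g.map σ).mulVecLin (fun i => (Y.map σ) i t) := by
      ext i
      exact RingHom.map_mulVec σ g _ i
    rw [this] at h2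
    exact h2

theorem slope_le_of_flagDim_le {n : ℕ} {a : Fin n → ℝ} (ha : Antitone a)
    {g g' : Matrix (Fin n) (Fin n) ℂ} {V V' : Submodule ℂ (Fin n → ℂ)}
    (h : ∀ k, flagDim g V k ≤ flagDim g' V' k) (hn : flagDim g V n = flagDim g' V' n) :
    slope a g V ≤ slope a g' V' :=
  abel_le ha (F := fun k => (flagDim g V k : ℝ)) (F' := fun k => (flagDim g' V' k : ℝ))
    (by simp [flagDim_zero]) (fun k _ => by exact_mod_cast h k)
    (Or.inl (by exact_mod_cast hn))

theorem tendsto_toBlocks {α : Type*} {l : Filter α}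
    {f : α → Matrix (Fin p ⊕ Fin q) (Fin p ⊕ Fin q) ℂ}
    {A : Matrix (Fin p ⊕ Fin q) (Fin p ⊕ Fin q) ℂ} (h : Filter.Tendsto f l (nhds A)) :
    Filter.Tendsto (fun x => (f x).toBlocks₁₁) l (nhds A.toBlocks₁₁) ∧
    Filter.Tendsto (fun x => (f x).toBlocks₁₂) l (nhds A.toBlocks₁₂) ∧
    Filter.Tendsto (fun x => (f x).toBlocks₂₁) l (nhds A.toBlocks₂₁) ∧
    Filter.Tendsto (fun x => (f x).toBlocks₂₂) l (nhds A.toBlocks₂₂) := by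
  have h' := fun i j => tendsto_pi_nhds.1 (tendsto_pi_nhds.1 h i) j
  refine ⟨?_, ?_, ?_, ?_⟩ <;>
    exact tendsto_pi_nhds.2 fun i => tendsto_pi_nhds.2 fun j => h' _ _

theorem tendsto_det {α n : Type*} [Fintype n] [DecidableEq n] {l : Filter α}
    {f : α → Matrix n n ℂ} {A : Matrix n n ℂ} (h : Filter.Tendsto f l (nhds A)) :
    Filter.Tendsto (fun x => (f x).det) l (nhds A.det) :=
  (continuous_id.matrix_det.tendsto A).comp h

theorem isUnit_det_of_approx {n : ℕ} {l : Filter ℕ} [l.NeBot] {σ : ℕ → ℂ →+* ℂ}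
    {g g₀ : Matrix (Fin n) (Fin n) ℂ}
    (h : Filter.Tendsto (fun m => g.map (σ m)) l (nhds g₀)) (h0 : IsUnit g₀.det) :
    IsUnit g.det := by
  rw [isUnit_iff_ne_zero] at h0 ⊢
  intro hg
  refine h0 (tendsto_nhds_unique (tendsto_det h) ?_)
  refine tendsto_const_nhds.congr fun m => ?_
  have := RingHom.map_det (σ m) g
  rw [hg, map_zero] at this
  exact this

/-- Specialising the subspace `V` along approximating field endomorphisms: limits of Galois
conjugates of `V`, described by frames. -/
theorem exists_limit_frame {n : ℕ} (𝒰 : Ultrafilter ℕ) (σ : ℕ → ℂ →+* ℂ)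
    (V : Submodule ℂ (Fin n → ℂ)) :
    ∃ (r : ℕ) (X T₀ : Matrix (Fin n) (Fin r) ℂ) (T : ℕ → Matrix (Fin n) (Fin r) ℂ),
      V = LinearMap.range X.mulVecLin ∧ Xᴴ * X = 1 ∧
      Filter.Tendsto T 𝒰 (nhds T₀) ∧ (∀ m, (T m)ᴴ * T m = 1) ∧ T₀ᴴ * T₀ = 1 ∧
      (∀ m, LinearMap.range (X.map (σ m)).mulVecLin = LinearMap.range (T m).mulVecLin) ∧
      Module.finrank ℂ V = r := by
  obtain ⟨X, hX, hXV⟩ := exists_frame V le_rfl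
  have hr := fun m => finrank_range_of_frame (map_mul_eq_one (σ m) hX)
  choose T hT hTV using fun m => exists_frame (d := Module.finrank ℂ V)
    (LinearMap.range (X.map (σ m)).mulVecLin) (hr m).ge
  obtain ⟨T₀, hT₀⟩ := exists_tendsto_of_bounded 𝒰
    (Filter.Eventually.of_forall fun x i j => norm_frame_le (hT x) i j)
  refine ⟨_, X, T₀, T, eq_range_of_frame hX hXV rfl, hX, hT₀, hT, ?_,
    fun m => eq_range_of_frame (hT m) (hTV m) (hr m), rfl⟩
  refine tendsto_nhds_unique (tendsto_mul (tendsto_conjTranspose hT₀) hT₀) ?_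
  simp only [hT]; exact tendsto_const_nhds

theorem slope_le_limit {n r : ℕ} (𝒰 : Ultrafilter ℕ) {σ : ℕ → ℂ →+* ℂ}
    {g g₀ : Matrix (Fin n) (Fin n) ℂ} {X T₀ : Matrix (Fin n) (Fin r) ℂ}
    {T : ℕ → Matrix (Fin n) (Fin r) ℂ} {a : Fin n → ℝ} (ha : Antitone a)
    (hX : Xᴴ * X = 1) (hg : IsUnit g.det) (hg₀ : IsUnit g₀.det)
    (h : Filter.Tendsto (fun m => g.map (σ m)) 𝒰 (nhds g₀))
    (hT : Filter.Tendsto T 𝒰 (nhds T₀)) (h1 : ∀ m, (T m)ᴴ * T m = 1) (h2 : T₀ᴴ * T₀ = 1)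
    (hr : ∀ m, LinearMap.range (X.map (σ m)).mulVecLin = LinearMap.range (T m).mulVecLin) :
    slope a g (LinearMap.range X.mulVecLin) ≤ slope a g₀ (LinearMap.range T₀.mulVecLin) := by
  refine slope_le_of_flagDim_le ha (fun k => ?_) ?_
  · refine le_flagDim_of_tendsto 𝒰 h hT h1 fun m => ?_
    rw [← hr m]
    exact flagDim_le_map (σ m) g X k
  · rw [flagDim_last hg, flagDim_last hg₀, finrank_range_of_frame hX, finrank_range_of_frame h2]

/-- Semistability lifts from a datum to any datum some of whose Galois conjugates approximate
it. -/
theorem Semistable.of_approx [Fintype κ] {kind : κ → Bool} {a : κ → Fin p → ℝ}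
    {b : κ → Fin q → ℝ} (ha : ∀ j, Antitone (a j)) (hb : ∀ j, Antitone (b j))
    {e e₀ : Datum p q κ}
    (h : ∀ ε : ℝ, 0 < ε → ∃ σ : ℂ →+* ℂ, ∀ j s t, ‖σ (e j s t) - e₀ j s t‖ < ε)
    (h₀ : Semistable kind a b e₀) : Semistable kind a b e := by
  choose σ hσ using fun m : ℕ => h (1 / ((m : ℝ) + 1)) (by positivity)
  let 𝒰 : Ultrafilter ℕ := Filter.hyperfilter ℕ
  have hle : (𝒰 : Filter ℕ) ≤ Filter.atTop := Nat.hyperfilter_le_atTop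
  have hlim : ∀ j, Filter.Tendsto (fun m => (e j).map (σ m)) 𝒰 (nhds (e₀ j)) := by
    intro j
    refine tendsto_pi_nhds.2 fun s => tendsto_pi_nhds.2 fun t => ?_
    refine Filter.Tendsto.mono_left ?_ hle
    rw [tendsto_iff_norm_sub_tendsto_zero]
    exact squeeze_zero (fun _ => norm_nonneg _) (fun m => (hσ m j s t).le)
      tendsto_one_div_add_atTop_nhds_zero_nat
  have hfr : IsFramed e := fun j =>
    ⟨isUnit_det_of_approx (tendsto_toBlocks (hlim j)).1 (h₀.1 j).1,
      isUnit_det_of_approx (tendsto_toBlocks (hlim j)).2.2.2 (h₀.1 j).2⟩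
  refine ⟨hfr, fun V W hVW => ?_⟩
  obtain ⟨r, X, T₀, T, hV, hX, hT, hT1, hT2, hr, -⟩ := exists_limit_frame 𝒰 σ V
  obtain ⟨r', X', T₀', T', hW, hX', hT', hT1', hT2', hr', -⟩ := exists_limit_frame 𝒰 σ W
  refine le_trans ?_ (h₀.2 (LinearMap.range T₀.mulVecLin) (LinearMap.range T₀'.mulVecLin) ?_)
  · refine Finset.sum_le_sum fun j _ => add_le_add ?_ ?_
    · rw [hV]
      exact slope_le_limit 𝒰 (ha j) hX (hfr j).1 (h₀.1 j).1 (tendsto_toBlocks (hlim j)).1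
        hT hT1 hT2 hr
    · rw [hW]
      exact slope_le_limit 𝒰 (hb j) hX' (hfr j).2 (h₀.1 j).2 (tendsto_toBlocks (hlim j)).2.2.2
        hT' hT1' hT2' hr'
  · rintro i j hi hj _ ⟨c, rfl⟩
    rw [mulVecLin_apply, mulVec_mulVec]
    revert c
    rw [range_frame_iff hT2]
    have hY : Filter.Tendsto
        (fun m => (((e i).map (σ m)).toBlocks₁₂ - ((e j).map (σ m)).toBlocks₁₂) * T' m) 𝒰
        (nhds (((e₀ i).toBlocks₁₂ - (e₀ j).toBlocks₁₂) * T₀')) :=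
      tendsto_mul ((tendsto_toBlocks (hlim i)).2.1.sub (tendsto_toBlocks (hlim j)).2.1) hT'
    refine tendsto_nhds_unique (tendsto_mul (tendsto_mul hT (tendsto_conjTranspose hT)) hY) ?_
    refine hY.congr fun m => ((range_frame_iff (hT1 m)).1 fun c => ?_).symm
    rw [← mulVec_mulVec]
    obtain ⟨c', hc'⟩ : T' m *ᵥ c ∈ LinearMap.range (X'.map (σ m)).mulVecLin := by
      rw [hr' m]; exact ⟨c, rfl⟩
    rw [← hc', ← hr m, mulVecLin_apply, mulVec_mulVec]
    refine mulVec_mem_of_cols (fun t => ?_) c'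
    have h1 := hVW i j hi hj (X' *ᵥ Pi.single t 1) (by rw [hW]; exact ⟨_, rfl⟩)
    rw [hV] at h1
    have h2 := map_mem_range (σ m) h1
    convert h2 using 1
    ext s
    rw [mulVec_single_one]
    simp [mul_apply, mulVec, dotProduct, toBlocks₁₂]

end

/-! ### A generic point whose Galois conjugates are dense -/

theorem exists_ringHom_extend {A S M : Type*} [CommRing A] [IsDomain A] [Field S] [Field M]
    [IsAlgClosed M] [Algebra A S] [Module.IsTorsionFree A S] [Algebra.IsAlgebraic A S]
    (g : A →+* M) (hg : Function.Injective g) :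
    ∃ σ : S →+* M, ∀ x, σ (algebraMap A S x) = g x := by
  let := g.toAlgebra
  have : FaithfulSMul A M := (faithfulSMul_iff_algebraMap_injective A M).2 hg
  let φ : S →ₐ[A] M := IsAlgClosed.lift
  exact ⟨φ.toRingHom, fun x => φ.commutes x⟩

/-- Rescaling and translating a transcendence basis is realised by a field endomorphism. -/
theorem exists_ringHom_affine {K : Type*} [Field K] [Algebra K ℂ] {s : Type*} {v : s → ℂ}
    (hv : IsTranscendenceBasis K v) (c d : s → K) (hd : ∀ b, d b ≠ 0) :
    ∃ σ : ℂ →+* ℂ, ∀ b, σ (v b) = algebraMap K ℂ (c b) + algebraMap K ℂ (d b) * v b := by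
  let φ : MvPolynomial s K →ₐ[K] MvPolynomial s K :=
    MvPolynomial.aeval fun b => MvPolynomial.C (c b) + MvPolynomial.C (d b) * MvPolynomial.X b
  let ψ : MvPolynomial s K →ₐ[K] MvPolynomial s K :=
    MvPolynomial.aeval fun b =>
      MvPolynomial.C (d b)⁻¹ * (MvPolynomial.X b - MvPolynomial.C (c b))
  have hψφ : ψ.comp φ = AlgHom.id K _ := by
    refine MvPolynomial.algHom_ext fun b => ?_
    simp only [φ, ψ, AlgHom.comp_apply, MvPolynomial.aeval_X, map_add, map_mul,
      MvPolynomial.algHom_C, MvPolynomial.algebraMap_eq, AlgHom.id_apply]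
    rw [← mul_assoc, ← map_mul, mul_inv_cancel₀ (hd b)]
    simp
  have hφ : Function.Injective φ := by
    intro x y hxy
    have := congrArg ψ hxy
    simpa [← AlgHom.comp_apply, hψφ] using this
  have hind := hv.1
  let A := Algebra.adjoin K (Set.range v)
  let g : A →ₐ[K] ℂ := ((MvPolynomial.aeval v).comp φ).comp
    (AlgHomClass.toAlgHom hind.aevalEquiv.symm)
  have hg : Function.Injective g := by
    have h1 : Function.Injective (MvPolynomial.aeval v : MvPolynomial s K →ₐ[K] ℂ) := hind
    exact (h1.comp hφ).comp hind.aevalEquiv.symm.injective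
  have := hv.isAlgebraic
  obtain ⟨σ, hσ⟩ := exists_ringHom_extend (S := ℂ) (g : A →+* ℂ) hg
  refine ⟨σ, fun b => ?_⟩
  have h1 := hσ (hind.aevalEquiv (MvPolynomial.X b))
  rw [AlgebraicIndependent.algebraMap_aevalEquiv, MvPolynomial.aeval_X] at h1
  rw [h1]
  simp [g, φ]

theorem isAlgebraic_gaussian (x y : ℚ) : IsAlgebraic ℚ ((x : ℂ) + (y : ℂ) * I) := by
  have hI : IsAlgebraic ℚ I :=
    (Complex.isIntegral_rat_I).isAlgebraic
  have h1 : IsAlgebraic ℚ ((x : ℂ)) := isAlgebraic_algebraMap (A := ℂ) x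
  have h2 : IsAlgebraic ℚ ((y : ℂ)) := isAlgebraic_algebraMap (A := ℂ) y
  exact h1.add (h2.mul hI)

theorem exists_gaussian_near (z : ℂ) {ε : ℝ} (hε : 0 < ε) :
    ∃ x y : ℚ, ‖((x : ℂ) + (y : ℂ) * I) - z‖ < ε := by
  obtain ⟨x, hx⟩ := exists_rat_btwn (show z.re < z.re + ε / 2 by linarith)
  obtain ⟨y, hy⟩ := exists_rat_btwn (show z.im < z.im + ε / 2 by linarith)
  refine ⟨x, y, ?_⟩
  refine (Complex.norm_le_abs_re_add_abs_im _).trans_lt ?_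
  simp only [sub_re, add_re, ratCast_re, mul_re, I_re, mul_zero, ratCast_im, I_im, mul_one,
    sub_self, add_zero, sub_im, add_im, mul_im, zero_add]
  rw [abs_of_pos (by linarith), abs_of_pos (by linarith)]
  linarith

/-- There is a tuple of complex numbers whose conjugates under field endomorphisms of `ℂ` are
dense. -/
theorem exists_generic (ι : Type) [Finite ι] :
    ∃ e : ι → ℂ, ∀ e₀ : ι → ℂ, ∀ ε : ℝ, 0 < ε → ∃ σ : ℂ →+* ℂ, ∀ i, ‖σ (e i) - e₀ i‖ < ε := by
  classical
  let K := algebraicClosure ℚ ℂ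
  obtain ⟨s, hs⟩ := exists_isTranscendenceBasis K ℂ
  have : Algebra.IsAlgebraic ℚ K := algebraicClosure.isAlgebraic ℚ ℂ
  have hK : Cardinal.mk K ≤ Cardinal.aleph0 := by
    have := Algebra.IsAlgebraic.cardinalMk_le_max ℚ K
    simpa using this
  have hinf : Infinite s := by
    by_contra hfin
    rw [not_infinite_iff_finite] at hfin
    have h1 := IsAlgClosed.cardinal_le_max_transcendence_basis (R := K) _ hs
    simp only [Cardinal.lift_id] at h1
    have h2 : Cardinal.mk s ≤ Cardinal.aleph0 := Cardinal.mk_le_aleph0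
    have h3 := h1.trans (max_le (max_le hK h2) le_rfl)
    rw [Cardinal.mk_complex] at h3
    exact absurd h3 (not_le.2 Cardinal.aleph0_lt_continuum)
  obtain ⟨f⟩ : Nonempty (ι ↪ s) := by
    have := Fintype.ofFinite ι
    obtain ⟨g⟩ := Function.Embedding.exists_of_card_le_finset (α := ι) (s := (Finset.univ.map
      ((Fintype.equivFin ι).toEmbedding.trans (Fin.valEmbedding.trans (Infinite.natEmbedding s)))))
      (by simp)
    exact ⟨g⟩
  refine ⟨fun i => (f i : ℂ), fun e₀ ε hε => ?_⟩
  choose x y hxy using fun i => exists_gaussian_near (e₀ i) (half_pos hε)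
  have := Fintype.ofFinite ι
  obtain ⟨N, hN⟩ : ∃ N : ℕ, ∀ i, ‖(f i : ℂ)‖ * 2 / ε < N := by
    obtain ⟨N, hN⟩ := exists_nat_gt (∑ i, ‖(f i : ℂ)‖ * 2 / ε)
    refine ⟨N, fun i => lt_of_le_of_lt ?_ hN⟩
    exact Finset.single_le_sum (f := fun i => ‖(f i : ℂ)‖ * 2 / ε)
      (fun i _ => by positivity) (Finset.mem_univ i)
  let c : ι → K := fun i => ⟨(x i : ℂ) + (y i : ℂ) * I,
    mem_algebraicClosure_iff.2 (isAlgebraic_gaussian _ _)⟩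
  obtain ⟨σ, hσ⟩ := exists_ringHom_affine hs
    (Function.extend f c 0) (fun _ => ((N : K) + 1)⁻¹)
    (fun _ => inv_ne_zero (by exact_mod_cast Nat.succ_ne_zero N))
  refine ⟨σ, fun i => ?_⟩
  rw [hσ (f i), f.injective.extend_apply]
  have h1 : algebraMap K ℂ (c i) = (x i : ℂ) + (y i : ℂ) * I := rfl
  have h2 : algebraMap K ℂ ((N : K) + 1)⁻¹ = ((N : ℂ) + 1)⁻¹ := by simp
  rw [h1, h2, add_sub_right_comm]
  refine (norm_add_le _ _).trans_lt ?_
  have h3 : ‖((N : ℂ) + 1)⁻¹ * (f i : ℂ)‖ < ε / 2 := by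
    have hn : ‖((N : ℂ) + 1)⁻¹‖ = ((N : ℝ) + 1)⁻¹ := by
      rw [norm_inv]
      congr 1
      have : ((N : ℂ) + 1) = ((N + 1 : ℝ) : ℂ) := by push_cast; ring
      rw [this, Complex.norm_real, Real.norm_of_nonneg (by positivity)]
    rw [norm_mul, hn, inv_mul_eq_div, div_lt_iff₀ (by positivity)]
    have := hN i
    rw [div_lt_iff₀ hε] at this
    linarith
  linarith [hxy i]

/-- A datum that is semistable for every weight admitting some semistable datum. -/
theorem exists_generic_datum (p q : ℕ) (κ : Type) [Fintype κ] :
    ∃ e : Datum p q κ, ∀ (kind : κ → Bool) (a : κ → Fin p → ℝ) (b : κ → Fin q → ℝ),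
      (∀ j, Antitone (a j)) → (∀ j, Antitone (b j)) →
      ∀ e₀, Semistable kind a b e₀ → Semistable kind a b e := by
  obtain ⟨e, he⟩ := exists_generic (κ × (Fin p ⊕ Fin q) × (Fin p ⊕ Fin q))
  refine ⟨fun j => Matrix.of fun s t => e (j, s, t), fun kind a b ha hb e₀ h₀ => ?_⟩
  refine h₀.of_approx ha hb fun ε hε => ?_
  obtain ⟨σ, hσ⟩ := he (fun x => e₀ x.1 x.2.1 x.2.2) ε hε
  exact ⟨σ, fun j s t => hσ (j, s, t)⟩

/-! ### Solutions of the Horn problem are semistable -/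

theorem exists_normalizer {r : ℕ} {G : Matrix (Fin r) (Fin r) ℂ} (hG : G.PosDef) :
    ∃ τ : Matrix (Fin r) (Fin r) ℂ, IsUnit τ.det ∧ τᴴ * G * τ = 1 := by
  obtain ⟨U, -, hU, rfl⟩ := exists_cholesky hG
  refine ⟨U⁻¹, Matrix.isUnit_nonsing_inv_det_iff.2 hU, ?_⟩
  have h1 : U * U⁻¹ = 1 := mul_nonsing_inv _ hU
  have h2 : (U⁻¹)ᴴ * Uᴴ = 1 := by rw [← conjTranspose_mul, h1, conjTranspose_one]
  rw [← Matrix.mul_assoc, h2, Matrix.one_mul, h1]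

theorem sum_lt_succ_sub {n : ℕ} (ρ : Fin n → ℝ) (k : Fin n) :
    (∑ i : Fin n, if (i : ℕ) < (k : ℕ) + 1 then ρ i else 0)
      - (∑ i : Fin n, if (i : ℕ) < k then ρ i else 0) = ρ k := by
  rw [← Finset.sum_sub_distrib, Finset.sum_eq_single k]
  · simp
  · intro i _ hik
    have : (i : ℕ) ≠ k := fun h => hik (Fin.ext h)
    by_cases h : (i : ℕ) < k
    · simp [h, Nat.lt_succ_of_lt h]
    · simp [h, show ¬ (i : ℕ) < k + 1 by omega]
  · simp

theorem flagDim_eq_one_comap {n : ℕ} (g : Matrix (Fin n) (Fin n) ℂ) (V : Submodule ℂ (Fin n → ℂ))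
    (k : ℕ) : flagDim g V k = flagDim 1 (V.comap g.mulVecLin) k := by
  rw [flagDim, flagDim, Matrix.mulVecLin_one, Submodule.comap_id]

theorem slope_eq_one_comap {n : ℕ} (a : Fin n → ℝ) (g : Matrix (Fin n) (Fin n) ℂ)
    (V : Submodule ℂ (Fin n → ℂ)) : slope a g V = slope a 1 (V.comap g.mulVecLin) := by
  simp only [slope, flagDim_eq_one_comap g V]

theorem posSemidef_one_sub_frame {n d : ℕ} {Y : Matrix (Fin n) (Fin d) ℂ} (hY : Yᴴ * Y = 1) :
    (1 - Y * Yᴴ).PosSemidef := by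
  have : (1 - Y * Yᴴ) = (1 - Y * Yᴴ)ᴴ * (1 - Y * Yᴴ) := by
    simp only [conjTranspose_sub, conjTranspose_one, conjTranspose_mul, conjTranspose_conjTranspose,
      Matrix.sub_mul, Matrix.mul_sub, Matrix.one_mul, Matrix.mul_one]
    have : Y * Yᴴ * (Y * Yᴴ) = Y * Yᴴ := by
      rw [Matrix.mul_assoc, ← Matrix.mul_assoc Yᴴ, hY, Matrix.one_mul]
    rw [this]; simp
  rw [this]
  exact posSemidef_conjTranspose_mul_self _

/-- A Ky Fan type bound: the mass of the first rows of an expanding matrix bounds the dimension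
of the intersection of its range with the coordinate flag. -/
theorem flagDim_le_rows {n r : ℕ} {B : Matrix (Fin n) (Fin r) ℂ} (hB : (Bᴴ * B - 1).PosSemidef)
    (k : ℕ) : (flagDim 1 (LinearMap.range B.mulVecLin) k : ℝ)
      ≤ ∑ i : Fin n, if (i : ℕ) < k then ((B * Bᴴ) i i).re else 0 := by
  set d := flagDim 1 (LinearMap.range B.mulVecLin) k with hd
  have h1 : d ≤ Module.finrank ℂ ↥((coordFlag n k).comap B.mulVecLin) := by
    rw [hd, flagDim, Matrix.mulVecLin_one, Submodule.comap_id, inf_comm, ← Submodule.map_comap_eq]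
    exact Submodule.finrank_map_le _ _
  obtain ⟨Y, hY, hYW⟩ := exists_frame _ h1
  have hrow : ∀ i : Fin n, k ≤ i → ∀ t, (B * Y) i t = 0 := by
    refine frame_in_coordFlag_iff.1 fun c => ?_
    rw [← mulVec_mulVec]; exact hYW c
  have h2 : (d : ℝ) ≤ (((B * Y) * (B * Y)ᴴ).trace).re := by
    have h3 := (hB.conjTranspose_mul_mul_same Y).trace_nonneg
    rw [Matrix.mul_sub, Matrix.sub_mul, Matrix.mul_one, hY, trace_sub, trace_one,
      Fintype.card_fin] at h3
    have h4 : Yᴴ * (Bᴴ * B) * Y = (B * Y)ᴴ * (B * Y) := by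
      rw [conjTranspose_mul]; simp only [Matrix.mul_assoc]
    rw [h4, trace_mul_comm] at h3
    have := (Complex.le_def.1 h3).1
    simpa using this
  refine h2.trans ?_
  rw [trace, Complex.re_sum]
  refine Finset.sum_le_sum fun i _ => ?_
  rw [diag_apply]
  split_ifs with hi
  · have h5 := ((posSemidef_one_sub_frame hY).mul_mul_conjTranspose_same B).diag_nonneg (i := i)
    rw [Matrix.mul_sub, Matrix.sub_mul, Matrix.mul_one, Matrix.sub_apply] at h5
    have h6 : B * (Y * Yᴴ) * Bᴴ = (B * Y) * (B * Y)ᴴ := by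
      rw [conjTranspose_mul]; simp only [Matrix.mul_assoc]
    rw [h6] at h5
    have := (Complex.le_def.1 h5).1
    simpa using this
  · rw [mul_apply]
    simp [hrow i (not_lt.1 hi)]

theorem trace_diag_re {n r : ℕ} (a : Fin n → ℝ) (B : Matrix (Fin n) (Fin r) ℂ) :
    ((Bᴴ * diagonal (fun i => (a i : ℂ)) * B).trace).re = ∑ i, a i * ((B * Bᴴ) i i).re := by
  rw [Matrix.mul_assoc, trace_mul_comm, Matrix.mul_assoc, trace, Complex.re_sum]
  refine Finset.sum_congr rfl fun i _ => ?_
  rw [diag_apply, diagonal_mul, Complex.re_ofReal_mul]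

theorem slope_le_trace {n r : ℕ} {a : Fin n → ℝ} (ha : Antitone a) {B : Matrix (Fin n) (Fin r) ℂ}
    (hB : (Bᴴ * B - 1).PosSemidef) (h : Bᴴ * B = 1 ∨ ∀ i, 0 ≤ a i) :
    slope a 1 (LinearMap.range B.mulVecLin)
      ≤ ((Bᴴ * diagonal (fun i => (a i : ℂ)) * B).trace).re := by
  rw [trace_diag_re, slope]
  have key := abel_le ha (F := fun k => (flagDim 1 (LinearMap.range B.mulVecLin) k : ℝ))
    (F' := fun k => ∑ i : Fin n, if (i : ℕ) < k then ((B * Bᴴ) i i).re else 0)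
    (by simp [flagDim_zero]) (fun k _ => flagDim_le_rows hB k) (h.imp (fun h1 => ?_) id)
  · refine key.trans (Finset.sum_le_sum fun k _ => ?_)
    exact (congrArg (a k * ·) (sum_lt_succ_sub (fun i => ((B * Bᴴ) i i).re) k)).le
  · rw [flagDim_last (by simp), finrank_range_of_frame h1]
    have h2 : ((Bᴴ * B).trace).re = r := by rw [h1]; simp
    rw [trace_mul_comm, trace, Complex.re_sum] at h2
    simpa using h2.symm

/-- The signature matrix in block form. -/
def sgn (p q : ℕ) : Matrix (Fin p ⊕ Fin q) (Fin p ⊕ Fin q) ℂ := fromBlocks 1 0 0 (-1)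

/-- The weight matrix `diag (a, -b)` in block form. -/
def wt {p q : ℕ} (a : Fin p → ℝ) (b : Fin q → ℝ) : Matrix (Fin p ⊕ Fin q) (Fin p ⊕ Fin q) ℂ :=
  fromBlocks (diagonal fun i => (a i : ℂ)) 0 0 (-diagonal fun i => (b i : ℂ))

theorem sgn_mul_sgn (p q : ℕ) : sgn p q * sgn p q = 1 := by
  simp [sgn, fromBlocks_multiply]

theorem sgn_conjTranspose (p q : ℕ) : (sgn p q)ᴴ = sgn p q := by
  simp [sgn, fromBlocks_conjTranspose]

theorem trace_fromBlocks' {m n : Type*} [Fintype m] [Fintype n] (A : Matrix m m ℂ)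
    (B : Matrix m n ℂ) (C : Matrix n m ℂ) (D : Matrix n n ℂ) :
    (fromBlocks A B C D).trace = A.trace + D.trace := by
  simp [trace, Fintype.sum_sum_type]

theorem range_mul_isUnit {n r : ℕ} (B : Matrix (Fin n) (Fin r) ℂ) {τ : Matrix (Fin r) (Fin r) ℂ}
    (hτ : IsUnit τ.det) :
    LinearMap.range (B * τ).mulVecLin = LinearMap.range B.mulVecLin := by
  refine le_antisymm ?_ ?_
  · rintro _ ⟨c, rfl⟩
    exact ⟨τ *ᵥ c, by simp [mulVec_mulVec]⟩
  · rintro _ ⟨c, rfl⟩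
    refine ⟨τ⁻¹ *ᵥ c, ?_⟩
    simp [mulVec_mulVec, mul_nonsing_inv _ hτ]

theorem slope_le_trace_block {p q r r' : ℕ} {a : Fin p → ℝ} {b : Fin q → ℝ} (ha : Antitone a)
    (hb : Antitone b) (ha0 : ∀ i, 0 ≤ a i) (hb0 : ∀ i, b i ≤ 0)
    {B₁ : Matrix (Fin p) (Fin r) ℂ} {B₂ : Matrix (Fin q) (Fin r) ℂ} {B₃ : Matrix (Fin q) (Fin r') ℂ}
    (hP : (B₁ᴴ * B₁ - B₂ᴴ * B₂).PosDef) (hN : (B₃ᴴ * B₃).PosDef)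
    {H : Matrix (Fin r ⊕ Fin r') (Fin r ⊕ Fin r') ℂ}
    (hH : H = (fromBlocks B₁ 0 B₂ B₃)ᴴ * sgn p q * fromBlocks B₁ 0 B₂ B₃) :
    IsUnit H.det ∧ slope a 1 (LinearMap.range B₁.mulVecLin) +
      slope b 1 (LinearMap.range B₃.mulVecLin) ≤
      ((H⁻¹ * ((fromBlocks B₁ 0 B₂ B₃)ᴴ * wt a b * fromBlocks B₁ 0 B₂ B₃)).trace).re := by
  obtain ⟨τ₂, hτ₂, hτ₂'⟩ := exists_normalizer hN
  set C := B₃ * τ₂ with hC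
  have hCC : Cᴴ * C = 1 := by
    rw [← hτ₂', hC, conjTranspose_mul]; simp only [Matrix.mul_assoc]
  have hS : ((B₁ᴴ * B₁ - B₂ᴴ * B₂) + (Cᴴ * B₂)ᴴ * (Cᴴ * B₂)).PosDef :=
    hP.add_posSemidef (posSemidef_conjTranspose_mul_self _)
  obtain ⟨τ₁, hτ₁, hτ₁'⟩ := exists_normalizer hS
  set D₁ := B₁ * τ₁ with hD₁
  set D₂ := (B₂ - C * Cᴴ * B₂) * τ₁ with hD₂
  set τ : Matrix (Fin r ⊕ Fin r') (Fin r ⊕ Fin r') ℂ :=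
    fromBlocks τ₁ 0 (-(τ₂ * Cᴴ * B₂ * τ₁)) τ₂ with hτ
  have hBτ : fromBlocks B₁ 0 B₂ B₃ * τ = fromBlocks D₁ 0 D₂ C := by
    rw [hτ, fromBlocks_multiply, hD₁, hD₂, hC]
    congr 1
    · simp
    · simp
    · simp only [Matrix.mul_neg, Matrix.sub_mul, Matrix.mul_assoc]
      rw [← sub_eq_add_neg]
    · simp
  have hτdet : IsUnit τ.det := by
    rw [hτ, det_fromBlocks_zero₁₂]; exact hτ₁.mul hτ₂
  have hCD : Cᴴ * D₂ = 0 := by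
    rw [hD₂, ← Matrix.mul_assoc, Matrix.mul_sub, Matrix.mul_assoc C, ← Matrix.mul_assoc Cᴴ C, hCC,
      Matrix.one_mul, sub_self, Matrix.zero_mul]
  have hDC : D₂ᴴ * C = 0 := by
    have := congrArg conjTranspose hCD
    simpa [conjTranspose_mul] using this
  have hDD : D₁ᴴ * D₁ - D₂ᴴ * D₂ = 1 := by
    have h1 : D₂ᴴ * D₂ = τ₁ᴴ * (B₂ᴴ * B₂ - (Cᴴ * B₂)ᴴ * (Cᴴ * B₂)) * τ₁ := by
      have h2 : D₂ᴴ * D₂ = D₂ᴴ * (B₂ * τ₁) := by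
        have h3 : D₂ = B₂ * τ₁ - C * (Cᴴ * B₂ * τ₁) := by
          rw [hD₂, Matrix.sub_mul]; simp only [Matrix.mul_assoc]
        calc D₂ᴴ * D₂ = D₂ᴴ * (B₂ * τ₁ - C * (Cᴴ * B₂ * τ₁)) := congrArg (D₂ᴴ * ·) h3
          _ = _ := by rw [Matrix.mul_sub, ← Matrix.mul_assoc D₂ᴴ C, hDC, Matrix.zero_mul, sub_zero]
      rw [h2, hD₂]
      simp only [conjTranspose_mul, conjTranspose_sub, conjTranspose_conjTranspose, Matrix.mul_sub,
        Matrix.sub_mul, Matrix.mul_assoc]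
    rw [h1, ← hτ₁', hD₁, conjTranspose_mul]
    simp only [Matrix.mul_sub, Matrix.sub_mul, Matrix.mul_add, Matrix.add_mul, Matrix.mul_assoc]
    abel
  have hτH : τᴴ * H * τ = sgn r r' := by
    have : τᴴ * H * τ = (fromBlocks D₁ 0 D₂ C)ᴴ * sgn p q * fromBlocks D₁ 0 D₂ C := by
      rw [← hBτ, hH, conjTranspose_mul]; simp only [Matrix.mul_assoc]
    rw [this, sgn, sgn, fromBlocks_conjTranspose, fromBlocks_multiply, fromBlocks_multiply]
    congr 1
    · simp [← hDD, sub_eq_add_neg]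
    · simp [hDC]
    · simp [hCD]
    · simp [hCC]
  have hinv : (τ * sgn r r' * τᴴ) * H = 1 := by
    have h1 : (τ * sgn r r' * τᴴ) * H = τ * sgn r r' * (τᴴ * H * τ) * τ⁻¹ := by
      simp only [Matrix.mul_assoc, mul_nonsing_inv _ hτdet, Matrix.mul_one]
    rw [h1, hτH, Matrix.mul_assoc τ, sgn_mul_sgn, Matrix.mul_one, mul_nonsing_inv _ hτdet]
  have hHinv : H⁻¹ = τ * sgn r r' * τᴴ := inv_eq_left_inv hinv
  refine ⟨isUnit_det_of_left_inverse hinv, ?_⟩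
  have htr : (H⁻¹ * ((fromBlocks B₁ 0 B₂ B₃)ᴴ * wt a b * fromBlocks B₁ 0 B₂ B₃)).trace
      = (sgn r r' * ((fromBlocks D₁ 0 D₂ C)ᴴ * wt a b * fromBlocks D₁ 0 D₂ C)).trace := by
    rw [hHinv, ← hBτ, Matrix.mul_assoc τ, Matrix.mul_assoc τ, trace_mul_comm τ, conjTranspose_mul]
    simp only [Matrix.mul_assoc]
  rw [htr, wt, sgn, fromBlocks_conjTranspose, fromBlocks_multiply, fromBlocks_multiply,
    fromBlocks_multiply, trace_fromBlocks']
  simp only [conjTranspose_zero, Matrix.zero_mul, Matrix.mul_zero, add_zero, zero_add,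
    Matrix.one_mul, Matrix.mul_neg, Matrix.neg_mul, neg_neg, trace_add, trace_neg, add_re, neg_re,
    neg_zero]
  have e1 := slope_le_trace ha (B := D₁) (by
    rw [show D₁ᴴ * D₁ - 1 = D₂ᴴ * D₂ by rw [← hDD]; abel]
    exact posSemidef_conjTranspose_mul_self _) (Or.inr ha0)
  have e2 := slope_le_trace hb (B := C) (by rw [hCC, sub_self]; exact PosSemidef.zero)
    (Or.inl hCC)
  rw [← range_mul_isUnit B₁ hτ₁, ← range_mul_isUnit B₃ hτ₂, ← hD₁, ← hC]
  have e3 : ((D₂ᴴ * diagonal (fun i => (b i : ℂ)) * D₂).trace).re ≤ 0 := by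
    rw [trace_diag_re]
    refine Finset.sum_nonpos fun i _ => mul_nonpos_of_nonpos_of_nonneg (hb0 i) ?_
    exact (Complex.le_def.1 (posSemidef_self_mul_conjTranspose D₂).diag_nonneg).1
  linarith

theorem comap_range_of_mul_eq_one {n r : ℕ} {g h : Matrix (Fin n) (Fin n) ℂ} (hgh : g * h = 1)
    (T : Matrix (Fin n) (Fin r) ℂ) :
    (LinearMap.range T.mulVecLin).comap g.mulVecLin = LinearMap.range (h * T).mulVecLin := by
  have hhg : h * g = 1 := mul_eq_one_comm.1 hgh
  ext v
  simp only [Submodule.mem_comap, LinearMap.mem_range, mulVecLin_apply]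
  constructor
  · rintro ⟨c, hc⟩
    exact ⟨c, by rw [← mulVec_mulVec, hc, mulVec_mulVec, hhg, one_mulVec]⟩
  · rintro ⟨c, rfl⟩
    exact ⟨c, by rw [mulVec_mulVec, ← Matrix.mul_assoc, hgh, Matrix.one_mul]⟩

theorem sgn_mul_wt_mul_sgn {p q : ℕ} (a : Fin p → ℝ) (b : Fin q → ℝ) :
    sgn p q * wt a b * sgn p q = wt a b := by
  rw [sgn, wt, fromBlocks_multiply, fromBlocks_multiply]
  simp only [Matrix.one_mul, Matrix.mul_one, Matrix.zero_mul, Matrix.mul_zero, add_zero, zero_add,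
    Matrix.neg_mul, Matrix.mul_neg, neg_neg, neg_zero]

/-- The matrix parametrising a pair of subspaces with frames `S`, `T` inside the graph of `Z`. -/
def pairFrame {p q r r' : ℕ} (Z : Matrix (Fin p) (Fin q) ℂ) (S : Matrix (Fin p) (Fin r) ℂ)
    (T : Matrix (Fin q) (Fin r') ℂ) : Matrix (Fin p ⊕ Fin q) (Fin r ⊕ Fin r') ℂ :=
  fromBlocks S (Z * T) 0 T

/-- The trace of a matrix compressed to a nondegenerate pair. -/
noncomputable def compTrace {p q r r' : ℕ} (B : Matrix (Fin p ⊕ Fin q) (Fin r ⊕ Fin r') ℂ)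
    (M : Matrix (Fin p ⊕ Fin q) (Fin p ⊕ Fin q) ℂ) : ℝ :=
  (((Bᴴ * sgn p q * B)⁻¹ * (Bᴴ * (sgn p q * M * sgn p q) * B)).trace).re

theorem compTrace_mul_isUnit {p q r r' : ℕ} (B : Matrix (Fin p ⊕ Fin q) (Fin r ⊕ Fin r') ℂ)
    {u : Matrix (Fin r ⊕ Fin r') (Fin r ⊕ Fin r') ℂ} (hu : IsUnit u.det)
    (M : Matrix (Fin p ⊕ Fin q) (Fin p ⊕ Fin q) ℂ) : compTrace (B * u) M = compTrace B M := by
  have hu' : IsUnit (uᴴ).det := by rw [det_conjTranspose]; exact hu.star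
  have h1 : ∀ X : Matrix (Fin p ⊕ Fin q) (Fin p ⊕ Fin q) ℂ,
      (B * u)ᴴ * X * (B * u) = uᴴ * (Bᴴ * X * B) * u := fun X => by
    rw [conjTranspose_mul]; simp only [Matrix.mul_assoc]
  unfold compTrace
  rw [h1, h1, Matrix.mul_inv_rev, Matrix.mul_inv_rev, Matrix.mul_assoc u⁻¹, trace_mul_comm u⁻¹]
  congr 2
  simp only [Matrix.mul_assoc]
  rw [mul_nonsing_inv _ hu, Matrix.mul_one, ← Matrix.mul_assoc (uᴴ)⁻¹, nonsing_inv_mul _ hu',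
    Matrix.one_mul]

theorem compTrace_sum {p q r r' : ℕ} {κ : Type} [Fintype κ]
    (B : Matrix (Fin p ⊕ Fin q) (Fin r ⊕ Fin r') ℂ)
    (M : κ → Matrix (Fin p ⊕ Fin q) (Fin p ⊕ Fin q) ℂ) :
    compTrace B (∑ j, M j) = ∑ j, compTrace B (M j) := by
  simp only [compTrace, Matrix.mul_sum, Matrix.sum_mul, trace_sum, Complex.re_sum]

theorem pseudo_mul {p q : ℕ} {k : Matrix (Fin p ⊕ Fin q) (Fin p ⊕ Fin q) ℂ}
    (hk : kᴴ * sgn p q * k = sgn p q) : k * sgn p q * kᴴ = sgn p q := by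
  have h1 : (sgn p q * kᴴ * sgn p q) * k = 1 := by
    rw [Matrix.mul_assoc, Matrix.mul_assoc, ← Matrix.mul_assoc kᴴ, hk, sgn_mul_sgn]
  have h2 := mul_eq_one_comm.1 h1
  have h3 := congrArg (· * sgn p q) h2
  simp only [Matrix.mul_assoc, sgn_mul_sgn, Matrix.mul_one, Matrix.one_mul] at h3
  have h4 := congrArg (sgn p q * ·) h3
  simp only [Matrix.mul_assoc] at h3 ⊢
  exact h3

theorem pseudo_blocks {p q : ℕ} {α : Matrix (Fin p) (Fin p) ℂ} {β : Matrix (Fin p) (Fin q) ℂ}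
    {γ : Matrix (Fin q) (Fin p) ℂ} {δ : Matrix (Fin q) (Fin q) ℂ}
    (hk : (fromBlocks α β γ δ)ᴴ * sgn p q * fromBlocks α β γ δ = sgn p q) :
    αᴴ * α = 1 + γᴴ * γ ∧ αᴴ * β = γᴴ * δ ∧ δᴴ * δ = 1 + βᴴ * β := by
  rw [sgn, fromBlocks_conjTranspose, fromBlocks_multiply, fromBlocks_multiply,
    fromBlocks_inj] at hk
  simp only [Matrix.mul_one, Matrix.mul_zero, add_zero, zero_add, Matrix.mul_neg,
    Matrix.neg_mul] at hk
  obtain ⟨h1, h2, -, h4⟩ := hk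
  refine ⟨?_, ?_, ?_⟩
  · rw [← h1]; abel
  · rw [← sub_eq_zero, ← h2]; abel
  · rw [← sub_eq_zero, ← neg_eq_zero, ← sub_eq_zero_of_eq h4]; abel

theorem pseudo_isUnit {p q : ℕ} {α : Matrix (Fin p) (Fin p) ℂ} {β : Matrix (Fin p) (Fin q) ℂ}
    {γ : Matrix (Fin q) (Fin p) ℂ} {δ : Matrix (Fin q) (Fin q) ℂ}
    (hk : (fromBlocks α β γ δ)ᴴ * sgn p q * fromBlocks α β γ δ = sgn p q) :
    IsUnit α.det ∧ IsUnit δ.det := by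
  obtain ⟨h1, -, h3⟩ := pseudo_blocks hk
  have key : ∀ {n m : ℕ} (A : Matrix (Fin n) (Fin n) ℂ) (B : Matrix (Fin m) (Fin n) ℂ),
      Aᴴ * A = 1 + Bᴴ * B → IsUnit A.det := fun A B h => by
    have h5 : (Aᴴ * A).PosDef := by
      rw [h]; exact PosDef.one.add_posSemidef (posSemidef_conjTranspose_mul_self _)
    have := h5.det_pos.ne'
    rw [det_mul] at this
    exact isUnit_iff_ne_zero.2 (right_ne_zero_of_mul this)
  exact ⟨key _ _ h1, key _ _ h3⟩

theorem slope_le_compTrace_false {p q r r' : ℕ} {a : Fin p → ℝ} {b : Fin q → ℝ} (ha : Antitone a)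
    (hb : Antitone b) (ha0 : ∀ i, 0 ≤ a i) (hb0 : ∀ i, b i ≤ 0)
    {α : Matrix (Fin p) (Fin p) ℂ} {β : Matrix (Fin p) (Fin q) ℂ}
    {γ : Matrix (Fin q) (Fin p) ℂ} {δ : Matrix (Fin q) (Fin q) ℂ}
    (hk : (fromBlocks α β γ δ)ᴴ * sgn p q * fromBlocks α β γ δ = sgn p q)
    {S : Matrix (Fin p) (Fin r) ℂ} {T : Matrix (Fin q) (Fin r') ℂ} (hS : Sᴴ * S = 1)
    (hT : Tᴴ * T = 1) :
    slope a (αᴴ)⁻¹ (LinearMap.range S.mulVecLin) + slope b δ (LinearMap.range T.mulVecLin)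
      ≤ compTrace (pairFrame (β * δ⁻¹) S T)
        (fromBlocks α β γ δ * wt a b * (fromBlocks α β γ δ)ᴴ) := by
  obtain ⟨hα, hδ⟩ := pseudo_isUnit hk
  obtain ⟨h1, h2, h3⟩ := pseudo_blocks hk
  have hk' := pseudo_mul hk
  have hα' : IsUnit (αᴴ).det := by rw [det_conjTranspose]; exact hα.star
  have h4 : α * αᴴ - β * βᴴ = 1 := by
    have h := hk'
    rw [sgn, fromBlocks_conjTranspose, fromBlocks_multiply, fromBlocks_multiply,
      fromBlocks_inj] at h
    have h := h.1
    simp only [Matrix.mul_one, Matrix.mul_zero, add_zero, zero_add, Matrix.mul_neg,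
      Matrix.neg_mul] at h
    rw [← h]; abel
  set k := fromBlocks α β γ δ with hkdef
  set P := pairFrame (β * δ⁻¹) S T with hP
  have hB : sgn p q * kᴴ * sgn p q * P = fromBlocks (αᴴ * S) 0 (-(βᴴ * S)) (δ⁻¹ * T) := by
    rw [hkdef, hP, sgn, pairFrame, fromBlocks_conjTranspose, fromBlocks_multiply,
      fromBlocks_multiply, fromBlocks_multiply]
    simp only [Matrix.one_mul, Matrix.zero_mul, Matrix.mul_one, Matrix.mul_zero, add_zero, zero_add,
      Matrix.mul_neg, Matrix.neg_mul, neg_neg]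
    congr 1
    · rw [← Matrix.mul_assoc, ← Matrix.mul_assoc, h2, Matrix.mul_assoc γᴴ, mul_nonsing_inv _ hδ,
        Matrix.mul_one, add_neg_cancel]
    · have h5 : δᴴ = δ⁻¹ + βᴴ * (β * δ⁻¹) := by
        have := congrArg (· * δ⁻¹) h3
        simpa only [Matrix.mul_assoc, mul_nonsing_inv _ hδ, Matrix.mul_one, Matrix.add_mul,
          Matrix.one_mul] using this
      conv_lhs => rw [h5]
      simp only [Matrix.add_mul, Matrix.mul_assoc]
      abel
  have key := (slope_le_trace_block (B₁ := αᴴ * S) (B₂ := -(βᴴ * S)) (B₃ := δ⁻¹ * T) ha hb ha0 hb0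
    (by
      have : (αᴴ * S)ᴴ * (αᴴ * S) - (-(βᴴ * S))ᴴ * (-(βᴴ * S)) = Sᴴ * (α * αᴴ - β * βᴴ) * S := by
        simp only [conjTranspose_mul, conjTranspose_neg, conjTranspose_conjTranspose,
          Matrix.neg_mul, Matrix.mul_neg, neg_neg, Matrix.mul_sub, Matrix.sub_mul, Matrix.mul_assoc]
      rw [this, h4, Matrix.mul_one, hS]; exact PosDef.one)
    (by
      refine PosDef.conjTranspose_mul_self _ ?_
      intro v w hvw
      have h6 := congrArg (fun x => (Tᴴ * δ) *ᵥ x) hvw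
      simp only [mulVec_mulVec] at h6
      have h7 : Tᴴ * δ * (δ⁻¹ * T) = 1 := by
        rw [Matrix.mul_assoc, ← Matrix.mul_assoc δ, mul_nonsing_inv _ hδ, Matrix.one_mul, hT]
      simpa [h7] using h6) rfl).2
  rw [slope_eq_one_comap a, slope_eq_one_comap b,
    comap_range_of_mul_eq_one (nonsing_inv_mul _ hα'),
    comap_range_of_mul_eq_one (mul_nonsing_inv _ hδ)]
  refine key.trans (le_of_eq ?_)
  rw [← hB]
  have h8 : ∀ X, (sgn p q * kᴴ * sgn p q * P)ᴴ * X * (sgn p q * kᴴ * sgn p q * P)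
      = Pᴴ * (sgn p q * (k * (sgn p q * X * sgn p q) * kᴴ) * sgn p q) * P := fun X => by
    simp only [conjTranspose_mul, conjTranspose_conjTranspose, sgn_conjTranspose, Matrix.mul_assoc]
  rw [h8, h8, sgn_mul_wt_mul_sgn, sgn_mul_sgn, Matrix.one_mul, hk', sgn_mul_sgn, Matrix.one_mul]
  rfl

theorem slope_le_compTrace_true {p q r r' : ℕ} {a : Fin p → ℝ} {b : Fin q → ℝ} (ha : Antitone a)
    (hb : Antitone b) (ha0 : ∀ i, a i ≤ 0) (hb0 : ∀ i, 0 ≤ b i) {Z : Matrix (Fin p) (Fin q) ℂ}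
    {S : Matrix (Fin p) (Fin r) ℂ} {T : Matrix (Fin q) (Fin r') ℂ} (hS : Sᴴ * S = 1)
    (hT : (Tᴴ * T - (Z * T)ᴴ * (Z * T)).PosDef) :
    slope a 1 (LinearMap.range S.mulVecLin) + slope b 1 (LinearMap.range T.mulVecLin)
      ≤ compTrace (pairFrame Z S T) (wt a b) := by
  have key := (slope_le_trace_block (B₁ := T) (B₂ := Z * T) (B₃ := S) hb ha hb0 ha0 hT
    (by rw [hS]; exact PosDef.one) rfl).2
  rw [add_comm]
  refine key.trans (le_of_eq ?_)
  let e := Equiv.sumComm (Fin r') (Fin r)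
  let f := Equiv.sumComm (Fin q) (Fin p)
  have h1 : fromBlocks T 0 (Z * T) S = (pairFrame Z S T).submatrix f e := by
    ext (i | i) (j | j) <;> rfl
  have h2 : sgn q p = -(sgn p q).submatrix f f := by
    ext (i | i) (j | j) <;> simp [sgn, f]
  have h3 : wt b a = -(wt a b).submatrix f f := by
    ext (i | i) (j | j) <;> simp [wt, f, -fromBlocks_diagonal, -diagonal_neg]
  have h4 : ∀ X : Matrix (Fin p ⊕ Fin q) (Fin p ⊕ Fin q) ℂ,
      ((pairFrame Z S T).submatrix f e)ᴴ * (-(X.submatrix f f)) * (pairFrame Z S T).submatrix f e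
      = -((pairFrame Z S T)ᴴ * X * pairFrame Z S T).submatrix e e := fun X => by
    rw [conjTranspose_submatrix, Matrix.mul_neg, Matrix.neg_mul, submatrix_mul_equiv,
      submatrix_mul_equiv]
  have h5 : ∀ X : Matrix (Fin r ⊕ Fin r') (Fin r ⊕ Fin r') ℂ,
      (-(X.submatrix e e))⁻¹ = -(X⁻¹.submatrix e e) := fun X => by
    rw [← inv_submatrix_equiv]
    by_cases hX : IsUnit (X.submatrix e e).det
    · refine inv_eq_left_inv ?_
      rw [Matrix.neg_mul, Matrix.mul_neg, neg_neg, nonsing_inv_mul _ hX]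
    · rw [nonsing_inv_apply_not_isUnit _ hX, nonsing_inv_apply_not_isUnit, neg_zero]
      rwa [det_neg, IsUnit.mul_iff, not_and_or, or_iff_right]
      rw [not_not]; exact (isUnit_one.neg).pow _
  rw [h1, h2, h3, h4, h4, h5, Matrix.neg_mul, Matrix.mul_neg, neg_neg, submatrix_mul_equiv,
    compTrace,
    sgn_mul_wt_mul_sgn]
  congr 1
  exact (e.sum_comp fun i => ((((pairFrame Z S T)ᴴ * sgn p q * pairFrame Z S T)⁻¹ *
    ((pairFrame Z S T)ᴴ * wt a b * pairFrame Z S T)) i i))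

theorem exists_frame_range {n : ℕ} (V : Submodule ℂ (Fin n → ℂ)) :
    ∃ (r : ℕ) (S : Matrix (Fin n) (Fin r) ℂ), Sᴴ * S = 1 ∧ V = LinearMap.range S.mulVecLin := by
  obtain ⟨S, hS, hSV⟩ := exists_frame V le_rfl
  exact ⟨_, S, hS, eq_range_of_frame hS hSV rfl⟩

/-- Solutions of the Horn equation give semistable data. -/
theorem exists_semistable_of_solution {p q : ℕ} {κ : Type} [Fintype κ] {kind : κ → Bool}
    {a : κ → Fin p → ℝ} {b : κ → Fin q → ℝ} (ha : ∀ j, Antitone (a j)) (hb : ∀ j, Antitone (b j))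
    (hf : ∀ j, kind j = false → (∀ i, 0 ≤ a j i) ∧ ∀ i, b j i ≤ 0)
    (ht : ∀ j, kind j = true → (∀ i, a j i ≤ 0) ∧ ∀ i, 0 ≤ b j i)
    {k : κ → Matrix (Fin p ⊕ Fin q) (Fin p ⊕ Fin q) ℂ}
    (hk : ∀ j, (k j)ᴴ * sgn p q * k j = sgn p q) (hk1 : ∀ j, kind j = true → k j = 1)
    {j₀ : κ} (hj₀ : kind j₀ = false) (hsum : ∑ j, k j * wt (a j) (b j) * (k j)ᴴ = 0) :
    ∃ e : Datum p q κ, Semistable kind a b e := by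
  have hblk : ∀ j, fromBlocks (k j).toBlocks₁₁ (k j).toBlocks₁₂ (k j).toBlocks₂₁ (k j).toBlocks₂₂
      = k j := fun j => fromBlocks_toBlocks (k j)
  have hk2 : ∀ j, (fromBlocks (k j).toBlocks₁₁ (k j).toBlocks₁₂ (k j).toBlocks₂₁
      (k j).toBlocks₂₂)ᴴ * sgn p q * fromBlocks (k j).toBlocks₁₁ (k j).toBlocks₁₂ (k j).toBlocks₂₁
      (k j).toBlocks₂₂ = sgn p q := fun j => by rw [hblk]; exact hk j
  set Z : κ → Matrix (Fin p) (Fin q) ℂ := fun j => (k j).toBlocks₁₂ * ((k j).toBlocks₂₂)⁻¹ with hZ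
  refine ⟨fun j => fromBlocks (((k j).toBlocks₁₁)ᴴ)⁻¹ (Z j) 0 (k j).toBlocks₂₂, fun j => ?_, ?_⟩
  · rw [toBlocks_fromBlocks₁₁, toBlocks_fromBlocks₂₂]
    refine ⟨?_, (pseudo_isUnit (hk2 j)).2⟩
    rw [isUnit_nonsing_inv_det_iff, det_conjTranspose]
    exact (pseudo_isUnit (hk2 j)).1.star
  intro V W hVW
  obtain ⟨r, S, hS, rfl⟩ := exists_frame_range V
  obtain ⟨r', T, hT, rfl⟩ := exists_frame_range W
  have hC : ∀ j, kind j = false → ∃ u : Matrix (Fin r ⊕ Fin r') (Fin r ⊕ Fin r') ℂ, IsUnit u.det ∧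
      pairFrame (Z j) S T = pairFrame (Z j₀) S T * u := by
    intro j hj
    refine ⟨fromBlocks 1 (Sᴴ * ((Z j - Z j₀) * T)) 0 1, by simp, ?_⟩
    have h1 : S * Sᴴ * ((Z j - Z j₀) * T) = (Z j - Z j₀) * T := by
      refine (range_frame_iff hS).1 fun c => ?_
      rw [← mulVec_mulVec]
      have := hVW j j₀ hj hj₀ (T *ᵥ c) ⟨c, rfl⟩
      simpa only [toBlocks_fromBlocks₁₂] using this
    rw [pairFrame, pairFrame, fromBlocks_multiply]
    congr 1
    · simp
    · rw [← Matrix.mul_assoc, h1, Matrix.mul_one, Matrix.sub_mul]; abel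
    · simp
    · simp
  have hterm : ∀ j, slope (a j) (((k j).toBlocks₁₁)ᴴ)⁻¹ (LinearMap.range S.mulVecLin) +
      slope (b j) (k j).toBlocks₂₂ (LinearMap.range T.mulVecLin)
      ≤ compTrace (pairFrame (Z j₀) S T) (k j * wt (a j) (b j) * (k j)ᴴ) := by
    intro j
    cases hj : kind j with
    | false =>
      obtain ⟨u, hu, hu'⟩ := hC j hj
      rw [← compTrace_mul_isUnit _ hu, ← hu']
      have := slope_le_compTrace_false (ha j) (hb j) (hf j hj).1 (hf j hj).2 (hk2 j) hS hT
      rwa [hblk] at this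
    | true =>
      have h1 : (k j).toBlocks₁₁ = 1 ∧ (k j).toBlocks₂₂ = 1 := by
        rw [hk1 j hj, ← fromBlocks_one]
        exact ⟨toBlocks_fromBlocks₁₁ _ _ _ _, toBlocks_fromBlocks₂₂ _ _ _ _⟩
      rw [h1.1, h1.2, hk1 j hj, conjTranspose_one, inv_one, Matrix.one_mul,
        conjTranspose_one, Matrix.mul_one]
      refine slope_le_compTrace_true (ha j) (hb j) (ht j hj).1 (ht j hj).2 hS ?_
      have hδ := (pseudo_isUnit (hk2 j₀)).2
      have h2 := (pseudo_blocks (hk2 j₀)).2.2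
      set δ := (k j₀).toBlocks₂₂
      set β := (k j₀).toBlocks₁₂
      have h3 : 1 - (Z j₀)ᴴ * Z j₀ = (δ⁻¹)ᴴ * δ⁻¹ := by
        have h4 : δ * δ⁻¹ = 1 := mul_nonsing_inv _ hδ
        have h5 : (δ⁻¹)ᴴ * δᴴ = 1 := by rw [← conjTranspose_mul, h4, conjTranspose_one]
        have h6 := congrArg (fun x => (δ⁻¹)ᴴ * x * δ⁻¹) h2
        simp only [Matrix.mul_add, Matrix.add_mul, Matrix.mul_one] at h6
        rw [← Matrix.mul_assoc, h5, Matrix.one_mul, h4] at h6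
        rw [h6, hZ]
        simp only [conjTranspose_mul, Matrix.mul_assoc]
        exact add_sub_cancel_right _ _
      have h7 : Tᴴ * T - (Z j₀ * T)ᴴ * (Z j₀ * T) = (δ⁻¹ * T)ᴴ * (δ⁻¹ * T) := by
        have : (δ⁻¹ * T)ᴴ * (δ⁻¹ * T) = Tᴴ * ((δ⁻¹)ᴴ * δ⁻¹) * T := by
          rw [conjTranspose_mul]; simp only [Matrix.mul_assoc]
        rw [this, ← h3, conjTranspose_mul]
        simp only [Matrix.mul_sub, Matrix.sub_mul, Matrix.mul_one, Matrix.mul_assoc]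
      rw [h7]
      refine PosDef.conjTranspose_mul_self _ ?_
      intro v w hvw
      have h6 := congrArg (fun x => (Tᴴ * δ) *ᵥ x) hvw
      simp only [mulVec_mulVec] at h6
      have h7 : Tᴴ * δ * (δ⁻¹ * T) = 1 := by
        rw [Matrix.mul_assoc, ← Matrix.mul_assoc δ, mul_nonsing_inv _ hδ, Matrix.one_mul, hT]
      simpa [h7] using h6
  simp only [totalSlope, toBlocks_fromBlocks₁₁, toBlocks_fromBlocks₂₂]
  refine (Finset.sum_le_sum fun j _ => hterm j).trans ?_
  rw [← compTrace_sum, hsum]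
  simp [compTrace]

section

/-! ### Triangular factorisations with signature -/

/-- The spectral theorem for complex Hermitian matrices. -/
theorem exists_spectral {n : ℕ} {H : Matrix (Fin n) (Fin n) ℂ} (hH : H.IsHermitian) :
    ∃ (V : Matrix (Fin n) (Fin n) ℂ) (l : Fin n → ℝ), Vᴴ * V = 1 ∧ V * Vᴴ = 1 ∧
      H = V * diagonal (fun i => (l i : ℂ)) * Vᴴ := by
  refine ⟨hH.eigenvectorUnitary, hH.eigenvalues, ?_, ?_, ?_⟩
  · exact Unitary.coe_star_mul_self hH.eigenvectorUnitary
  · exact Unitary.coe_mul_star_self hH.eigenvectorUnitary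
  · have := hH.spectral_theorem
    rw [Unitary.conjStarAlgAut_apply] at this
    exact this

theorem exists_bound_hermitian {n : ℕ} {H : Matrix (Fin n) (Fin n) ℂ} (hH : H.IsHermitian) :
    ∃ C : ℝ, 0 ≤ C ∧ ((C : ℂ) • 1 - H).PosSemidef ∧ ((C : ℂ) • 1 + H).PosSemidef := by
  obtain ⟨V, l, h1, h2, h3⟩ := exists_spectral hH
  have hl : ∀ i, |l i| ≤ ∑ i, |l i| := fun i =>
    Finset.single_le_sum (f := fun i => |l i|) (fun _ _ => abs_nonneg _) (Finset.mem_univ i)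
  have key : ∀ m : Fin n → ℝ, (∀ i, 0 ≤ m i) →
      (V * diagonal (fun i => (m i : ℂ)) * Vᴴ).PosSemidef := fun m hm =>
    (PosSemidef.diagonal fun i => by
      show (0 : ℂ) ≤ (m i : ℂ)
      exact_mod_cast hm i).mul_mul_conjTranspose_same V
  have hone : ∀ C : ℝ, ((C : ℂ) • (1 : Matrix (Fin n) (Fin n) ℂ))
      = V * diagonal (fun _ => (C : ℂ)) * Vᴴ := fun C => by
    rw [← h2, ← smul_one_eq_diagonal]; simp
  refine ⟨∑ i, |l i|, Finset.sum_nonneg fun _ _ => abs_nonneg _, ?_, ?_⟩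
  · have := key (fun i => (∑ i, |l i|) - l i) fun i => by linarith [hl i, le_abs_self (l i)]
    rw [hone, h3, ← Matrix.sub_mul, ← Matrix.mul_sub, diagonal_sub]
    simpa only [Complex.ofReal_sub] using this
  · have := key (fun i => (∑ i, |l i|) + l i) fun i => by linarith [hl i, neg_abs_le (l i)]
    rw [hone, h3, ← Matrix.add_mul, ← Matrix.mul_add, diagonal_add]
    simpa only [Complex.ofReal_add] using this

theorem eventually_posDef_one_add {n : ℕ} {H : Matrix (Fin n) (Fin n) ℂ} (hH : H.IsHermitian) :
    ∀ᶠ t : ℝ in nhds 0, (1 + (t : ℂ) • H).PosDef := by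
  obtain ⟨C, hC, h1, h2⟩ := exists_bound_hermitian hH
  have hC1 : 0 < 1 / (C + 1) := by positivity
  filter_upwards [Metric.ball_mem_nhds (0 : ℝ) hC1] with t ht
  rw [mem_ball_zero_iff, Real.norm_eq_abs, lt_div_iff₀ (by positivity)] at ht
  have h3 : 0 < 1 - |t| * C := by nlinarith [abs_nonneg t]
  have h4 : (((1 - |t| * C : ℝ) : ℂ) • (1 : Matrix (Fin n) (Fin n) ℂ)).PosDef :=
    PosDef.one.smul (by exact_mod_cast h3)
  rcases le_total 0 t with h | h
  · have h5 := h4.add_posSemidef (h2.smul (a := (t : ℂ)) (by exact_mod_cast h))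
    rw [abs_of_nonneg h] at h5
    convert h5 using 1
    rw [smul_add, smul_smul, ← add_assoc, ← add_smul]
    push_cast
    simp
  · have h5 := h4.add_posSemidef (h1.smul (a := ((-t : ℝ) : ℂ)) (by
      exact_mod_cast neg_nonneg.2 h))
    rw [abs_of_nonpos h] at h5
    convert h5 using 1
    rw [smul_sub, smul_smul, add_sub, ← add_smul]
    push_cast
    simp [sub_eq_add_neg]

/-- The position of a basis vector in the ordering attached to a kind. -/
def pos {p q : ℕ} : Bool → Fin p ⊕ Fin q → ℕ
  | true, Sum.inl i => i
  | true, Sum.inr j => p + j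
  | false, Sum.inr j => j
  | false, Sum.inl i => q + i

theorem pos_injective {p q : ℕ} (k : Bool) : Function.Injective (pos (p := p) (q := q) k) := by
  rintro (i | i) (j | j) h <;> cases k <;> simp only [pos] at h
  all_goals (congr 1; omega)

theorem blockTriangular_true {p q : ℕ} {A : Matrix (Fin p) (Fin p) ℂ} {B : Matrix (Fin p) (Fin q) ℂ}
    {C : Matrix (Fin q) (Fin p) ℂ} {D : Matrix (Fin q) (Fin q) ℂ} :
    (fromBlocks A B C D).BlockTriangular (pos true) ↔
      A.BlockTriangular id ∧ C = 0 ∧ D.BlockTriangular id := by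
  constructor
  · intro h
    refine ⟨fun i j hij => h (i := Sum.inl i) (j := Sum.inl j) hij, ?_,
      fun i j hij => h (i := Sum.inr i) (j := Sum.inr j) (Nat.add_lt_add_left hij p)⟩
    ext i j
    exact h (i := Sum.inr i) (j := Sum.inl j) (by simp only [pos]; omega)
  · rintro ⟨h1, h2, h3⟩ (i | i) (j | j) hij
    · exact h1 hij
    · simp only [pos] at hij; omega
    · simp [h2]
    · exact h3 (Nat.lt_of_add_lt_add_left hij)

theorem blockTriangular_false {p q : ℕ} {A : Matrix (Fin p) (Fin p) ℂ}
    {B : Matrix (Fin p) (Fin q) ℂ} {C : Matrix (Fin q) (Fin p) ℂ} {D : Matrix (Fin q) (Fin q) ℂ} :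
    (fromBlocks A B C D).BlockTriangular (pos false) ↔
      A.BlockTriangular id ∧ B = 0 ∧ D.BlockTriangular id := by
  constructor
  · intro h
    refine ⟨fun i j hij => h (i := Sum.inl i) (j := Sum.inl j) (Nat.add_lt_add_left hij q), ?_,
      fun i j hij => h (i := Sum.inr i) (j := Sum.inr j) hij⟩
    ext i j
    exact h (i := Sum.inl i) (j := Sum.inr j) (by simp only [pos]; omega)
  · rintro ⟨h1, h2, h3⟩ (i | i) (j | j) hij
    · exact h1 (Nat.lt_of_add_lt_add_left hij)
    · simp [h2]
    · simp only [pos] at hij; omega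
    · exact h3 hij

/-- Block matrices of the correct signature have a triangular factorisation. -/
theorem exists_sgn_factor {p q : ℕ} (k : Bool) {A : Matrix (Fin p) (Fin p) ℂ}
    {B : Matrix (Fin p) (Fin q) ℂ} {G : Matrix (Fin q) (Fin q) ℂ} (hA : A.PosDef) (hG : G.PosDef) :
    ∃ U : Matrix (Fin p ⊕ Fin q) (Fin p ⊕ Fin q) ℂ, U.BlockTriangular (pos k) ∧ IsUnit U.det ∧
      Uᴴ * sgn p q * U = fromBlocks A B Bᴴ (-G) := by
  cases k with
  | true =>
    obtain ⟨U, hU, hU', rfl⟩ := exists_cholesky hA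
    have hUH : IsUnit (Uᴴ).det := by rw [det_conjTranspose]; exact hU'.star
    set C := (Uᴴ)⁻¹ * B with hC
    have hUC : Uᴴ * C = B := by rw [hC, ← Matrix.mul_assoc, mul_nonsing_inv _ hUH, Matrix.one_mul]
    have hCU : Cᴴ * U = Bᴴ := by
      have := congrArg conjTranspose hUC
      simpa [conjTranspose_mul] using this
    obtain ⟨W, hW, hW', hWG⟩ := exists_cholesky
      (hG.add_posSemidef (posSemidef_conjTranspose_mul_self C))
    refine ⟨fromBlocks U C 0 W, blockTriangular_true.2 ⟨hU, rfl, hW⟩, ?_, ?_⟩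
    · rw [det_fromBlocks_zero₂₁]; exact hU'.mul hW'
    · rw [sgn, fromBlocks_conjTranspose, fromBlocks_multiply, fromBlocks_multiply]
      congr 1
      · simp
      · simp [hUC]
      · simp [hCU]
      · simp [hWG]
  | false =>
    obtain ⟨W, hW, hW', rfl⟩ := exists_cholesky hG
    have hWH : IsUnit (Wᴴ).det := by rw [det_conjTranspose]; exact hW'.star
    set C := -((Wᴴ)⁻¹ * Bᴴ) with hC
    have hWC : Wᴴ * C = -Bᴴ := by
      rw [hC, Matrix.mul_neg, ← Matrix.mul_assoc, mul_nonsing_inv _ hWH, Matrix.one_mul]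
    have hCW : Cᴴ * W = -B := by
      have := congrArg conjTranspose hWC
      simpa [conjTranspose_mul] using this
    obtain ⟨U, hU, hU', hUA⟩ := exists_cholesky
      (hA.add_posSemidef (posSemidef_conjTranspose_mul_self C))
    refine ⟨fromBlocks U 0 C W, blockTriangular_false.2 ⟨hU, rfl, hW⟩, ?_, ?_⟩
    · rw [det_fromBlocks_zero₁₂]; exact hU'.mul hW'
    · rw [sgn, fromBlocks_conjTranspose, fromBlocks_multiply, fromBlocks_multiply]
      congr 1
      · simp [hUA]
      · simp [hCW]
      · simp [hWC]
      · simp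

theorem sgn_eq_diagonal (p q : ℕ) : sgn p q = diagonal (Sum.elim (fun _ => 1) fun _ => -1) := by
  ext (i | i) (j | j) <;> simp [sgn, diagonal_apply, one_apply]
  split_ifs <;> simp

section Minors

variable {ι : Type}

/-- The leading principal block of a matrix for a given ordering. -/
def lead (b : ι → ℕ) (k : ℕ) (R : Matrix ι ι ℂ) : Matrix {l // b l < k} {l // b l < k} ℂ :=
  R.submatrix Subtype.val Subtype.val

variable [Fintype ι]

theorem sum_lead {b : ι → ℕ} {A : Type*} [AddCommMonoid A] (k : ℕ) (f : ι → A) :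
    ∑ l : {l // b l < k}, f l = ∑ l, if b l < k then f l else 0 := by
  rw [← Finset.sum_filter]
  exact (Finset.sum_subtype (p := fun l => b l < k) (Finset.univ.filter fun l => b l < k)
    (by simp) _).symm

theorem lead_mul {b : ι → ℕ} (k : ℕ) (R : Matrix ι ι ℂ) {U : Matrix ι ι ℂ}
    (hU : U.BlockTriangular b) : lead b k (R * U) = lead b k R * lead b k U := by
  ext i j
  simp only [lead, submatrix_apply, mul_apply]
  refine Eq.trans ?_ (sum_lead (b := b) k fun x => R i.1 x * U x j.1).symm
  refine Finset.sum_congr rfl fun l _ => ?_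
  split_ifs with h
  · rfl
  · rw [hU (by have := j.2; omega), mul_zero]

variable [DecidableEq ι]

theorem det_of_blockTriangular_injective {b : ι → ℕ} (hb : Function.Injective b) {U : Matrix ι ι ℂ}
    (hU : U.BlockTriangular b) : U.det = ∏ i, U i i := by
  classical
  let _ : LinearOrder ι := LinearOrder.lift' b hb
  have h : U.IsUpperTriangular := fun i j hij => hU hij
  have := det_of_isUpperTriangular h
  convert this

theorem norm_det_lead {b : ι → ℕ} (hb : Function.Injective b) {U : Matrix ι ι ℂ}
    (hU : U.BlockTriangular b) {ε : ι → ℂ} (hε : ∀ i, ‖ε i‖ = 1) (k : ℕ) :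
    ‖(lead b k (Uᴴ * diagonal ε * U)).det‖ = ∏ l : {l // b l < k}, ‖U l l‖ ^ 2 := by
  have hd : (diagonal ε).BlockTriangular b := blockTriangular_diagonal ε
  have hdet : (lead b k U).det = ∏ l : {l // b l < k}, U l l :=
    det_of_blockTriangular_injective (b := fun l : {l // b l < k} => b l)
      (fun x y h => Subtype.ext (hb h)) (fun i j hij => hU hij)
  have hdiag : (lead b k (diagonal ε)).det = ∏ l : {l // b l < k}, ε l := by
    rw [lead, submatrix_diagonal _ _ Subtype.val_injective, det_diagonal]; rfl
  have hH : lead b k Uᴴ = (lead b k U)ᴴ := rfl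
  rw [lead_mul k _ hU, lead_mul k _ hd, det_mul, det_mul, hH, det_conjTranspose, hdet, hdiag]
  simp only [norm_mul, norm_prod, norm_star, hε, Finset.prod_const_one, mul_one, ← sq,
    Finset.prod_pow]

theorem two_log_diag {b : ι → ℕ} (hb : Function.Injective b) {U : Matrix ι ι ℂ}
    (hU : U.BlockTriangular b) (hU' : IsUnit U.det) {ε : ι → ℂ} (hε : ∀ i, ‖ε i‖ = 1) (i : ι) :
    2 * Real.log ‖U i i‖ = Real.log ‖(lead b (b i + 1) (Uᴴ * diagonal ε * U)).det‖
      - Real.log ‖(lead b (b i) (Uᴴ * diagonal ε * U)).det‖ := by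
  have hne : ∀ l, ‖U l l‖ ^ 2 ≠ 0 := fun l => by
    rw [det_of_blockTriangular_injective hb hU, isUnit_iff_ne_zero, Finset.prod_ne_zero_iff] at hU'
    exact pow_ne_zero _ (norm_ne_zero_iff.2 (hU' l (Finset.mem_univ l)))
  have hsum : ∀ k, Real.log ‖(lead b k (Uᴴ * diagonal ε * U)).det‖
      = ∑ l, if b l < k then Real.log (‖U l l‖ ^ 2) else 0 := fun k => by
    rw [norm_det_lead hb hU hε, ← sum_lead]
    exact Real.log_prod fun l _ => hne l
  rw [hsum, hsum, ← Finset.sum_sub_distrib, Finset.sum_eq_single i]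
  · simp
  · intro l _ hl
    have : b l ≠ b i := fun h => hl (hb h)
    by_cases h : b l < b i
    · simp [h, Nat.lt_succ_of_lt h]
    · simp [h, show ¬ b l < b i + 1 by omega]
  · simp

theorem hasDerivAt_log_det {ν : Type} [Fintype ν] [DecidableEq ν] (A : Matrix ν ν ℂ) :
    HasDerivAt (fun t : ℝ => Real.log ‖(1 + (t : ℂ) • A).det‖) A.trace.re 0 := by
  have h1 : HasDerivAt (fun z : ℂ => (1 + z • A).det) A.trace 0 := by
    simp_rw [fun z : ℂ => det_one_add_smul z A]
    set P := (det (1 + (Polynomial.X : Polynomial ℂ) • A.map Polynomial.C)).divX.divX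
    have h2 := (((hasDerivAt_id (0 : ℂ)).const_mul A.trace).const_add 1).add
      ((P.hasDerivAt 0).mul ((hasDerivAt_id (0 : ℂ)).pow 2))
    exact h2.congr_deriv (by simp)
  have h2 : HasDerivAt (fun t : ℝ => (1 + (t : ℂ) • A).det) A.trace 0 := by
    have := h1.comp_ofReal (z := 0)
    simpa using this
  have h3 := h2.clog_real (by simp)
  have h4 := (Complex.reCLM.hasFDerivAt).comp_hasDerivAt (0 : ℝ) h3
  simpa [Function.comp_def, log_re] using h4

theorem hasDerivAt_log_det_lead {b : ι → ℕ} {ε : ι → ℂ}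
    (hε' : ∀ i, ε i * ε i = 1) (ρ : Matrix ι ι ℂ) (k : ℕ) :
    HasDerivAt (fun t : ℝ => Real.log ‖(lead b k (diagonal ε + (t : ℂ) • ρ)).det‖)
      (∑ l, if b l < k then (ε l * ρ l l).re else 0) 0 := by
  have hsplit : ∀ t : ℝ, ‖(lead b k (diagonal ε + (t : ℂ) • ρ)).det‖
      = ‖(1 + (t : ℂ) • (lead b k (diagonal ε) * lead b k ρ)).det‖ := fun t => by
    have hdd : lead b k (diagonal ε) * lead b k (diagonal ε) = 1 := by
      rw [← lead_mul k _ (blockTriangular_diagonal ε), diagonal_mul_diagonal]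
      simp only [hε', lead, diagonal_one]
      exact submatrix_one _ Subtype.val_injective
    have h1 : lead b k (diagonal ε + (t : ℂ) • ρ)
        = lead b k (diagonal ε) * (1 + (t : ℂ) • (lead b k (diagonal ε) * lead b k ρ)) := by
      rw [Matrix.mul_add, Matrix.mul_one, Matrix.mul_smul, ← Matrix.mul_assoc, hdd, Matrix.one_mul]
      rfl
    have h2 : ‖(lead b k (diagonal ε)).det‖ = 1 := by
      have := congrArg (fun M => ‖det M‖) hdd
      simp only [det_mul, det_one, norm_mul, norm_one] at this
      nlinarith [norm_nonneg (lead b k (diagonal ε)).det]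
    rw [h1, det_mul, norm_mul, h2, one_mul]
  simp only [hsplit]
  convert hasDerivAt_log_det (lead b k (diagonal ε) * lead b k ρ) using 1
  rw [trace, Complex.re_sum, ← sum_lead]
  refine Finset.sum_congr rfl fun l _ => ?_
  rw [lead, submatrix_diagonal _ _ Subtype.val_injective, diag_apply, diagonal_mul]
  rfl

end Minors

end

section

/-! ### Critical points of the Kempf–Ness function are solutions -/

variable {p q : ℕ} {κ : Type}

/-- The block upper triangular matrix attached to a framing. -/
def frameMat (E : Matrix (Fin p ⊕ Fin q) (Fin p ⊕ Fin q) ℂ) :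
    Matrix (Fin p ⊕ Fin q) (Fin p ⊕ Fin q) ℂ :=
  fromBlocks E.toBlocks₁₁ (E.toBlocks₁₂ * E.toBlocks₂₂) 0 E.toBlocks₂₂

/-- A form `P` together with triangular factorisations in all the frames. -/
def Feasible (kind : κ → Bool) (e : Datum p q κ) (P : Matrix (Fin p ⊕ Fin q) (Fin p ⊕ Fin q) ℂ)
    (U : Datum p q κ) : Prop :=
  ∀ j, (U j).BlockTriangular (pos (kind j)) ∧ IsUnit (U j).det ∧
    (U j)ᴴ * sgn p q * U j = (frameMat (e j))ᴴ * P * frameMat (e j)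

/-- The Kempf–Ness function. -/
noncomputable def energy [Fintype κ] (a : κ → Fin p → ℝ) (b : κ → Fin q → ℝ)
    (U : Datum p q κ) : ℝ :=
  ∑ j, ∑ k, Sum.elim (a j) (b j) k * (2 * Real.log ‖U j k k‖)

theorem isUnit_frameMat {e : Datum p q κ} (he : IsFramed e) (j : κ) :
    IsUnit (frameMat (e j)).det := by
  rw [frameMat, det_fromBlocks_zero₂₁]; exact (he j).1.mul (he j).2

theorem mul_diag_of_blockTriangular {ι : Type} [Fintype ι] {b : ι → ℕ} (hb : Function.Injective b)
    {U V : Matrix ι ι ℂ} (hU : U.BlockTriangular b) (hV : V.BlockTriangular b) (i : ι) :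
    (U * V) i i = U i i * V i i := by
  rw [mul_apply, Finset.sum_eq_single i]
  · intro l _ hl
    rcases lt_or_gt_of_ne (fun h => hl (hb h) : b l ≠ b i) with h | h
    · rw [hU h, zero_mul]
    · rw [hV h, mul_zero]
  · simp

theorem eventually_exists_sgn_factor (k : Bool) {ρ : Matrix (Fin p ⊕ Fin q) (Fin p ⊕ Fin q) ℂ}
    (hρ : ρ.IsHermitian) : ∀ᶠ t : ℝ in nhds 0, ∃ U : Matrix (Fin p ⊕ Fin q) (Fin p ⊕ Fin q) ℂ,
      U.BlockTriangular (pos k) ∧ IsUnit U.det ∧ Uᴴ * sgn p q * U = sgn p q + (t : ℂ) • ρ := by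
  rw [← fromBlocks_toBlocks ρ, isHermitian_fromBlocks_iff] at hρ
  obtain ⟨h1, h2, h3, h4⟩ := hρ
  filter_upwards [eventually_posDef_one_add h1, eventually_posDef_one_add h4.neg] with t ht ht'
  obtain ⟨U, hU, hU', hUt⟩ := exists_sgn_factor k (B := (t : ℂ) • ρ.toBlocks₁₂) ht ht'
  refine ⟨U, hU, hU', hUt.trans ?_⟩
  conv_rhs => rw [← fromBlocks_toBlocks ρ]
  rw [sgn, fromBlocks_smul, fromBlocks_add]
  congr 1
  · simp
  · simp [conjTranspose_smul, h2]
  · rw [smul_neg]; abel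

theorem elim_mul_sgn_eq_trace (a : Fin p → ℝ) (b : Fin q → ℝ)
    (ρ : Matrix (Fin p ⊕ Fin q) (Fin p ⊕ Fin q) ℂ) :
    ∑ k, Sum.elim a b k * ((Sum.elim (fun _ => (1 : ℂ)) (fun _ => -1) k) * ρ k k).re
      = ((wt a b * ρ).trace).re := by
  have : wt a b = diagonal (Sum.elim (fun i => (a i : ℂ)) fun i => -(b i : ℂ)) := by
    ext (i | i) (j | j) <;> simp [wt, diagonal_apply]
  rw [this, trace, Complex.re_sum]
  refine Finset.sum_congr rfl fun k _ => ?_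
  rw [diag_apply, diagonal_mul]
  rcases k with k | k <;> simp

/-- The derivative of the energy along a Hermitian perturbation vanishes at a minimum. -/
theorem trace_eq_zero_of_minimizer [Fintype κ] {kind : κ → Bool} {a : κ → Fin p → ℝ}
    {b : κ → Fin q → ℝ} {e : Datum p q κ}
    {P : Matrix (Fin p ⊕ Fin q) (Fin p ⊕ Fin q) ℂ} {U : Datum p q κ} (hU : Feasible kind e P U)
    (hmin : ∀ P' U', Feasible kind e P' U' → energy a b U ≤ energy a b U')
    {δ : Matrix (Fin p ⊕ Fin q) (Fin p ⊕ Fin q) ℂ} (hδ : δ.IsHermitian)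
    {C : Datum p q κ} (hC : ∀ j, C j * U j = frameMat (e j)) :
    ∑ j, ((wt (a j) (b j) * ((C j)ᴴ * δ * C j)).trace).re = 0 := by
  set ρ : Datum p q κ := fun j => (C j)ᴴ * δ * C j with hρ
  have hρH : ∀ j, (ρ j).IsHermitian := fun j => isHermitian_conjTranspose_mul_mul _ hδ
  set ε : Fin p ⊕ Fin q → ℂ := Sum.elim (fun _ => 1) fun _ => -1 with hε
  have hε1 : ∀ i, ‖ε i‖ = 1 := by rintro (i | i) <;> simp [hε]
  have hε2 : ∀ i, ε i * ε i = 1 := by rintro (i | i) <;> simp [hε]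
  let f : ℝ → ℝ := fun t => ∑ j, ∑ k, Sum.elim (a j) (b j) k *
    (Real.log ‖(lead (pos (kind j)) (pos (kind j) k + 1) (diagonal ε + (t : ℂ) • ρ j)).det‖
      - Real.log ‖(lead (pos (kind j)) (pos (kind j) k) (diagonal ε + (t : ℂ) • ρ j)).det‖)
  have hf : HasDerivAt f (∑ j, ((wt (a j) (b j) * ρ j).trace).re) 0 := by
    refine HasDerivAt.fun_sum fun j _ => ?_
    rw [← elim_mul_sgn_eq_trace]
    refine HasDerivAt.fun_sum fun k _ => HasDerivAt.const_mul _ ?_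
    refine ((hasDerivAt_log_det_lead hε2 (ρ j) _).sub
      (hasDerivAt_log_det_lead hε2 (ρ j) _)).congr_deriv ?_
    rw [← Finset.sum_sub_distrib, Finset.sum_eq_single k]
    · simp [hε]
    · intro l _ hl
      have : pos (kind j) l ≠ pos (kind j) k := fun h => hl (pos_injective _ h)
      by_cases h : pos (kind j) l < pos (kind j) k
      · simp [h, Nat.lt_succ_of_lt h]
      · simp [h, show ¬ pos (kind j) l < pos (kind j) k + 1 by omega]
    · simp
  have hkey : ∀ (j : κ) (t : ℝ) (W : Matrix (Fin p ⊕ Fin q) (Fin p ⊕ Fin q) ℂ),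
      W.BlockTriangular (pos (kind j)) → IsUnit W.det →
      Wᴴ * sgn p q * W = sgn p q + (t : ℂ) • ρ j → ∀ k,
      Real.log ‖(lead (pos (kind j)) (pos (kind j) k + 1) (diagonal ε + (t : ℂ) • ρ j)).det‖
      - Real.log ‖(lead (pos (kind j)) (pos (kind j) k) (diagonal ε + (t : ℂ) • ρ j)).det‖
      = 2 * Real.log ‖W k k‖ := by
    intro j t W hW hW' hWt k
    rw [sgn_eq_diagonal] at hWt
    rw [hε, ← hWt, two_log_diag (pos_injective _) hW hW' hε1]
  have hf0 : f 0 = 0 := by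
    refine Finset.sum_eq_zero fun j _ => Finset.sum_eq_zero fun k _ => ?_
    rw [hkey j 0 1 blockTriangular_one (by simp) (by simp)]
    simp
  have hloc : IsLocalMin f 0 := by
    filter_upwards [Filter.eventually_all.2 fun j =>
      eventually_exists_sgn_factor (kind j) (hρH j)] with t ht
    rw [hf0]
    choose W hW hW' hWt using ht
    have hfeas : Feasible kind e (P + (t : ℂ) • δ) fun j => W j * U j := by
      intro j
      refine ⟨(hW j).mul (hU j).1, ?_, ?_⟩
      · rw [det_mul]; exact (hW' j).mul (hU j).2.1
      · have h1 : (W j * U j)ᴴ * sgn p q * (W j * U j)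
            = (U j)ᴴ * ((W j)ᴴ * sgn p q * W j) * U j := by
          rw [conjTranspose_mul]; simp only [Matrix.mul_assoc]
        rw [h1, hWt, Matrix.mul_add, Matrix.add_mul, (hU j).2.2, Matrix.mul_add, Matrix.add_mul]
        congr 1
        rw [← hC j, hρ, conjTranspose_mul]
        simp only [Matrix.mul_smul, Matrix.smul_mul, Matrix.mul_assoc]
    have h2 := hmin _ _ hfeas
    have h3 : energy a b (fun j => W j * U j) = f t + energy a b U := by
      simp only [energy, f, ← Finset.sum_add_distrib]
      refine Finset.sum_congr rfl fun j _ => Finset.sum_congr rfl fun k _ => ?_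
      rw [hkey j t (W j) (hW j) (hW' j) (hWt j),
        mul_diag_of_blockTriangular (pos_injective _) (hW j) (hU j).1, norm_mul, Real.log_mul]
      · ring
      · have h4 := hW' j
        rw [det_of_blockTriangular_injective (pos_injective _) (hW j), isUnit_iff_ne_zero,
          Finset.prod_ne_zero_iff] at h4
        exact norm_ne_zero_iff.2 (h4 k (Finset.mem_univ k))
      · have h4 := (hU j).2.1
        rw [det_of_blockTriangular_injective (pos_injective _) (hU j).1, isUnit_iff_ne_zero,
          Finset.prod_ne_zero_iff] at h4
        exact norm_ne_zero_iff.2 (h4 k (Finset.mem_univ k))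
    linarith
  exact hloc.hasDerivAt_eq_zero hf

theorem wt_isHermitian (a : Fin p → ℝ) (b : Fin q → ℝ) : (wt a b)ᴴ = wt a b := by
  rw [wt, fromBlocks_conjTranspose, conjTranspose_neg, diagonal_conjTranspose,
    diagonal_conjTranspose]
  congr 1
  · simp
  · simp
  · ext i; simp
  · congr 2; ext i; simp

/-- Minimizers of the energy solve the Horn equation. -/
theorem exists_solution_of_minimizer [Fintype κ] {kind : κ → Bool} {a : κ → Fin p → ℝ}
    {b : κ → Fin q → ℝ} {e : Datum p q κ} (he : IsFramed e)
    {P : Matrix (Fin p ⊕ Fin q) (Fin p ⊕ Fin q) ℂ} {U : Datum p q κ} (hU : Feasible kind e P U)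
    (hmin : ∀ P' U', Feasible kind e P' U' → energy a b U ≤ energy a b U') :
    ∃ C : Datum p q κ, (∀ j, IsUnit (C j).det) ∧ (∀ j, (C j)ᴴ * P * C j = sgn p q) ∧
      ∑ j, C j * wt (a j) (b j) * (C j)ᴴ = 0 := by
  set C : Datum p q κ := fun j => frameMat (e j) * (U j)⁻¹ with hCdef
  have hC : ∀ j, C j * U j = frameMat (e j) := fun j => by
    rw [hCdef, Matrix.mul_assoc, nonsing_inv_mul _ (hU j).2.1, Matrix.mul_one]
  refine ⟨C, fun j => ?_, fun j => ?_, ?_⟩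
  · rw [hCdef, det_mul]
    exact (isUnit_frameMat he j).mul (isUnit_nonsing_inv_det_iff.2 (hU j).2.1)
  · have h1 : U j * (U j)⁻¹ = 1 := mul_nonsing_inv _ (hU j).2.1
    have h2 : ((U j)⁻¹)ᴴ * (U j)ᴴ = 1 := by rw [← conjTranspose_mul, h1, conjTranspose_one]
    calc (C j)ᴴ * P * C j
        = ((U j)⁻¹)ᴴ * ((frameMat (e j))ᴴ * P * frameMat (e j)) * (U j)⁻¹ := by
          rw [hCdef, conjTranspose_mul]; simp only [Matrix.mul_assoc]
      _ = (((U j)⁻¹)ᴴ * (U j)ᴴ) * sgn p q * (U j * (U j)⁻¹) := by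
          rw [← (hU j).2.2]; simp only [Matrix.mul_assoc]
      _ = sgn p q := by rw [h1, h2, Matrix.one_mul, Matrix.mul_one]
  · set E := ∑ j, C j * wt (a j) (b j) * (C j)ᴴ with hE
    have hEH : Eᴴ = E := by
      rw [hE, conjTranspose_sum]
      refine Finset.sum_congr rfl fun j _ => ?_
      rw [conjTranspose_mul (C j * _), conjTranspose_mul (C j), conjTranspose_conjTranspose,
        wt_isHermitian,
        Matrix.mul_assoc (C j)]
    have h1 := trace_eq_zero_of_minimizer hU hmin (δ := E) hEH hC
    have h2 : ((Eᴴ * E).trace).re = 0 := by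
      rw [← h1, hEH]
      conv_lhs => enter [1, 1, 1]; rw [hE]
      rw [Matrix.sum_mul, trace_sum, Complex.re_sum]
      refine Finset.sum_congr rfl fun j _ => ?_
      rw [Matrix.mul_assoc (C j), Matrix.mul_assoc (C j), trace_mul_comm]
      simp only [Matrix.mul_assoc]
    have h3 : (Eᴴ * E).trace = 0 := by
      refine Complex.ext h2 ?_
      exact (Complex.le_def.1 (posSemidef_conjTranspose_mul_self E).trace_nonneg).2.symm
    exact trace_conjTranspose_mul_self_eq_zero_iff.1 h3

end

/-! ### Triangular factors of degenerating families -/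

/-- A basis chosen greedily by decreasing value of `ℓ`. -/
theorem exists_greedy {ι E : Type*} [Fintype ι] [AddCommGroup E] [Module ℂ E] (v : ι → E)
    (ℓ : ι → ℝ) :
    ∃ I : Finset ι, LinearIndepOn ℂ v (I : Set ι) ∧
      ∀ (θ : ℝ) (i : ι), θ < ℓ i → v i ∈ Submodule.span ℂ (v '' {i | i ∈ I ∧ θ < ℓ i}) := by
  classical
  suffices h : ∀ s : Finset ι, ∃ I ⊆ s, LinearIndepOn ℂ v (I : Set ι) ∧
      ∀ (θ : ℝ), ∀ i ∈ s, θ < ℓ i → v i ∈ Submodule.span ℂ (v '' {i | i ∈ I ∧ θ < ℓ i}) by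
    obtain ⟨I, -, h1, h2⟩ := h Finset.univ
    exact ⟨I, h1, fun θ i => h2 θ i (Finset.mem_univ i)⟩
  intro s
  induction s using Finset.induction_on_min_value ℓ with
  | empty => exact ⟨∅, le_rfl, by simp, by simp⟩
  | insert a s ha hmin ih =>
    obtain ⟨I, hI, hli, hsp⟩ := ih
    by_cases hmem : v a ∈ Submodule.span ℂ (v '' (I : Set ι))
    · refine ⟨I, hI.trans (Finset.subset_insert a s), hli, fun θ i hi hθ => ?_⟩
      rcases Finset.mem_insert.1 hi with rfl | hi
      · refine Submodule.span_mono (Set.image_mono fun j hj => ?_) hmem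
        exact ⟨hj, hθ.trans_le (hmin j (hI hj))⟩
      · exact hsp θ i hi hθ
    · refine ⟨insert a I, Finset.insert_subset_insert a hI, ?_, fun θ i hi hθ => ?_⟩
      · rw [Finset.coe_insert]
        exact hli.insert hmem
      · rcases Finset.mem_insert.1 hi with rfl | hi
        · exact Submodule.subset_span ⟨i, ⟨Finset.mem_insert_self i I, hθ⟩, rfl⟩
        · refine Submodule.span_mono (Set.image_mono fun j hj => ?_) (hsp θ i hi hθ)
          exact ⟨Finset.mem_insert_of_mem hj.1, hj.2⟩

/-- The sum of the spectral subspaces with values at most `θ`. -/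
def lowSpace {n : ℕ} (V : Matrix (Fin n) (Fin n) ℂ) (ℓ : Fin n → ℝ) (θ : ℝ) :
    Submodule ℂ (Fin n → ℂ) where
  carrier := {v | ∀ i, θ < ℓ i → (Vᴴ *ᵥ v) i = 0}
  add_mem' := fun {v w} hv hw i hi => by simp [mulVec_add, hv i hi, hw i hi]
  zero_mem' := fun i _ => by simp
  smul_mem' := fun c v hv i hi => by simp [mulVec_smul, hv i hi]

theorem mem_lowSpace {n : ℕ} {V : Matrix (Fin n) (Fin n) ℂ} {ℓ : Fin n → ℝ} {θ : ℝ}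
    {v : Fin n → ℂ} : v ∈ lowSpace V ℓ θ ↔ ∀ i, θ < ℓ i → (Vᴴ *ᵥ v) i = 0 := Iff.rfl

theorem flagDim_lowSpace {n k : ℕ} (hk : k ≤ n) (V g : Matrix (Fin n) (Fin n) ℂ)
    (ℓ : Fin n → ℝ) (θ : ℝ) :
    ((Vᴴ * g).submatrix (Subtype.val : {i // θ < ℓ i} → Fin n) (Fin.castLE hk)).rank
      + flagDim g (lowSpace V ℓ θ) k = k := by
  set R := (Vᴴ * g).submatrix (Subtype.val : {i // θ < ℓ i} → Fin n) (Fin.castLE hk) with hR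
  have h1 := LinearMap.finrank_range_add_finrank_ker R.mulVecLin
  rw [Module.finrank_fin_fun] at h1
  have hinj : Function.Injective (Fin.castLE hk) := Fin.castLE_injective hk
  set E := Function.ExtendByZero.linearMap ℂ (Fin.castLE hk) with hE
  have hEa : ∀ u c, E u (Fin.castLE hk c) = u c := fun u c => hinj.extend_apply u 0 c
  have hE0 : ∀ u (i : Fin n), k ≤ i → E u i = 0 := by
    intro u i hi
    refine Function.extend_apply' u (0 : Fin n → ℂ) i ?_
    rintro ⟨c, rfl⟩
    exact absurd c.2 (not_lt.2 hi)
  have hEi : Function.Injective E := by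
    intro u u' h
    funext c
    rw [← hEa u c, h, hEa]
  have hmul : ∀ u (i : Fin n), ((Vᴴ * g) *ᵥ E u) i
      = ∑ c : Fin k, (Vᴴ * g) i (Fin.castLE hk c) * u c := by
    intro u i
    rw [mulVec, dotProduct]
    symm
    refine Fintype.sum_of_injective (Fin.castLE hk) hinj _ _ (fun j hj => ?_) (fun c => ?_)
    · rw [hE0, mul_zero]
      by_contra h
      exact hj ⟨⟨j, not_le.1 h⟩, rfl⟩
    · rw [hEa]
  have hmap : coordFlag n k ⊓ (lowSpace V ℓ θ).comap g.mulVecLin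
      = (LinearMap.ker R.mulVecLin).map E := by
    ext v
    simp only [Submodule.mem_inf, Submodule.mem_comap, Submodule.mem_map, LinearMap.mem_ker,
      mulVecLin_apply, mem_lowSpace, mulVec_mulVec]
    constructor
    · rintro ⟨h2, h3⟩
      have hv : E (fun c => v (Fin.castLE hk c)) = v := by
        funext i
        by_cases hi : (i : ℕ) < k
        · exact hEa _ ⟨i, hi⟩
        · rw [hE0 _ _ (not_lt.1 hi), h2 i (not_lt.1 hi)]
      refine ⟨_, ?_, hv⟩
      funext i
      have := h3 i i.2
      rw [← hv, hmul] at this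
      exact this
    · rintro ⟨u, hu, rfl⟩
      refine ⟨hE0 u, fun i hi => ?_⟩
      rw [hmul]
      exact congrFun hu ⟨i, hi⟩
  rw [flagDim, hmap, (Submodule.equivMapOfInjective E hEi _).finrank_eq.symm]
  exact h1

theorem exists_minor {n k : ℕ} (hk : k ≤ n) {V g : Matrix (Fin n) (Fin n) ℂ}
    (hM : IsUnit (Vᴴ * g).det) (ℓ : Fin n → ℝ) :
    ∃ f : Fin k → Fin n, Function.Injective f ∧
      ((Vᴴ * g).submatrix f (Fin.castLE hk)).det ≠ 0 ∧
      ∀ θ, (∑ i, if θ < ℓ (f i) then (1 : ℝ) else 0)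
        = k - flagDim g (lowSpace V ℓ θ) k := by
  classical
  set v : Fin n → Fin k → ℂ := fun i c => (Vᴴ * g) i (Fin.castLE hk c) with hv
  obtain ⟨I, hli, hsp⟩ := exists_greedy v ℓ
  have hcard : ∀ θ, ((I.filter fun i => θ < ℓ i).card : ℝ)
      = k - flagDim g (lowSpace V ℓ θ) k := by
    intro θ
    have h1 := flagDim_lowSpace hk V g ℓ θ
    rw [rank_eq_finrank_span_row] at h1
    have h2 : Submodule.span ℂ (Set.range ((Vᴴ * g).submatrix
        (Subtype.val : {i // θ < ℓ i} → Fin n) (Fin.castLE hk)).row)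
        = Submodule.span ℂ (v '' ((I.filter fun i => θ < ℓ i : Finset (Fin n)) : Set (Fin n))) := by
      apply le_antisymm
      · rw [Submodule.span_le]
        rintro _ ⟨i, rfl⟩
        have := hsp θ i i.2
        rw [Finset.coe_filter]
        exact this
      · apply Submodule.span_mono
        rintro _ ⟨i, hi, rfl⟩
        have hi' : i ∈ I ∧ θ < ℓ i := by simpa using hi
        exact ⟨⟨i, hi'.2⟩, rfl⟩
    have h3 : LinearIndepOn ℂ v ((I.filter fun i => θ < ℓ i : Finset (Fin n)) : Set (Fin n)) :=
      hli.mono (Finset.coe_subset.2 (Finset.filter_subset _ I))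
    rw [h2, Set.image_eq_range, finrank_span_eq_card h3] at h1
    rw [eq_sub_iff_add_eq]
    have h4 : Fintype.card ((I.filter fun i => θ < ℓ i : Finset (Fin n)) : Set (Fin n))
      = (I.filter fun i => θ < ℓ i).card := by simp
    rw [h4] at h1
    exact_mod_cast h1
  have hIk : I.card = k := by
    obtain ⟨θ, hθ⟩ : ∃ θ, ∀ i, θ < ℓ i := by
      obtain ⟨b, hb⟩ := (Set.finite_range ℓ).bddBelow
      exact ⟨b - 1, fun i => by linarith [hb ⟨i, rfl⟩]⟩
    have h1 := hcard θ
    have h2 : flagDim g (lowSpace V ℓ θ) k = 0 := by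
      rw [flagDim]
      rw [Submodule.finrank_eq_zero, eq_bot_iff]
      rintro u ⟨-, hu⟩
      have hz : (Vᴴ * g) *ᵥ u = 0 := by
        funext i
        rw [← mulVec_mulVec]
        exact hu i (hθ i)
      exact (Submodule.mem_bot ℂ).2 (Matrix.mulVec_injective_of_isUnit
        ((Matrix.isUnit_iff_isUnit_det _).2 hM) (by rw [hz, mulVec_zero]))
    rw [h2, Finset.filter_true_of_mem fun i _ => hθ i] at h1
    simpa using h1
  set f := I.orderEmbOfFin hIk with hf
  have himg : Finset.univ.image f = I := Finset.image_orderEmbOfFin_univ I hIk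
  refine ⟨f, f.injective, ?_, fun θ => ?_⟩
  · rw [← isUnit_iff_ne_zero, ← Matrix.isUnit_iff_isUnit_det, ← linearIndependent_rows_iff_isUnit]
    have : LinearIndependent ℂ (fun i : Fin k => v (f i)) := by
      have h := hli.comp (fun i : Fin k => (⟨f i, I.orderEmbOfFin_mem hIk i⟩ : (I : Set (Fin n))))
        (fun i j h => f.injective (by simpa using h))
      exact h
    exact this
  · rw [← hcard, Finset.card_filter, ← himg, Finset.sum_image fun i _ j _ h => f.injective h]
    push_cast
    rfl

theorem submatrix_castLE_gram {n k : ℕ} (hk : k ≤ n) {U : Matrix (Fin n) (Fin n) ℂ}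
    (hU : U.BlockTriangular id) :
    (U.submatrix (Fin.castLE hk) (Fin.castLE hk))ᴴ * U.submatrix (Fin.castLE hk) (Fin.castLE hk)
      = (Uᴴ * U).submatrix (Fin.castLE hk) (Fin.castLE hk) := by
  ext i j
  simp only [mul_apply, conjTranspose_apply, submatrix_apply]
  refine Fintype.sum_of_injective (Fin.castLE hk) (Fin.castLE_injective hk) _ _ (fun r hr => ?_)
    (fun c => rfl)
  have : U r (Fin.castLE hk j) = 0 := by
    apply hU
    by_contra h
    refine hr ⟨⟨r, ?_⟩, rfl⟩
    have h' : (r : ℕ) ≤ j := not_lt.1 h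
    exact h'.trans_lt j.2
  rw [this, mul_zero]

theorem gram_diagonal_sqrt {m n : Type*} [Fintype m] [DecidableEq m] [Fintype n]
    (K : Matrix m n ℂ) {d : m → ℝ} (hd : ∀ i, 0 < d i) :
    (diagonal (fun i => ((√(d i) : ℝ) : ℂ)) * K)ᴴ * (diagonal (fun i => ((√(d i) : ℝ) : ℂ)) * K)
      = Kᴴ * diagonal (fun i => (d i : ℂ)) * K := by
  rw [conjTranspose_mul, Matrix.mul_assoc, ← Matrix.mul_assoc _ _ K, diagonal_conjTranspose,
    diagonal_mul_diagonal, Matrix.mul_assoc]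
  congr 3
  funext i
  have : (d i : ℂ) = ((√(d i) * √(d i) : ℝ) : ℂ) := by rw [Real.mul_self_sqrt (hd i).le]
  rw [this]
  simp

theorem log_minor_le {n k : ℕ} (hk : k ≤ n) {U K : Matrix (Fin n) (Fin n) ℂ}
    (hU : U.BlockTriangular id) (hUd : IsUnit U.det) {d : Fin n → ℝ} (hd : ∀ i, 0 < d i)
    (h : Uᴴ * U = Kᴴ * diagonal (fun i => (d i : ℂ)) * K) {f : Fin k → Fin n}
    (hf : Function.Injective f) (hdet : (K.submatrix f (Fin.castLE hk)).det ≠ 0) :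
    ∑ i, Real.log (d (f i)) + 2 * Real.log ‖(K.submatrix f (Fin.castLE hk)).det‖
      ≤ ∑ i : Fin k, 2 * Real.log ‖U (Fin.castLE hk i) (Fin.castLE hk i)‖ := by
  set c := Fin.castLE hk with hc
  set D : Matrix (Fin n) (Fin n) ℂ := diagonal (fun i => ((√(d i) : ℝ) : ℂ)) with hD
  set X : Matrix (Fin k) (Fin k) ℂ :=
    diagonal (fun i => ((√(d (f i)) : ℝ) : ℂ)) * K.submatrix f c with hX
  set Y : Matrix (Fin n) (Fin k) ℂ := D * K.submatrix id c with hY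
  have hXdet : X.det = (∏ i, ((√(d (f i)) : ℝ) : ℂ)) * (K.submatrix f c).det := by
    rw [hX, det_mul, det_diagonal]
  have hX0 : X.det ≠ 0 := by
    rw [hXdet]
    refine mul_ne_zero (Finset.prod_ne_zero_iff.2 fun i _ => ?_) hdet
    exact_mod_cast (Real.sqrt_pos.2 (hd (f i))).ne'
  have hXpos : (Xᴴ * X).PosDef := by
    apply Matrix.PosDef.conjTranspose_mul_self
    exact Matrix.mulVec_injective_of_isUnit
      ((Matrix.isUnit_iff_isUnit_det _).2 (isUnit_iff_ne_zero.2 hX0))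
  obtain ⟨U₁, hU₁, hU₁d, hU₁X⟩ := exists_cholesky hXpos
  have hYU : (U.submatrix c c)ᴴ * U.submatrix c c = Yᴴ * Y := by
    rw [submatrix_castLE_gram hk hU, h, hY, hD, gram_diagonal_sqrt _ hd]
    rfl
  have hle : ((U.submatrix c c)ᴴ * U.submatrix c c - U₁ᴴ * U₁).PosSemidef := by
    rw [hYU, hU₁X]
    refine PosSemidef.of_dotProduct_mulVec_nonneg
      ((isHermitian_conjTranspose_mul_self Y).sub (isHermitian_conjTranspose_mul_self X))
      fun v => ?_
    rw [sub_mulVec, dotProduct_sub, star_dot_gram, star_dot_gram, sub_nonneg]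
    have h1 : ∀ i, (X *ᵥ v) i = (Y *ᵥ v) (f i) := by
      intro i
      simp [hX, hY, hD, mulVec, dotProduct, diagonal_mul]
    rw [Fintype.sum_of_injective (M := ℂ) f hf _ (fun j => if j ∈ Set.range f then
      ((‖(Y *ᵥ v) j‖ ^ 2 : ℝ) : ℂ) else 0) (fun j hj => if_neg hj)
      (fun i => by rw [if_pos ⟨i, rfl⟩, h1])]
    refine Finset.sum_le_sum fun j _ => ?_
    split_ifs
    · exact le_rfl
    · exact_mod_cast sq_nonneg ‖(Y *ᵥ v) j‖
  have hUk : (U.submatrix c c).BlockTriangular id := fun i j hij => hU hij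
  have hUkd : IsUnit (U.submatrix c c).det :=
    isUnit_det_upper hUk fun i => diag_ne_zero_of_isUnit hU hUd _
  have hmono := fun i => diag_norm_mono hU₁ hUk hUkd hle i
  have hprod : ‖U₁.det‖ ^ 2 = ‖X.det‖ ^ 2 := by
    have := congrArg (fun M : Matrix (Fin k) (Fin k) ℂ => ‖M.det‖) hU₁X
    simpa [det_mul, det_conjTranspose, pow_two] using this
  have hlogX : 2 * Real.log ‖X.det‖
      = ∑ i, Real.log (d (f i)) + 2 * Real.log ‖(K.submatrix f c).det‖ := by
    rw [hXdet, norm_mul, Real.log_mul (norm_ne_zero_iff.2 (left_ne_zero_of_mul (hXdet ▸ hX0)))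
      (norm_ne_zero_iff.2 hdet), norm_prod, Real.log_prod fun i _ => ?_, mul_add, Finset.mul_sum]
    · congr 1
      refine Finset.sum_congr rfl fun i _ => ?_
      rw [Complex.norm_real, Real.norm_of_nonneg (Real.sqrt_nonneg _), Real.log_sqrt (hd _).le]
      ring
    · rw [Complex.norm_real, Real.norm_of_nonneg (Real.sqrt_nonneg _)]
      exact (Real.sqrt_pos.2 (hd (f i))).ne'
  rw [← hlogX]
  have hlog2 : 2 * Real.log ‖X.det‖ = 2 * Real.log ‖U₁.det‖ := by
    have := congrArg Real.log hprod
    rw [Real.log_pow, Real.log_pow] at this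
    exact_mod_cast this.symm
  rw [hlog2, det_upper hU₁, norm_prod, Real.log_prod fun i _ =>
    norm_ne_zero_iff.2 (diag_ne_zero_of_isUnit hU₁ hU₁d i), Finset.mul_sum]
  refine Finset.sum_le_sum fun i _ => ?_
  have := Real.log_le_log (norm_pos_iff.2 (diag_ne_zero_of_isUnit hU₁ hU₁d i)) (hmono i)
  exact mul_le_mul_of_nonneg_left this (by norm_num)

theorem log_minor_eq {n : ℕ} {U K : Matrix (Fin n) (Fin n) ℂ}
    (hU : U.BlockTriangular id) (hUd : IsUnit U.det) {d : Fin n → ℝ} (hd : ∀ i, 0 < d i)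
    (h : Uᴴ * U = Kᴴ * diagonal (fun i => (d i : ℂ)) * K) {f : Fin n → Fin n}
    (hf : Function.Injective f) (hdet : (K.submatrix f (Fin.castLE le_rfl)).det ≠ 0) :
    ∑ i, Real.log (d (f i)) + 2 * Real.log ‖(K.submatrix f (Fin.castLE le_rfl)).det‖
      = ∑ i : Fin n, 2 * Real.log ‖U i i‖ := by
  let σ : Equiv.Perm (Fin n) := Equiv.ofBijective f (Finite.injective_iff_bijective.1 hf)
  have hK : ‖(K.submatrix f (Fin.castLE le_rfl)).det‖ = ‖K.det‖ := by
    have : K.submatrix f (Fin.castLE le_rfl) = K.submatrix σ id := rfl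
    rw [this, det_permute, norm_mul]
    rcases Int.units_eq_one_or (Equiv.Perm.sign σ) with h | h <;> simp [h]
  have hK0 : ‖K.det‖ ≠ 0 := by rw [← hK]; exact norm_ne_zero_iff.2 hdet
  have hdf : ∑ i, Real.log (d (f i)) = ∑ i, Real.log (d i) :=
    Equiv.sum_comp σ fun i => Real.log (d i)
  have hdetU := congrArg (fun M : Matrix (Fin n) (Fin n) ℂ => Real.log ‖M.det‖) h
  simp only [det_mul, det_conjTranspose, norm_mul, norm_star, det_diagonal] at hdetU
  have hU0 : ‖U.det‖ ≠ 0 := norm_ne_zero_iff.2 hUd.ne_zero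
  have hd0 : ‖∏ i, (d i : ℂ)‖ ≠ 0 :=
    norm_ne_zero_iff.2 (Finset.prod_ne_zero_iff.2 fun i _ => by exact_mod_cast (hd i).ne')
  rw [Real.log_mul hU0 hU0, Real.log_mul (mul_ne_zero hK0 hd0) hK0, Real.log_mul hK0 hd0,
    det_upper hU, norm_prod, norm_prod, Real.log_prod fun i _ =>
    norm_ne_zero_iff.2 (diag_ne_zero_of_isUnit hU hUd i), Real.log_prod fun i _ =>
    norm_ne_zero_iff.2 (by exact_mod_cast (hd i).ne')] at hdetU
  rw [hK, hdf, ← Finset.mul_sum]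
  have : ∀ i, Real.log ‖(d i : ℂ)‖ = Real.log (d i) := fun i => by
    rw [Complex.norm_real, Real.norm_of_nonneg (hd i).le]
  simp only [this] at hdetU
  linarith

theorem sum_castLE {n k : ℕ} (hk : k ≤ n) (ρ : Fin n → ℝ) :
    ∑ i : Fin k, ρ (Fin.castLE hk i) = ∑ i : Fin n, if (i : ℕ) < k then ρ i else 0 := by
  refine Fintype.sum_of_injective (Fin.castLE hk) (Fin.castLE_injective hk) _ _ (fun r hr => ?_)
    (fun c => (if_pos c.2).symm)
  exact if_neg fun h => hr ⟨⟨r, h⟩, rfl⟩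

/-- Lower bound, along a degenerating family of positive definite forms, for the weighted
logarithms of the diagonal of their triangular factors. -/
theorem exists_asymptotic_lower {n : ℕ} {α : Type*} {𝒰 : Filter α}
    {g : Matrix (Fin n) (Fin n) ℂ} (hg : IsUnit g.det)
    {V : α → Matrix (Fin n) (Fin n) ℂ} {V₀ : Matrix (Fin n) (Fin n) ℂ}
    (hV : Filter.Tendsto V 𝒰 (nhds V₀)) (hV₀ : V₀ᴴ * V₀ = 1)
    {ℓ : α → Fin n → ℝ} {ℓ₀ : Fin n → ℝ} (hℓ : Filter.Tendsto ℓ 𝒰 (nhds ℓ₀))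
    {t lo : α → ℝ} (ht : Filter.Tendsto t 𝒰 Filter.atTop)
    {U : α → Matrix (Fin n) (Fin n) ℂ} (hU : ∀ m, (U m).BlockTriangular id)
    (hUd : ∀ m, IsUnit (U m).det)
    (hUU : ∀ m, (U m)ᴴ * U m = ((V m)ᴴ * g)ᴴ *
      diagonal (fun i => ((Real.exp (lo m + t m * ℓ m i) : ℝ) : ℂ)) * ((V m)ᴴ * g))
    {w : Fin n → ℝ} (hw : Antitone w) {T : Finset ℝ} {c : ℝ → ℝ}
    (hc : ∀ i, ℓ₀ i = ∑ θ ∈ T, c θ * (if θ < ℓ₀ i then 1 else 0)) :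
    ∃ s : α → ℝ, Filter.Tendsto s 𝒰
        (nhds (∑ θ ∈ T, c θ * (∑ k, w k - slope w g (lowSpace V₀ ℓ₀ θ)))) ∧
      ∀ᶠ m in 𝒰, (∑ k, w k) * lo m + t m * s m
        ≤ ∑ k, w k * (2 * Real.log ‖U m k k‖) := by
  have hM : IsUnit (V₀ᴴ * g).det := by
    rw [det_mul]
    refine IsUnit.mul (isUnit_iff_ne_zero.2 fun h => ?_) hg
    have := congrArg Matrix.det hV₀
    rw [det_mul, h, zero_mul, det_one] at this
    exact zero_ne_one this
  choose f hfi hfd hfc using fun (k : ℕ) (hk : k ≤ n) => exists_minor hk hM ℓ₀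
  set Δ : α → (k : ℕ) → k ≤ n → ℂ := fun m k hk =>
    (((V m)ᴴ * g).submatrix (f k hk) (Fin.castLE hk)).det with hΔ
  set φ : α → ℕ → ℝ := fun m k => if hk : k ≤ n then
    ∑ i, ℓ m (f k hk i) + 2 * Real.log ‖Δ m k hk‖ / t m else 0 with hφ
  have hΔt : ∀ k hk, Filter.Tendsto (fun m => Δ m k hk) 𝒰
      (nhds ((V₀ᴴ * g).submatrix (f k hk) (Fin.castLE hk)).det) := by
    intro k hk
    refine tendsto_det ?_
    have := tendsto_mul (tendsto_conjTranspose hV) (tendsto_const_nhds (x := g))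
    exact tendsto_pi_nhds.2 fun i => tendsto_pi_nhds.2 fun j =>
      tendsto_pi_nhds.1 (tendsto_pi_nhds.1 this _) _
  have hφt : ∀ k ≤ n, Filter.Tendsto (fun m => φ m k) 𝒰
      (nhds (∑ θ ∈ T, c θ * ((k : ℝ) - flagDim g (lowSpace V₀ ℓ₀ θ) k))) := by
    intro k hk
    have h1 : Filter.Tendsto (fun m => ∑ i, ℓ m (f k hk i) + 2 * Real.log ‖Δ m k hk‖ / t m) 𝒰
        (nhds (∑ i, ℓ₀ (f k hk i) + 0)) := by
      refine Filter.Tendsto.add (tendsto_finsetSum _ fun i _ => tendsto_pi_nhds.1 hℓ _) ?_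
      exact ((((hΔt k hk).norm).log (norm_ne_zero_iff.2 (hfd k hk))).const_mul 2).div_atTop ht
    have h2 : ∑ i, ℓ₀ (f k hk i) + 0
        = ∑ θ ∈ T, c θ * ((k : ℝ) - flagDim g (lowSpace V₀ ℓ₀ θ) k) := by
      rw [add_zero, Finset.sum_congr rfl fun i _ => hc (f k hk i), Finset.sum_comm]
      refine Finset.sum_congr rfl fun θ _ => ?_
      rw [← Finset.mul_sum, hfc]
    rw [← h2]
    refine h1.congr fun m => ?_
    simp only [hφ, dif_pos hk]
  refine ⟨fun m => ∑ k : Fin n, w k * (φ m (k + 1) - φ m k), ?_, ?_⟩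
  · have h1 : Filter.Tendsto (fun m => ∑ k : Fin n, w k * (φ m (k + 1) - φ m k)) 𝒰
        (nhds (∑ k : Fin n, w k *
          (∑ θ ∈ T, c θ * (((k + 1 : ℕ) : ℝ) - flagDim g (lowSpace V₀ ℓ₀ θ) (k + 1))
          - ∑ θ ∈ T, c θ * ((k : ℝ) - flagDim g (lowSpace V₀ ℓ₀ θ) k)))) :=
      tendsto_finsetSum _ fun k _ =>
        (((hφt (k + 1) k.2).sub (hφt k k.2.le))).const_mul (w k)
    convert h1 using 2
    simp only [slope, ← Finset.sum_sub_distrib, Finset.mul_sum]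
    rw [Finset.sum_comm]
    refine Finset.sum_congr rfl fun k _ => Finset.sum_congr rfl fun θ _ => ?_
    push_cast
    ring
  · have hne : ∀ᶠ m in 𝒰, ∀ k : Fin (n + 1), Δ m k (Nat.lt_succ_iff.1 k.2) ≠ 0 :=
      Filter.eventually_all.2 fun k => (hΔt k _).eventually_ne (hfd k _)
    filter_upwards [hne, ht.eventually_gt_atTop 0] with m hm htm
    have hm' : ∀ k (hk : k ≤ n), Δ m k hk ≠ 0 := fun k hk => hm ⟨k, Nat.lt_succ_of_le hk⟩
    set d : Fin n → ℝ := fun i => Real.exp (lo m + t m * ℓ m i) with hd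
    have hd0 : ∀ i, 0 < d i := fun i => Real.exp_pos _
    have hF : ∀ k (hk : k ≤ n), (k : ℝ) * lo m + t m * φ m k
        = ∑ i, Real.log (d (f k hk i)) + 2 * Real.log ‖Δ m k hk‖ := by
      intro k hk
      simp only [hφ, dif_pos hk, hd, Real.log_exp, Finset.sum_add_distrib, ← Finset.mul_sum,
        Finset.sum_const, Finset.card_univ, Fintype.card_fin, nsmul_eq_mul]
      field_simp
      ring
    have key := abel_le hw (F := fun k => (k : ℝ) * lo m + t m * φ m k)
      (F' := fun k => ∑ i : Fin n, if (i : ℕ) < k then 2 * Real.log ‖U m i i‖ else 0) ?_ ?_ ?_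
    · simp only [sum_lt_succ_sub] at key
      refine le_of_eq_of_le ?_ key
      rw [Finset.sum_mul, Finset.mul_sum, ← Finset.sum_add_distrib]
      refine Finset.sum_congr rfl fun k _ => ?_
      push_cast
      ring
    · simp only [hF 0 (Nat.zero_le n)]
      simp [hΔ]
    · intro k hk
      simp only [hF k hk]
      rw [← sum_castLE hk fun i => 2 * Real.log ‖U m i i‖]
      exact log_minor_le hk (hU m) (hUd m) hd0 (hUU m) (hfi k hk) (hm' k hk)
    · left
      simp only [hF n le_rfl, Fin.is_lt, if_true]
      exact log_minor_eq (hU m) (hUd m) hd0 (hUU m) (hfi n le_rfl) (hm' n le_rfl)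

/-- Layer-cake decomposition of finitely many nonnegative reals. -/
theorem exists_layers (A : Finset ℝ) (hA : ∀ x ∈ A, 0 ≤ x) :
    ∃ (T : Finset ℝ) (c : ℝ → ℝ), (∀ θ ∈ T, 0 < c θ ∧ 0 ≤ θ ∧ ∃ x ∈ A, θ < x) ∧
      ∀ x ∈ A, x = ∑ θ ∈ T, c θ * (if θ < x then 1 else 0) := by
  induction A using Finset.induction_on_max with
  | empty => exact ⟨∅, fun _ => 0, by simp, by simp⟩
  | insert a A ha ih =>
    obtain ⟨T, c, hT, hs⟩ := ih fun x hx => hA x (Finset.mem_insert_of_mem hx)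
    have ha0 := hA a (Finset.mem_insert_self a A)
    -- the previous maximum, or zero
    obtain ⟨b, hb0, hba, hbA, hbs⟩ : ∃ b, 0 ≤ b ∧ b ≤ a ∧ (∀ x ∈ A, x ≤ b) ∧
        (b = ∑ θ ∈ T, c θ * (if θ < b then 1 else 0)) ∧ ∀ θ ∈ T, θ < b := by
      rcases A.eq_empty_or_nonempty with rfl | hne
      · have : T = ∅ := Finset.eq_empty_of_forall_notMem fun θ hθ => by
          obtain ⟨-, -, x, hx, -⟩ := hT θ hθ
          simp at hx
        exact ⟨0, le_rfl, ha0, by simp, by simp [this]⟩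
      · refine ⟨A.max' hne, ?_, (ha _ (A.max'_mem hne)).le, fun x hx => A.le_max' x hx,
          hs _ (A.max'_mem hne), fun θ hθ => ?_⟩
        · exact hA _ (Finset.mem_insert_of_mem (A.max'_mem hne))
        · obtain ⟨-, -, x, hx, hθx⟩ := hT θ hθ
          exact hθx.trans_le (A.le_max' x hx)
    rcases hba.eq_or_lt with rfl | hlt
    · refine ⟨T, c, fun θ hθ => ?_, fun x hx => ?_⟩
      · obtain ⟨h1, h2, x, hx, h3⟩ := hT θ hθ
        exact ⟨h1, h2, x, Finset.mem_insert_of_mem hx, h3⟩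
      · rcases Finset.mem_insert.1 hx with rfl | hx
        · exact hbs.1
        · exact hs x hx
    · have hbT : b ∉ T := fun h => lt_irrefl b (hbs.2 b h)
      have hcongr : ∀ x, ∑ θ ∈ T, (if θ = b then a - b else c θ) * (if θ < x then (1 : ℝ) else 0)
          = ∑ θ ∈ T, c θ * (if θ < x then 1 else 0) := fun x =>
        Finset.sum_congr rfl fun θ hθ => by rw [if_neg (ne_of_mem_of_not_mem hθ hbT)]
      refine ⟨insert b T, fun θ => if θ = b then a - b else c θ, fun θ hθ => ?_, fun x hx => ?_⟩
      · rcases Finset.mem_insert.1 hθ with rfl | hθ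
        · exact ⟨by simpa using hlt, hb0, a, Finset.mem_insert_self a A, hlt⟩
        · obtain ⟨h1, h2, x, hx, h3⟩ := hT θ hθ
          exact ⟨by beta_reduce; rw [if_neg (ne_of_mem_of_not_mem hθ hbT)]; exact h1, h2, x,
            Finset.mem_insert_of_mem hx, h3⟩
      · beta_reduce
        rw [Finset.sum_insert hbT, if_pos rfl, hcongr]
        rcases Finset.mem_insert.1 hx with rfl | hx
        · rw [if_pos hlt]
          have : ∑ θ ∈ T, c θ * (if θ < x then (1 : ℝ) else 0) = b := by
            refine (Finset.sum_congr rfl fun θ hθ => ?_).trans hbs.1.symm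
            rw [if_pos ((hbs.2 θ hθ).trans hlt), if_pos (hbs.2 θ hθ)]
          rw [this]; ring
        · rw [if_neg (not_lt.2 (hbA x hx)), mul_zero, zero_add]
          exact hs x hx

theorem lowSpace_ne_bot {n : ℕ} {V : Matrix (Fin n) (Fin n) ℂ} (hV : Vᴴ * V = 1) {ℓ : Fin n → ℝ}
    {θ : ℝ} {i : Fin n} (h : ℓ i ≤ θ) : lowSpace V ℓ θ ≠ ⊥ := by
  intro hb
  have hm : V *ᵥ Pi.single i 1 ∈ lowSpace V ℓ θ := by
    intro r hr
    rw [mulVec_mulVec, hV, one_mulVec, Pi.single_apply, if_neg]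
    rintro rfl
    exact absurd hr (not_lt.2 h)
  rw [hb, Submodule.mem_bot] at hm
  have : (Vᴴ *ᵥ V *ᵥ Pi.single i 1) i = 0 := by rw [hm, mulVec_zero]; rfl
  rw [mulVec_mulVec, hV, one_mulVec] at this
  simp at this

theorem lowSpace_ne_top {n : ℕ} {V : Matrix (Fin n) (Fin n) ℂ} (hV : Vᴴ * V = 1) {ℓ : Fin n → ℝ}
    {θ : ℝ} {i : Fin n} (h : θ < ℓ i) : lowSpace V ℓ θ ≠ ⊤ := by
  intro ht
  have hm : V *ᵥ Pi.single i 1 ∈ lowSpace V ℓ θ := ht ▸ Submodule.mem_top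
  have := hm i h
  rw [mulVec_mulVec, hV, one_mulVec] at this
  simp at this

theorem star_dot_conj_diagonal {m n : Type*} [Fintype m] [DecidableEq m] [Fintype n]
    (K : Matrix m n ℂ) {d : m → ℝ} (v : n → ℂ) :
    star v ⬝ᵥ (Kᴴ * diagonal (fun i => (d i : ℂ)) * K) *ᵥ v
      = ((∑ i, d i * ‖(K *ᵥ v) i‖ ^ 2 : ℝ) : ℂ) := by
  rw [← mulVec_mulVec, ← mulVec_mulVec, dotProduct_mulVec, ← star_mulVec, dotProduct]
  push_cast
  refine Finset.sum_congr rfl fun i _ => ?_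
  rw [mulVec_diagonal, Pi.star_apply]
  have := Complex.conj_mul' ((K *ᵥ v) i)
  rw [← this, starRingEnd_apply]
  ring

/-- The limit of the spectral filtrations of a degenerating family is compatible with `Z`. -/
theorem mem_lowSpace_of_degeneration {p q : ℕ} {𝒰 : Filter ℕ} [𝒰.NeBot]
    {Z : Matrix (Fin p) (Fin q) ℂ}
    {V : ℕ → Matrix (Fin p) (Fin p) ℂ} {V₀ : Matrix (Fin p) (Fin p) ℂ}
    {V' : ℕ → Matrix (Fin q) (Fin q) ℂ} {V₀' : Matrix (Fin q) (Fin q) ℂ}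
    (hV : Filter.Tendsto V 𝒰 (nhds V₀)) (hV' : Filter.Tendsto V' 𝒰 (nhds V₀'))
    (hV1 : ∀ m, (V' m)ᴴ * V' m = 1) (hV0 : V₀' * V₀'ᴴ = 1)
    {ℓ : ℕ → Fin p → ℝ} {ℓ₀ : Fin p → ℝ} (hℓ : Filter.Tendsto ℓ 𝒰 (nhds ℓ₀))
    {ℓ' : ℕ → Fin q → ℝ} {ℓ₀' : Fin q → ℝ} (hℓ' : Filter.Tendsto ℓ' 𝒰 (nhds ℓ₀'))
    {t lo : ℕ → ℝ} (ht : Filter.Tendsto t 𝒰 Filter.atTop)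
    (hZ : ∀ m, ((4 : ℂ) • (V' m * diagonal (fun i => ((Real.exp (lo m + t m * ℓ' m i) : ℝ) : ℂ))
        * (V' m)ᴴ) - Zᴴ * (V m * diagonal (fun i => ((Real.exp (lo m + t m * ℓ m i) : ℝ) : ℂ))
        * (V m)ᴴ) * Z).PosSemidef)
    {θ : ℝ} {v : Fin q → ℂ} (hv : v ∈ lowSpace V₀' ℓ₀' θ) : Z *ᵥ v ∈ lowSpace V₀ ℓ₀ θ := by
  intro r hr
  set c := V₀'ᴴ *ᵥ v with hc
  have hlim : Filter.Tendsto (fun m => (((V m)ᴴ * Z * V' m) *ᵥ c) r) 𝒰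
      (nhds ((V₀ᴴ *ᵥ Z *ᵥ v) r)) := by
    have h1 : V₀ᴴ *ᵥ Z *ᵥ v = (V₀ᴴ * Z * V₀') *ᵥ c := by
      rw [hc, mulVec_mulVec v _ V₀'ᴴ, Matrix.mul_assoc _ V₀', hV0, Matrix.mul_one, mulVec_mulVec]
    rw [h1]
    have h2 := tendsto_mul
      (tendsto_mul (tendsto_conjTranspose hV) (tendsto_const_nhds (x := Z))) hV'
    simp only [mulVec, dotProduct]
    exact tendsto_finsetSum _ fun i _ =>
      (tendsto_pi_nhds.1 (tendsto_pi_nhds.1 h2 r) i).mul_const _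
  have hbound : ∀ m, ‖(((V m)ᴴ * Z * V' m) *ᵥ c) r‖ ^ 2
      ≤ 4 * ∑ i, Real.exp (t m * (ℓ' m i - ℓ m r)) * ‖c i‖ ^ 2 := by
    intro m
    have h1 := (hZ m).dotProduct_mulVec_nonneg (V' m *ᵥ c)
    have e1 : Zᴴ * (V m * diagonal (fun i => ((Real.exp (lo m + t m * ℓ m i) : ℝ) : ℂ))
        * (V m)ᴴ) * Z = ((V m)ᴴ * Z)ᴴ *
        diagonal (fun i => ((Real.exp (lo m + t m * ℓ m i) : ℝ) : ℂ)) * ((V m)ᴴ * Z) := by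
      rw [conjTranspose_mul, conjTranspose_conjTranspose]
      simp only [Matrix.mul_assoc]
    have e2 : V' m * diagonal (fun i => ((Real.exp (lo m + t m * ℓ' m i) : ℝ) : ℂ)) * (V' m)ᴴ
        = ((V' m)ᴴ)ᴴ * diagonal (fun i => ((Real.exp (lo m + t m * ℓ' m i) : ℝ) : ℂ))
          * (V' m)ᴴ := by
      rw [conjTranspose_conjTranspose]
    rw [e1, e2, sub_mulVec, dotProduct_sub, smul_mulVec, dotProduct_smul, star_dot_conj_diagonal,
      star_dot_conj_diagonal, sub_nonneg, smul_eq_mul, mulVec_mulVec c (V' m)ᴴ, hV1,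
      one_mulVec, mulVec_mulVec] at h1
    have h2 : ∑ i, Real.exp (lo m + t m * ℓ m i) * ‖(((V m)ᴴ * Z * V' m) *ᵥ c) i‖ ^ 2
        ≤ 4 * ∑ i, Real.exp (lo m + t m * ℓ' m i) * ‖c i‖ ^ 2 := by
      exact_mod_cast h1
    have h3 := (Finset.single_le_sum (f := fun i => Real.exp (lo m + t m * ℓ m i)
      * ‖(((V m)ᴴ * Z * V' m) *ᵥ c) i‖ ^ 2) (fun i _ => by positivity)
      (Finset.mem_univ r)).trans h2
    have h4 : ∀ i, Real.exp (lo m + t m * ℓ' m i)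
        = Real.exp (lo m + t m * ℓ m r) * Real.exp (t m * (ℓ' m i - ℓ m r)) := fun i => by
      rw [← Real.exp_add]; ring_nf
    simp only [h4, mul_assoc, ← Finset.mul_sum] at h3
    rw [mul_left_comm] at h3
    exact le_of_mul_le_mul_left h3 (Real.exp_pos _)
  have hzero : Filter.Tendsto
      (fun m => 4 * ∑ i, Real.exp (t m * (ℓ' m i - ℓ m r)) * ‖c i‖ ^ 2) 𝒰 (nhds 0) := by
    have : Filter.Tendsto
        (fun m => 4 * ∑ i, Real.exp (t m * (ℓ' m i - ℓ m r)) * ‖c i‖ ^ 2) 𝒰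
        (nhds (4 * ∑ _i : Fin q, 0)) := by
      refine (tendsto_finsetSum _ fun i _ => ?_).const_mul 4
      by_cases hi : θ < ℓ₀' i
      · have : c i = 0 := hv i hi
        simp [this]
      · have hneg : ℓ₀' i - ℓ₀ r < 0 := by linarith [not_lt.1 hi]
        have h1 : Filter.Tendsto (fun m => ℓ' m i - ℓ m r) 𝒰 (nhds (ℓ₀' i - ℓ₀ r)) :=
          (tendsto_pi_nhds.1 hℓ' i).sub (tendsto_pi_nhds.1 hℓ r)
        have h2 := Real.tendsto_exp_atBot.comp (ht.atTop_mul_neg hneg h1)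
        simpa using h2.mul_const (‖c i‖ ^ 2)
    simpa using this
  have hle : ‖(V₀ᴴ *ᵥ Z *ᵥ v) r‖ ^ 2 ≤ 0 := le_of_tendsto_of_tendsto' (hlim.norm.pow 2) hzero hbound
  have := pow_eq_zero_iff (two_ne_zero) |>.1 (le_antisymm hle (sq_nonneg _))
  exact norm_eq_zero.1 this

theorem norm_le_one_of_unitary {n : ℕ} {V : Matrix (Fin n) (Fin n) ℂ} (h : Vᴴ * V = 1)
    (i j : Fin n) : ‖V i j‖ ≤ 1 := by
  have := norm_sq_le_gram V i j
  rw [h, one_apply_eq, Complex.one_re] at this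
  exact (sq_le_one_iff₀ (norm_nonneg _)).1 this

theorem unitary_of_tendsto {n : ℕ} {𝒰 : Filter ℕ} [𝒰.NeBot] {V : ℕ → Matrix (Fin n) (Fin n) ℂ}
    {V₀ : Matrix (Fin n) (Fin n) ℂ} (hV : Filter.Tendsto V 𝒰 (nhds V₀))
    (h : ∀ m, (V m)ᴴ * V m = 1) : V₀ᴴ * V₀ = 1 :=
  tendsto_nhds_unique (tendsto_mul (tendsto_conjTranspose hV) hV) (by simp [h])

section

/-! ### Coercivity of the Kempf–Ness function at stable data -/

variable {p q : ℕ} {κ : Type} [Fintype κ]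

/-- Stability of a datum for given weights. -/
def Stable (kind : κ → Bool) (a : κ → Fin p → ℝ) (b : κ → Fin q → ℝ) (e : Datum p q κ) : Prop :=
  IsFramed e ∧ ∀ V W, Inv kind e V W → ¬ (V = ⊥ ∧ W = ⊥) → ¬ (V = ⊤ ∧ W = ⊤) →
    totalSlope a b e V W < 0

theorem not_degenerate {kind : κ → Bool} {a : κ → Fin p → ℝ} {b : κ → Fin q → ℝ}
    {e : Datum p q κ} (ha : ∀ j, Antitone (a j)) (hb : ∀ j, Antitone (b j))
    (htr : ∑ j, (∑ i, a j i + ∑ i, b j i) = 0) (hst : Stable kind a b e)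
    {V : ℕ → Matrix (Fin p) (Fin p) ℂ} {V' : ℕ → Matrix (Fin q) (Fin q) ℂ}
    (hV : ∀ m, (V m)ᴴ * V m = 1) (hV' : ∀ m, (V' m)ᴴ * V' m = 1)
    {ℓ : ℕ → Fin p ⊕ Fin q → ℝ} (hℓ : ∀ m k, ℓ m k ∈ Set.Icc (0 : ℝ) 1)
    (hℓ0 : ∀ m, ∃ k, ℓ m k = 0) (hℓ1 : ∀ m, ∃ k, ℓ m k = 1)
    {t lo : ℕ → ℝ} (ht : Filter.Tendsto t Filter.atTop Filter.atTop)
    (hZ : ∀ m i j, kind i = false → kind j = false →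
      ((4 : ℂ) • (V' m * diagonal (fun i => ((Real.exp (lo m + t m * ℓ m (Sum.inr i)) : ℝ) : ℂ))
        * (V' m)ᴴ) - ((e i).toBlocks₁₂ - (e j).toBlocks₁₂)ᴴ *
        (V m * diagonal (fun i => ((Real.exp (lo m + t m * ℓ m (Sum.inl i)) : ℝ) : ℂ))
        * (V m)ᴴ) * ((e i).toBlocks₁₂ - (e j).toBlocks₁₂)).PosSemidef)
    {Q : ℕ → κ → Matrix (Fin p) (Fin p) ℂ} {R : ℕ → κ → Matrix (Fin q) (Fin q) ℂ}
    (hQ : ∀ m j, (Q m j).BlockTriangular id ∧ IsUnit (Q m j).det ∧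
      (Q m j)ᴴ * Q m j = (e j).toBlocks₁₁ᴴ *
        (V m * diagonal (fun i => ((Real.exp (lo m + t m * ℓ m (Sum.inl i)) : ℝ) : ℂ))
        * (V m)ᴴ) * (e j).toBlocks₁₁)
    (hR : ∀ m j, (R m j).BlockTriangular id ∧ IsUnit (R m j).det ∧
      (R m j)ᴴ * R m j = (e j).toBlocks₂₂ᴴ *
        (V' m * diagonal (fun i => ((Real.exp (lo m + t m * ℓ m (Sum.inr i)) : ℝ) : ℂ))
        * (V' m)ᴴ) * (e j).toBlocks₂₂) {E₀ : ℝ}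
    (hE : ∀ m, ∑ j, (∑ k, a j k * (2 * Real.log ‖Q m j k k‖)
      + ∑ k, b j k * (2 * Real.log ‖R m j k k‖)) ≤ E₀) : False := by
  classical
  let 𝒰 : Ultrafilter ℕ := Filter.hyperfilter ℕ
  have h𝒰 : (𝒰 : Filter ℕ) ≤ Filter.atTop := Nat.hyperfilter_le_atTop
  replace ht : Filter.Tendsto t 𝒰 Filter.atTop := ht.mono_left h𝒰
  obtain ⟨V₀, hV₀⟩ := exists_tendsto_of_bounded 𝒰 (f := V) (B := 1)
    (Filter.Eventually.of_forall fun m => norm_le_one_of_unitary (hV m))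
  obtain ⟨V₀', hV₀'⟩ := exists_tendsto_of_bounded 𝒰 (f := V') (B := 1)
    (Filter.Eventually.of_forall fun m => norm_le_one_of_unitary (hV' m))
  obtain ⟨ℓ₀, hℓ₀⟩ := exists_tendsto_real_of_bounded 𝒰 (f := ℓ) (B := 0) (C := 1)
    (Filter.Eventually.of_forall fun m => hℓ m)
  have hu := unitary_of_tendsto hV₀ hV
  have hu' := unitary_of_tendsto hV₀' hV'
  have hlk : ∀ k, Filter.Tendsto (fun m => ℓ m k) 𝒰 (nhds (ℓ₀ k)) := tendsto_pi_nhds.1 hℓ₀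
  have hl : Filter.Tendsto (fun m i => ℓ m (Sum.inl i)) 𝒰 (nhds fun i => ℓ₀ (Sum.inl i)) :=
    tendsto_pi_nhds.2 fun i => hlk _
  have hl' : Filter.Tendsto (fun m i => ℓ m (Sum.inr i)) 𝒰 (nhds fun i => ℓ₀ (Sum.inr i)) :=
    tendsto_pi_nhds.2 fun i => hlk _
  have hIcc : ∀ k, ℓ₀ k ∈ Set.Icc (0 : ℝ) 1 := fun k =>
    isClosed_Icc.mem_of_tendsto (hlk k) (Filter.Eventually.of_forall fun m => hℓ m k)
  obtain ⟨k₀, hk₀⟩ : ∃ k, ℓ₀ k = 0 := by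
    have h1 := tendsto_finsetProd Finset.univ fun k _ => hlk k
    have h2 : ∀ m, ∏ k, ℓ m k = 0 := fun m => by
      obtain ⟨k, hk⟩ := hℓ0 m
      exact Finset.prod_eq_zero (Finset.mem_univ k) hk
    simp only [h2] at h1
    obtain ⟨k, -, hk⟩ := Finset.prod_eq_zero_iff.1 (tendsto_nhds_unique h1 tendsto_const_nhds)
    exact ⟨k, hk⟩
  obtain ⟨k₁, hk₁⟩ : ∃ k, ℓ₀ k = 1 := by
    have h1 := tendsto_finsetProd Finset.univ fun k _ => (hlk k).const_sub 1
    have h2 : ∀ m, ∏ k, (1 - ℓ m k) = 0 := fun m => by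
      obtain ⟨k, hk⟩ := hℓ1 m
      exact Finset.prod_eq_zero (Finset.mem_univ k) (by rw [hk, sub_self])
    simp only [h2] at h1
    obtain ⟨k, -, hk⟩ := Finset.prod_eq_zero_iff.1 (tendsto_nhds_unique h1 tendsto_const_nhds)
    exact ⟨k, by linarith⟩
  obtain ⟨T, c, hT, hc⟩ := exists_layers (Finset.univ.image ℓ₀) (by
    intro x hx
    obtain ⟨k, -, rfl⟩ := Finset.mem_image.1 hx
    exact (hIcc k).1)
  replace hc : ∀ k, ℓ₀ k = ∑ θ ∈ T, c θ * (if θ < ℓ₀ k then 1 else 0) := fun k =>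
    hc _ (Finset.mem_image_of_mem ℓ₀ (Finset.mem_univ k))
  have hTne : T.Nonempty := by
    by_contra h
    have := hc k₁
    rw [Finset.not_nonempty_iff_eq_empty.1 h, Finset.sum_empty, hk₁] at this
    exact one_ne_zero this
  set X := fun θ => lowSpace V₀ (fun i => ℓ₀ (Sum.inl i)) θ with hX
  set Y := fun θ => lowSpace V₀' (fun i => ℓ₀ (Sum.inr i)) θ with hY
  have hneg : ∀ θ ∈ T, totalSlope a b e (X θ) (Y θ) < 0 := by
    intro θ hθ
    obtain ⟨-, h0, x, hx, hlt⟩ := hT θ hθ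
    obtain ⟨k, -, rfl⟩ := Finset.mem_image.1 hx
    have hθ1 : θ < 1 := hlt.trans_le (hIcc k).2
    refine hst.2 _ _ (fun i j hi hj v hv => ?_) ?_ ?_
    · exact mem_lowSpace_of_degeneration hV₀ hV₀' hV' (mul_eq_one_comm.1 hu') hl hl' ht
        (fun m => hZ m i j hi hj) hv
    · rintro ⟨h1, h2⟩
      rcases k₀ with k | k
      · exact lowSpace_ne_bot hu (i := k) (by rw [hk₀]; exact h0) h1
      · exact lowSpace_ne_bot hu' (i := k) (by rw [hk₀]; exact h0) h2
    · rintro ⟨h1, h2⟩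
      rcases k₁ with k | k
      · exact lowSpace_ne_top hu (i := k) (by rw [hk₁]; exact hθ1) h1
      · exact lowSpace_ne_top hu' (i := k) (by rw [hk₁]; exact hθ1) h2
  have hgram : ∀ {n : ℕ} (W D g : Matrix (Fin n) (Fin n) ℂ),
      gᴴ * (W * D * Wᴴ) * g = (Wᴴ * g)ᴴ * D * (Wᴴ * g) := by
    intro n W D g
    rw [conjTranspose_mul, conjTranspose_conjTranspose]
    simp only [Matrix.mul_assoc]
  choose s hs hs' using fun j => exists_asymptotic_lower (hst.1 j).1 hV₀ hu hl ht
    (fun m => (hQ m j).1) (fun m => (hQ m j).2.1)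
    (fun m => (hQ m j).2.2.trans (hgram _ _ _)) (ha j) (fun i => hc (Sum.inl i))
  choose r hr hr' using fun j => exists_asymptotic_lower (hst.1 j).2 hV₀' hu' hl' ht
    (fun m => (hR m j).1) (fun m => (hR m j).2.1)
    (fun m => (hR m j).2.2.trans (hgram _ _ _)) (hb j) (fun i => hc (Sum.inr i))
  have hlim := tendsto_finsetSum Finset.univ fun j _ => (hs j).add (hr j)
  have hval : ∑ j, (∑ θ ∈ T, c θ * (∑ k, a j k - slope (a j) (e j).toBlocks₁₁ (X θ))
      + ∑ θ ∈ T, c θ * (∑ k, b j k - slope (b j) (e j).toBlocks₂₂ (Y θ)))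
      = ∑ θ ∈ T, c θ * (-totalSlope a b e (X θ) (Y θ)) := by
    simp only [← Finset.sum_add_distrib]
    rw [Finset.sum_comm]
    refine Finset.sum_congr rfl fun θ _ => ?_
    have : -totalSlope a b e (X θ) (Y θ) = ∑ j, (∑ i, a j i + ∑ i, b j i)
        - totalSlope a b e (X θ) (Y θ) := by rw [htr]; ring
    rw [this, totalSlope, ← Finset.sum_sub_distrib, Finset.mul_sum]
    refine Finset.sum_congr rfl fun j _ => ?_
    ring
  rw [hval] at hlim
  have hpos : 0 < ∑ θ ∈ T, c θ * (-totalSlope a b e (X θ) (Y θ)) :=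
    Finset.sum_pos (fun θ hθ => mul_pos (hT θ hθ).1 (neg_pos.2 (hneg θ hθ))) hTne
  have htop := (ht.atTop_mul_pos hpos hlim).eventually_gt_atTop E₀
  obtain ⟨m, hm, h1, h2⟩ := (htop.and ((Filter.eventually_all.2 hs').and
    (Filter.eventually_all.2 hr'))).exists
  have h3 := Finset.sum_le_sum fun j (_ : j ∈ Finset.univ) => add_le_add (h1 j) (h2 j)
  have h4 : ∑ j, ((∑ k, a j k) * lo m + t m * s j m + ((∑ k, b j k) * lo m + t m * r j m))
      = (∑ j, (∑ i, a j i + ∑ i, b j i)) * lo m + t m * ∑ j, (s j m + r j m) := by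
    rw [Finset.sum_mul, Finset.mul_sum, ← Finset.sum_add_distrib]
    exact Finset.sum_congr rfl fun j _ => by ring
  rw [h4, htr, zero_mul, zero_add] at h3
  exact absurd (h3.trans (hE m)) (not_le.2 hm)

end

section

theorem exists_spectral_exp {n : ℕ} {A : Matrix (Fin n) (Fin n) ℂ} (hA : A.PosDef) :
    ∃ (V : Matrix (Fin n) (Fin n) ℂ) (x : Fin n → ℝ), Vᴴ * V = 1 ∧ V * Vᴴ = 1 ∧
      A = V * diagonal (fun i => ((Real.exp (x i) : ℝ) : ℂ)) * Vᴴ := by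
  obtain ⟨V, l, h1, h2, h3⟩ := exists_spectral hA.isHermitian
  have hd : Vᴴ * A * V = diagonal (fun i => (l i : ℂ)) := by
    rw [h3]
    calc Vᴴ * (V * diagonal (fun i => (l i : ℂ)) * Vᴴ) * V
        = (Vᴴ * V) * diagonal (fun i => (l i : ℂ)) * (Vᴴ * V) := by
          simp only [Matrix.mul_assoc]
      _ = _ := by rw [h1, Matrix.one_mul, Matrix.mul_one]
  have hpos : (diagonal (fun i => (l i : ℂ))).PosDef := by
    rw [← hd]
    exact hA.conjTranspose_mul_mul_same (Matrix.mulVec_injective_of_isUnit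
      (IsUnit.of_mul_eq_one_right _ h1))
  have hl : ∀ i, 0 < l i := fun i => by
    have := Matrix.posDef_diagonal_iff.1 hpos i
    exact_mod_cast this
  refine ⟨V, fun i => Real.log (l i), h1, h2, ?_⟩
  simp only [Real.exp_log (hl _)]
  exact h3

theorem posSemidef_sub_smul_one {n : ℕ} {V : Matrix (Fin n) (Fin n) ℂ} (hV : V * Vᴴ = 1)
    {d : Fin n → ℝ} {c : ℝ} (h : ∀ i, c ≤ d i) :
    (V * diagonal (fun i => (d i : ℂ)) * Vᴴ - (c : ℂ) • 1).PosSemidef := by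
  have : V * diagonal (fun i => (d i : ℂ)) * Vᴴ - (c : ℂ) • 1
      = V * diagonal (fun i => ((d i - c : ℝ) : ℂ)) * Vᴴ := by
    have h1 : diagonal (fun i => ((d i - c : ℝ) : ℂ))
        = diagonal (fun i => (d i : ℂ)) - (c : ℂ) • (1 : Matrix (Fin n) (Fin n) ℂ) := by
      ext i j
      by_cases hij : i = j <;> simp [hij, one_apply]
    rw [h1, Matrix.mul_sub, Matrix.sub_mul, Matrix.mul_smul, Matrix.smul_mul, Matrix.mul_one, hV]
  rw [this]
  refine PosSemidef.mul_mul_conjTranspose_same (PosSemidef.diagonal fun i => ?_) V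
  exact Complex.zero_le_real.2 (sub_nonneg.2 (h i))

theorem posSemidef_smul_one_sub {n : ℕ} {V : Matrix (Fin n) (Fin n) ℂ} (hV : V * Vᴴ = 1)
    {d : Fin n → ℝ} {c : ℝ} (h : ∀ i, d i ≤ c) :
    ((c : ℂ) • 1 - V * diagonal (fun i => (d i : ℂ)) * Vᴴ).PosSemidef := by
  have := posSemidef_sub_smul_one hV (d := fun i => -d i) (c := -c) fun i => neg_le_neg (h i)
  have e : (diagonal fun i => ((-d i : ℝ) : ℂ)) = -diagonal (fun i => (d i : ℂ)) := by
    ext i j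
    by_cases hij : i = j <;> simp [hij]
  rw [e] at this
  convert this using 1
  simp only [Matrix.mul_neg, Matrix.neg_mul, Complex.ofReal_neg, neg_smul]
  abel

variable {p q : ℕ} {κ : Type} [Fintype κ]

/-- Along a sublevel set of the energy, the condition numbers of the positive parts of a
stable datum are bounded. -/
theorem exists_condition_bound [Nonempty (Fin p ⊕ Fin q)] {kind : κ → Bool}
    {a : κ → Fin p → ℝ} {b : κ → Fin q → ℝ}
    {e : Datum p q κ} (ha : ∀ j, Antitone (a j)) (hb : ∀ j, Antitone (b j))
    (htr : ∑ j, (∑ i, a j i + ∑ i, b j i) = 0) (hst : Stable kind a b e) (E₀ : ℝ) :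
    ∃ B : ℝ, 0 < B ∧ ∀ (A : Matrix (Fin p) (Fin p) ℂ) (N : Matrix (Fin q) (Fin q) ℂ)
      (Q : κ → Matrix (Fin p) (Fin p) ℂ) (R : κ → Matrix (Fin q) (Fin q) ℂ),
      A.PosDef → N.PosDef →
      (∀ i j, kind i = false → kind j = false → ((4 : ℂ) • N -
        ((e i).toBlocks₁₂ - (e j).toBlocks₁₂)ᴴ * A *
          ((e i).toBlocks₁₂ - (e j).toBlocks₁₂)).PosSemidef) →
      (∀ j, (Q j).BlockTriangular id ∧ IsUnit (Q j).det ∧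
        (Q j)ᴴ * Q j = (e j).toBlocks₁₁ᴴ * A * (e j).toBlocks₁₁) →
      (∀ j, (R j).BlockTriangular id ∧ IsUnit (R j).det ∧
        (R j)ᴴ * R j = (e j).toBlocks₂₂ᴴ * N * (e j).toBlocks₂₂) →
      ∑ j, (∑ k, a j k * (2 * Real.log ‖Q j k k‖)
        + ∑ k, b j k * (2 * Real.log ‖R j k k‖)) ≤ E₀ →
      ∃ c : ℝ, 0 < c ∧ (A - (c : ℂ) • 1).PosSemidef ∧ (((c * B : ℝ) : ℂ) • 1 - A).PosSemidef ∧
        (N - (c : ℂ) • 1).PosSemidef ∧ (((c * B : ℝ) : ℂ) • 1 - N).PosSemidef := by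
  by_contra! hcon
  choose A N Q R hA hN hZ hQ hR hE hc using fun m : ℕ => hcon (Real.exp m) (Real.exp_pos _)
  choose V x hV hV1 hAx using fun m => exists_spectral_exp (hA m)
  choose V' x' hV' hV1' hNx using fun m => exists_spectral_exp (hN m)
  set z : ℕ → Fin p ⊕ Fin q → ℝ := fun m => Sum.elim (x m) (x' m) with hz
  choose k₀ hk₀ using fun m => Finite.exists_min (z m)
  choose k₁ hk₁ using fun m => Finite.exists_max (z m)
  set lo : ℕ → ℝ := fun m => z m (k₀ m) with hlo
  set t : ℕ → ℝ := fun m => z m (k₁ m) - z m (k₀ m) with ht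
  have htm : ∀ m : ℕ, (m : ℝ) < t m := by
    intro m
    by_contra! hle
    have hb1 : ∀ k, Real.exp (lo m) ≤ Real.exp (z m k) := fun k => Real.exp_le_exp.2 (hk₀ m k)
    have hb2 : ∀ k, Real.exp (z m k) ≤ Real.exp (lo m) * Real.exp m := fun k => by
      rw [← Real.exp_add, Real.exp_le_exp]
      have := hk₁ m k
      simp only [ht, hlo] at hle ⊢
      linarith
    refine hc m (Real.exp (lo m)) (Real.exp_pos _) ?_ ?_ ?_ ?_
    · rw [hAx m]
      exact posSemidef_sub_smul_one (hV1 m) fun i => hb1 (Sum.inl i)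
    · rw [hAx m]
      exact posSemidef_smul_one_sub (hV1 m) fun i => hb2 (Sum.inl i)
    · rw [hNx m]
      exact posSemidef_sub_smul_one (hV1' m) fun i => hb1 (Sum.inr i)
    · rw [hNx m]
      exact posSemidef_smul_one_sub (hV1' m) fun i => hb2 (Sum.inr i)
  have ht0 : ∀ m, 0 < t m := fun m => (Nat.cast_nonneg m).trans_lt (htm m)
  set ℓ : ℕ → Fin p ⊕ Fin q → ℝ := fun m k => (z m k - lo m) / t m with hℓ
  have hzℓ : ∀ m k, lo m + t m * ℓ m k = z m k := fun m k => by
    simp only [hℓ]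
    rw [mul_div_cancel₀ _ (ht0 m).ne']
    ring
  refine not_degenerate ha hb htr hst hV hV' (ℓ := ℓ) ?_ ?_ ?_ (t := t) (lo := lo) ?_ ?_ (Q := Q)
    (R := R) ?_ ?_ hE
  · intro m k
    refine ⟨div_nonneg (sub_nonneg.2 (hk₀ m k)) (ht0 m).le, (div_le_one (ht0 m)).2 ?_⟩
    exact sub_le_sub_right (hk₁ m k) _
  · exact fun m => ⟨k₀ m, by simp [hℓ, hlo]⟩
  · exact fun m => ⟨k₁ m, div_self (ht0 m).ne'⟩
  · exact Filter.tendsto_atTop_mono (fun m => (htm m).le) tendsto_natCast_atTop_atTop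
  · intro m i j hi hj
    simp only [hzℓ]
    have := hZ m i j hi hj
    rw [hAx m, hNx m] at this
    exact this
  · intro m j
    simp only [hzℓ]
    have := hQ m j
    rw [hAx m] at this
    exact this
  · intro m j
    simp only [hzℓ]
    have := hR m j
    rw [hNx m] at this
    exact this

end

section

/-! ### Normalisation and existence of minimisers -/

theorem posDef_of_gram {n : ℕ} {A g Q : Matrix (Fin n) (Fin n) ℂ} (hg : IsUnit g.det)
    (hQ : IsUnit Q.det) (h : Qᴴ * Q = gᴴ * A * g) : A.PosDef := by
  have hA : A = (Q * g⁻¹)ᴴ * (Q * g⁻¹) := by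
    rw [conjTranspose_mul, Matrix.mul_assoc, ← Matrix.mul_assoc Qᴴ, h, conjTranspose_nonsing_inv,
      Matrix.mul_assoc, mul_nonsing_inv _ hg, Matrix.mul_one,
      ← Matrix.mul_assoc, nonsing_inv_mul _ (by rw [det_conjTranspose]; exact hg.star),
      Matrix.one_mul]
  rw [hA]
  apply Matrix.PosDef.conjTranspose_mul_self
  refine Matrix.mulVec_injective_of_isUnit ((Matrix.isUnit_iff_isUnit_det _).2 ?_)
  rw [det_mul, det_nonsing_inv]
  exact hQ.mul (IsUnit.ringInverse hg)

variable {p q : ℕ}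

/-- A Hermitian form of signature `(p, q)` in terms of its Schur complement data. -/
def schurForm (A : Matrix (Fin p) (Fin p) ℂ) (Y : Matrix (Fin p) (Fin q) ℂ)
    (N : Matrix (Fin q) (Fin q) ℂ) : Matrix (Fin p ⊕ Fin q) (Fin p ⊕ Fin q) ℂ :=
  fromBlocks A (A * Y) (Yᴴ * A) (Yᴴ * A * Y - N)

theorem frameMat_schurForm (E : Matrix (Fin p ⊕ Fin q) (Fin p ⊕ Fin q) ℂ)
    (A : Matrix (Fin p) (Fin p) ℂ) (Y : Matrix (Fin p) (Fin q) ℂ) (N : Matrix (Fin q) (Fin q) ℂ) :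
    (frameMat E)ᴴ * schurForm A Y N * frameMat E = fromBlocks
      (E.toBlocks₁₁ᴴ * A * E.toBlocks₁₁)
      (E.toBlocks₁₁ᴴ * A * (Y + E.toBlocks₁₂) * E.toBlocks₂₂)
      (E.toBlocks₂₂ᴴ * (Y + E.toBlocks₁₂)ᴴ * A * E.toBlocks₁₁)
      (E.toBlocks₂₂ᴴ * ((Y + E.toBlocks₁₂)ᴴ * A * (Y + E.toBlocks₁₂) - N) * E.toBlocks₂₂) := by
  rw [frameMat, schurForm, fromBlocks_conjTranspose, fromBlocks_multiply, fromBlocks_multiply]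
  congr 1
  · simp
  · simp only [conjTranspose_zero, Matrix.zero_mul, add_zero, Matrix.mul_add, Matrix.add_mul,
      Matrix.mul_assoc]
    abel
  · simp only [conjTranspose_add, conjTranspose_mul, Matrix.mul_add, Matrix.add_mul,
      Matrix.mul_assoc, Matrix.mul_zero, add_zero]
    abel
  · simp only [conjTranspose_add, conjTranspose_mul, Matrix.mul_add, Matrix.add_mul,
      Matrix.mul_sub, Matrix.sub_mul, Matrix.mul_assoc]
    abel

theorem exists_schurForm {E U P : Matrix (Fin p ⊕ Fin q) (Fin p ⊕ Fin q) ℂ}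
    (hE : IsUnit E.toBlocks₁₁.det ∧ IsUnit E.toBlocks₂₂.det)
    (hU : U.BlockTriangular (pos true)) (hUd : IsUnit U.det)
    (h : Uᴴ * sgn p q * U = (frameMat E)ᴴ * P * frameMat E) :
    ∃ A Y N, A.PosDef ∧ P = schurForm A Y N := by
  have hF : IsUnit (frameMat E).det := by
    rw [frameMat, det_fromBlocks_zero₂₁]; exact hE.1.mul hE.2
  set F := frameMat E with hFdef
  have hP : P = (U * F⁻¹)ᴴ * sgn p q * (U * F⁻¹) := by
    calc P = (F⁻¹)ᴴ * (Fᴴ * P * F) * F⁻¹ := by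
          rw [conjTranspose_nonsing_inv]
          have h1 : (Fᴴ)⁻¹ * Fᴴ = 1 :=
            nonsing_inv_mul _ (by rw [det_conjTranspose]; exact hF.star)
          calc P = ((Fᴴ)⁻¹ * Fᴴ) * P * (F * F⁻¹) := by
                rw [h1, mul_nonsing_inv _ hF, Matrix.one_mul, Matrix.mul_one]
            _ = _ := by simp only [Matrix.mul_assoc]
      _ = _ := by
          rw [← h, conjTranspose_mul]
          simp only [Matrix.mul_assoc]
  have hPH : Pᴴ = P := by
    rw [hP]
    simp only [conjTranspose_mul, conjTranspose_conjTranspose, sgn_conjTranspose, Matrix.mul_assoc]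
  have hPb := fromBlocks_toBlocks P
  set A := P.toBlocks₁₁ with hAdef
  set P₁₂ := P.toBlocks₁₂ with hP12
  have hP21 : P.toBlocks₂₁ = P₁₂ᴴ := by
    have := congrArg toBlocks₂₁ hPH
    rw [← hPb, fromBlocks_conjTranspose] at this
    simpa using this.symm
  have hA : A.PosDef := by
    have h2 := h
    rw [← fromBlocks_toBlocks U] at hU h2
    obtain ⟨-, hC, -⟩ := blockTriangular_true.1 hU
    rw [hC, ← hPb, hFdef, frameMat, sgn, fromBlocks_conjTranspose, fromBlocks_conjTranspose,
      fromBlocks_multiply, fromBlocks_multiply, fromBlocks_multiply, fromBlocks_multiply] at h2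
    have h3 := congrArg toBlocks₁₁ h2
    simp only [toBlocks_fromBlocks₁₁, conjTranspose_zero, Matrix.mul_zero, Matrix.zero_mul,
      add_zero, Matrix.mul_one] at h3
    refine posDef_of_gram hE.1 ?_ h3
    rw [← fromBlocks_toBlocks U, hC, det_fromBlocks_zero₂₁] at hUd
    exact isUnit_of_mul_isUnit_left hUd
  have hAd : IsUnit A.det := (Matrix.isUnit_iff_isUnit_det _).1 hA.isUnit
  refine ⟨A, A⁻¹ * P₁₂, (A⁻¹ * P₁₂)ᴴ * A * (A⁻¹ * P₁₂) - P.toBlocks₂₂, hA, ?_⟩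
  rw [schurForm, mul_nonsing_inv_cancel_left _ _ hAd, sub_sub_cancel, conjTranspose_mul,
    conjTranspose_nonsing_inv, hA.isHermitian.eq, Matrix.mul_assoc, nonsing_inv_mul _ hAd,
    Matrix.mul_one, ← hP21]
  exact hPb.symm

/-- Triangular factors of the first kind of a form in Schur form. -/
theorem schur_factor_true {E U : Matrix (Fin p ⊕ Fin q) (Fin p ⊕ Fin q) ℂ}
    {A : Matrix (Fin p) (Fin p) ℂ} {Y : Matrix (Fin p) (Fin q) ℂ} {N : Matrix (Fin q) (Fin q) ℂ}
    (hE : IsUnit E.toBlocks₁₁.det ∧ IsUnit E.toBlocks₂₂.det)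
    (hU : U.BlockTriangular (pos true)) (hUd : IsUnit U.det)
    (h : Uᴴ * sgn p q * U = (frameMat E)ᴴ * schurForm A Y N * frameMat E) :
    ∃ Q C R, U = fromBlocks Q C 0 R ∧ Q.BlockTriangular id ∧ R.BlockTriangular id ∧
      IsUnit Q.det ∧ IsUnit R.det ∧ Qᴴ * Q = E.toBlocks₁₁ᴴ * A * E.toBlocks₁₁ ∧
      C = Q * E.toBlocks₁₁⁻¹ * (Y + E.toBlocks₁₂) * E.toBlocks₂₂ ∧
      Rᴴ * R = E.toBlocks₂₂ᴴ * N * E.toBlocks₂₂ := by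
  rw [← fromBlocks_toBlocks U] at hU h hUd
  obtain ⟨hQ, hC, hR⟩ := blockTriangular_true.1 hU
  rw [hC] at h hUd
  have hUb : U = fromBlocks U.toBlocks₁₁ U.toBlocks₁₂ 0 U.toBlocks₂₂ := by
    rw [← hC, fromBlocks_toBlocks]
  set Q := U.toBlocks₁₁ with hQdef
  set C := U.toBlocks₁₂ with hCdef
  set R := U.toBlocks₂₂ with hRdef
  set g := E.toBlocks₁₁ with hg
  rw [det_fromBlocks_zero₂₁] at hUd
  have hQd := isUnit_of_mul_isUnit_left hUd
  have hRd := isUnit_of_mul_isUnit_right hUd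
  rw [frameMat_schurForm, sgn, fromBlocks_conjTranspose, fromBlocks_multiply, fromBlocks_multiply,
    fromBlocks_inj] at h
  obtain ⟨h1, h2, -, h4⟩ := h
  simp only [conjTranspose_zero, Matrix.mul_zero, Matrix.zero_mul, add_zero, zero_add,
    Matrix.mul_one, Matrix.mul_neg, Matrix.neg_mul, neg_zero] at h1 h2 h4
  rw [← hg] at h1 h2
  have hCval : C = Q * g⁻¹ * (Y + E.toBlocks₁₂) * E.toBlocks₂₂ := by
    have hQh : IsUnit (Qᴴ).det := by rw [det_conjTranspose]; exact hQd.star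
    have h3 : Qᴴ * C = Qᴴ * (Q * g⁻¹ * (Y + E.toBlocks₁₂) * E.toBlocks₂₂) := by
      rw [h2]
      calc gᴴ * A * (Y + E.toBlocks₁₂) * E.toBlocks₂₂
          = (gᴴ * A * g) * g⁻¹ * (Y + E.toBlocks₁₂) * E.toBlocks₂₂ := by
            rw [mul_nonsing_inv_cancel_right _ _ hE.1]
        _ = _ := by rw [← h1]; simp only [Matrix.mul_assoc]
    have := congrArg (fun M => (Qᴴ)⁻¹ * M) h3
    simpa only [nonsing_inv_mul_cancel_left _ _ hQh] using this
  refine ⟨Q, C, R, hUb, hQ, hR, hQd, hRd, h1, hCval, ?_⟩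
  have hCC : Cᴴ * C = E.toBlocks₂₂ᴴ * ((Y + E.toBlocks₁₂)ᴴ * A * (Y + E.toBlocks₁₂))
      * E.toBlocks₂₂ := by
    have h5 : Cᴴ * C = E.toBlocks₂₂ᴴ * (Y + E.toBlocks₁₂)ᴴ * ((g⁻¹)ᴴ * (Qᴴ * Q) * g⁻¹) *
        (Y + E.toBlocks₁₂) * E.toBlocks₂₂ := by
      rw [hCval]
      simp only [conjTranspose_mul, Matrix.mul_assoc]
    have h6 : (g⁻¹)ᴴ * (Qᴴ * Q) * g⁻¹ = A := by
      rw [h1, conjTranspose_nonsing_inv, Matrix.mul_assoc, Matrix.mul_assoc, Matrix.mul_assoc,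
        mul_nonsing_inv _ hE.1, Matrix.mul_one, nonsing_inv_mul_cancel_left]
      rw [det_conjTranspose]; exact hE.1.star
    rw [h5, h6]
    simp only [Matrix.mul_assoc]
  rw [hCC, Matrix.mul_sub, Matrix.sub_mul, ← sub_eq_add_neg] at h4
  exact sub_right_injective h4

/-- Triangular factors of the second kind of a form in Schur form. -/
theorem schur_factor_false {E U : Matrix (Fin p ⊕ Fin q) (Fin p ⊕ Fin q) ℂ}
    {A : Matrix (Fin p) (Fin p) ℂ} {Y : Matrix (Fin p) (Fin q) ℂ} {N : Matrix (Fin q) (Fin q) ℂ}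
    (hU : U.BlockTriangular (pos false)) (hUd : IsUnit U.det)
    (h : Uᴴ * sgn p q * U = (frameMat E)ᴴ * schurForm A Y N * frameMat E) :
    ∃ Q C R, U = fromBlocks Q 0 C R ∧ Q.BlockTriangular id ∧ R.BlockTriangular id ∧
      IsUnit Q.det ∧ IsUnit R.det ∧ Qᴴ * Q = E.toBlocks₁₁ᴴ * A * E.toBlocks₁₁ + Cᴴ * C ∧
      C = -((Rᴴ)⁻¹ * (E.toBlocks₂₂ᴴ * (Y + E.toBlocks₁₂)ᴴ * A * E.toBlocks₁₁)) ∧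
      Rᴴ * R = E.toBlocks₂₂ᴴ * (N - (Y + E.toBlocks₁₂)ᴴ * A * (Y + E.toBlocks₁₂))
        * E.toBlocks₂₂ := by
  rw [← fromBlocks_toBlocks U] at hU h hUd
  obtain ⟨hQ, hC, hR⟩ := blockTriangular_false.1 hU
  rw [hC] at h hUd
  have hUb : U = fromBlocks U.toBlocks₁₁ 0 U.toBlocks₂₁ U.toBlocks₂₂ := by
    rw [← hC, fromBlocks_toBlocks]
  rw [det_fromBlocks_zero₁₂] at hUd
  have hQd := isUnit_of_mul_isUnit_left hUd
  have hRd := isUnit_of_mul_isUnit_right hUd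
  rw [frameMat_schurForm, sgn, fromBlocks_conjTranspose, fromBlocks_multiply, fromBlocks_multiply,
    fromBlocks_inj] at h
  obtain ⟨h1, -, h3, h4⟩ := h
  simp only [conjTranspose_zero, Matrix.mul_zero, Matrix.zero_mul, add_zero, zero_add,
    Matrix.mul_one, Matrix.mul_neg, Matrix.neg_mul] at h1 h3 h4
  refine ⟨_, _, _, hUb, hQ, hR, hQd, hRd, ?_, ?_, ?_⟩
  · rw [← h1]; abel
  · rw [← h3, Matrix.mul_neg, neg_neg, nonsing_inv_mul_cancel_left]
    rw [det_conjTranspose]; exact hRd.star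
  · rw [← neg_inj, h4, ← Matrix.neg_mul, ← Matrix.mul_neg, neg_sub]

end

section

variable {p q : ℕ} {κ : Type}

theorem Feasible.diag_ne_zero {kind : κ → Bool} {e U : Datum p q κ}
    {P : Matrix (Fin p ⊕ Fin q) (Fin p ⊕ Fin q) ℂ} (h : Feasible kind e P U) (j : κ)
    (k : Fin p ⊕ Fin q) : U j k k ≠ 0 := by
  obtain ⟨h1, h2, -⟩ := h j
  rw [det_of_blockTriangular_injective (pos_injective _) h1, isUnit_iff_ne_zero,
    Finset.prod_ne_zero_iff] at h2
  exact h2 k (Finset.mem_univ k)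

theorem Feasible.smul {kind : κ → Bool} {e U : Datum p q κ}
    {P : Matrix (Fin p ⊕ Fin q) (Fin p ⊕ Fin q) ℂ} (h : Feasible kind e P U) {t : ℝ} (ht : t ≠ 0) :
    Feasible kind e (((t ^ 2 : ℝ) : ℂ) • P) fun j => (t : ℂ) • U j := by
  intro j
  obtain ⟨h1, h2, h3⟩ := h j
  refine ⟨fun i k hik => by
    change (t : ℂ) * U j i k = 0
    rw [h1 hik, mul_zero], ?_, ?_⟩
  · rw [det_smul]
    exact (isUnit_iff_ne_zero.2 (pow_ne_zero _ (ofReal_ne_zero.2 ht))).mul h2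
  · rw [conjTranspose_smul, Matrix.smul_mul, Matrix.smul_mul, Matrix.mul_smul, h3, smul_smul,
      Matrix.mul_smul, Matrix.smul_mul, RCLike.star_def, conj_ofReal, ← ofReal_mul, sq]

theorem energy_smul [Fintype κ] {a : κ → Fin p → ℝ} {b : κ → Fin q → ℝ}
    (htr : ∑ j, (∑ i, a j i + ∑ i, b j i) = 0) {U : Datum p q κ} (hU : ∀ j k, U j k k ≠ 0)
    {t : ℝ} (ht : 0 < t) : energy a b (fun j => (t : ℂ) • U j) = energy a b U := by
  have h1 : ∀ j k, Sum.elim (a j) (b j) k * (2 * Real.log ‖((t : ℂ) • U j) k k‖)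
      = Sum.elim (a j) (b j) k * (2 * Real.log t)
        + Sum.elim (a j) (b j) k * (2 * Real.log ‖U j k k‖) := by
    intro j k
    rw [Matrix.smul_apply, smul_eq_mul, norm_mul, norm_real, Real.norm_eq_abs, abs_of_pos ht,
      Real.log_mul ht.ne' (norm_ne_zero_iff.2 (hU j k))]
    ring
  simp only [energy, h1, Finset.sum_add_distrib, ← Finset.sum_mul]
  have h2 : ∑ j, ∑ k, Sum.elim (a j) (b j) k = 0 := by
    rw [← htr]
    simp only [Fintype.sum_sum_type, Sum.elim_inl, Sum.elim_inr]
  rw [h2, zero_mul, zero_add]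

theorem smul_schurForm (t : ℂ) (A : Matrix (Fin p) (Fin p) ℂ) (Y : Matrix (Fin p) (Fin q) ℂ)
    (N : Matrix (Fin q) (Fin q) ℂ) : t • schurForm A Y N = schurForm (t • A) Y (t • N) := by
  rw [schurForm, schurForm, fromBlocks_smul]
  simp only [Matrix.smul_mul, Matrix.mul_smul, smul_sub]

theorem Feasible.exists_posDef {kind : κ → Bool} {e U : Datum p q κ}
    {P : Matrix (Fin p ⊕ Fin q) (Fin p ⊕ Fin q) ℂ} (he : IsFramed e) (h : Feasible kind e P U)
    {jt : κ} (hjt : kind jt = true) :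
    ∃ A Y N, A.PosDef ∧ N.PosDef ∧ P = schurForm A Y N := by
  obtain ⟨h1, h2, h3⟩ := h jt
  rw [hjt] at h1
  obtain ⟨A, Y, N, hA, rfl⟩ := exists_schurForm (he jt) h1 h2 h3
  obtain ⟨Q, C, R, -, -, -, -, hR, -, -, hR'⟩ := schur_factor_true (he jt) h1 h2 h3
  exact ⟨A, Y, N, hA, posDef_of_gram (he jt).2 hR hR', rfl⟩

theorem posDef_conj {n : ℕ} {A g : Matrix (Fin n) (Fin n) ℂ} (hA : A.PosDef) (hg : IsUnit g.det) :
    (gᴴ * A * g).PosDef :=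
  hA.conjTranspose_mul_mul_same
    (Matrix.mulVec_injective_of_isUnit ((Matrix.isUnit_iff_isUnit_det _).2 hg))

theorem log_diag_mono {n : ℕ} {U U' : Matrix (Fin n) (Fin n) ℂ} (hU : U.BlockTriangular id)
    (hUd : IsUnit U.det) (hU' : U'.BlockTriangular id) (hd : IsUnit U'.det)
    (h : (U'ᴴ * U' - Uᴴ * U).PosSemidef) (k : Fin n) :
    Real.log ‖U k k‖ ≤ Real.log ‖U' k k‖ :=
  Real.log_le_log (norm_pos_iff.2 (diag_ne_zero_of_isUnit hU hUd k)) (diag_norm_mono hU hU' hd h k)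

/-- Feasible points of bounded energy are, up to scaling, uniformly conditioned. -/
theorem exists_normalized [Fintype κ] [Nonempty (Fin p ⊕ Fin q)] {kind : κ → Bool}
    {a : κ → Fin p → ℝ} {b : κ → Fin q → ℝ} {e : Datum p q κ}
    (ha : ∀ j, Antitone (a j)) (hb : ∀ j, Antitone (b j))
    (htr : ∑ j, (∑ i, a j i + ∑ i, b j i) = 0) (hst : Stable kind a b e)
    (hf : ∀ j, kind j = false → (∀ i, 0 ≤ a j i) ∧ ∀ i, b j i ≤ 0)
    {jt : κ} (hjt : kind jt = true) (E₀ : ℝ) :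
    ∃ B : ℝ, 0 < B ∧ ∀ P U, Feasible kind e P U → energy a b U ≤ E₀ →
      ∃ A Y N U', Feasible kind e (schurForm A Y N) U' ∧ energy a b U' = energy a b U ∧
        (A - 1).PosSemidef ∧ ((B : ℂ) • 1 - A).PosSemidef ∧
        (N - 1).PosSemidef ∧ ((B : ℂ) • 1 - N).PosSemidef := by
  have he := hst.1
  obtain ⟨B, hB, H⟩ := exists_condition_bound ha hb htr hst E₀
  refine ⟨B, hB, fun P U hPU hE => ?_⟩
  obtain ⟨A, Y, N, hA, hN, rfl⟩ := hPU.exists_posDef he hjt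
  have hfac : ∀ j, ∃ (Q : Matrix (Fin p) (Fin p) ℂ) (R : Matrix (Fin q) (Fin q) ℂ),
      (Q.BlockTriangular id ∧ IsUnit Q.det ∧
        Qᴴ * Q = (e j).toBlocks₁₁ᴴ * A * (e j).toBlocks₁₁) ∧
      (R.BlockTriangular id ∧ IsUnit R.det ∧
        Rᴴ * R = (e j).toBlocks₂₂ᴴ * N * (e j).toBlocks₂₂) ∧
      (∑ k, a j k * (2 * Real.log ‖Q k k‖) + ∑ k, b j k * (2 * Real.log ‖R k k‖)
        ≤ ∑ k, Sum.elim (a j) (b j) k * (2 * Real.log ‖U j k k‖)) ∧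
      (kind j = false →
        (N - (Y + (e j).toBlocks₁₂)ᴴ * A * (Y + (e j).toBlocks₁₂)).PosSemidef) := by
    intro j
    obtain ⟨h1, h2, h3⟩ := hPU j
    cases hk : kind j with
    | true =>
      rw [hk] at h1
      obtain ⟨Q, C, R, hU, hQ, hR, hQd, hRd, hQA, -, hRN⟩ := schur_factor_true (he j) h1 h2 h3
      refine ⟨Q, R, ⟨hQ, hQd, hQA⟩, ⟨hR, hRd, hRN⟩, ?_, by simp⟩
      rw [hU, Fintype.sum_sum_type]
      simp
    | false =>
      rw [hk] at h1
      obtain ⟨Q, C, R, hU, hQ, hR, hQd, hRd, hQA, -, hRN⟩ := schur_factor_false h1 h2 h3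
      obtain ⟨Q₀, hQ₀, hQ₀d, hQ₀A⟩ := exists_cholesky (posDef_conj hA (he j).1)
      obtain ⟨R₀, hR₀, hR₀d, hR₀N⟩ := exists_cholesky (posDef_conj hN (he j).2)
      refine ⟨Q₀, R₀, ⟨hQ₀, hQ₀d, hQ₀A⟩, ⟨hR₀, hR₀d, hR₀N⟩, ?_,
        fun _ => (posDef_of_gram (he j).2 hRd hRN).posSemidef⟩
      rw [hU, Fintype.sum_sum_type]
      refine add_le_add (Finset.sum_le_sum fun k _ => ?_) (Finset.sum_le_sum fun k _ => ?_)
      · have h5 : (Qᴴ * Q - Q₀ᴴ * Q₀).PosSemidef := by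
          rw [hQA, hQ₀A, add_sub_cancel_left]
          exact posSemidef_conjTranspose_mul_self C
        exact mul_le_mul_of_nonneg_left (mul_le_mul_of_nonneg_left
          (log_diag_mono hQ₀ hQ₀d hQ hQd h5 k) zero_le_two) ((hf j hk).1 k)
      · have h5 : (R₀ᴴ * R₀ - Rᴴ * R).PosSemidef := by
          rw [hRN, hR₀N, ← Matrix.sub_mul, ← Matrix.mul_sub, sub_sub_cancel]
          exact (hA.posSemidef.conjTranspose_mul_mul_same _).conjTranspose_mul_mul_same _
        exact mul_le_mul_of_nonpos_left (mul_le_mul_of_nonneg_left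
          (log_diag_mono hR hRd hR₀ hR₀d h5 k) zero_le_two) ((hf j hk).2 k)
  choose Q R hQ hR hQR hYN using hfac
  have h4 : ∀ i j, kind i = false → kind j = false → ((4 : ℂ) • N -
        ((e i).toBlocks₁₂ - (e j).toBlocks₁₂)ᴴ * A *
          ((e i).toBlocks₁₂ - (e j).toBlocks₁₂)).PosSemidef := by
    intro i j hi hj
    have h5 := ((((hYN i hi).add (hYN j hj)).smul (show (0 : ℂ) ≤ 2 by norm_num)).add
      (hA.posSemidef.conjTranspose_mul_mul_same
        ((Y + (e i).toBlocks₁₂) + (Y + (e j).toBlocks₁₂))))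
    convert h5 using 1
    have h6 : (e i).toBlocks₁₂ - (e j).toBlocks₁₂
        = (Y + (e i).toBlocks₁₂) - (Y + (e j).toBlocks₁₂) := by abel
    rw [h6]
    generalize Y + (e i).toBlocks₁₂ = X₁
    generalize Y + (e j).toBlocks₁₂ = X₂
    simp only [conjTranspose_add, conjTranspose_sub, Matrix.add_mul, Matrix.mul_add,
      Matrix.sub_mul, Matrix.mul_sub]
    module
  obtain ⟨c, hc, hA1, hA2, hN1, hN2⟩ := H A N Q R hA hN h4 hQ hR
    ((Finset.sum_le_sum fun j _ => hQR j).trans hE)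
  have hs : (√c)⁻¹ ≠ 0 := inv_ne_zero (Real.sqrt_ne_zero'.2 hc)
  have hF := hPU.smul hs
  have hsq : ((√c)⁻¹ ^ 2 : ℝ) = c⁻¹ := by rw [inv_pow, Real.sq_sqrt hc.le]
  rw [hsq, smul_schurForm] at hF
  have hc0 : (0 : ℂ) ≤ ((c⁻¹ : ℝ) : ℂ) := Complex.zero_le_real.2 (inv_nonneg.2 hc.le)
  have hcc : (c : ℂ) ≠ 0 := ofReal_ne_zero.2 hc.ne'
  have e1 : ∀ {n : ℕ} (M : Matrix (Fin n) (Fin n) ℂ),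
      ((c⁻¹ : ℝ) : ℂ) • M - 1 = ((c⁻¹ : ℝ) : ℂ) • (M - (c : ℂ) • 1) := by
    intro n M
    rw [smul_sub, smul_smul, ← ofReal_mul, inv_mul_cancel₀ hc.ne', ofReal_one, one_smul]
  have e2 : ∀ {n : ℕ} (M : Matrix (Fin n) (Fin n) ℂ),
      (B : ℂ) • 1 - ((c⁻¹ : ℝ) : ℂ) • M = ((c⁻¹ : ℝ) : ℂ) • (((c * B : ℝ) : ℂ) • 1 - M) := by
    intro n M
    rw [smul_sub, smul_smul, ← ofReal_mul, inv_mul_cancel_left₀ hc.ne']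
  refine ⟨_, Y, _, _, hF, energy_smul htr hPU.diag_ne_zero (by positivity), ?_, ?_, ?_, ?_⟩
  · rw [e1]; exact hA1.smul hc0
  · rw [e2]; exact hA2.smul hc0
  · rw [e1]; exact hN1.smul hc0
  · rw [e2]; exact hN2.smul hc0

end

section

variable {p q : ℕ} {κ : Type}

theorem tendsto_nonsing_inv {α n : Type*} [Fintype n] [DecidableEq n] {l : Filter α}
    {f : α → Matrix n n ℂ} {A : Matrix n n ℂ} (h : Filter.Tendsto f l (nhds A))
    (hA : IsUnit A.det) : Filter.Tendsto (fun x => (f x)⁻¹) l (nhds A⁻¹) := by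
  refine (continuousAt_matrix_inv A ?_).tendsto.comp h
  rw [Ring.inverse_eq_inv']
  exact continuousAt_inv₀ hA.ne_zero

theorem tendsto_fromBlocks {α m n m' n' : Type*} {l : Filter α} {f : α → Matrix m n ℂ}
    {g : α → Matrix m n' ℂ} {h : α → Matrix m' n ℂ} {k : α → Matrix m' n' ℂ}
    {A : Matrix m n ℂ} {B : Matrix m n' ℂ} {C : Matrix m' n ℂ} {D : Matrix m' n' ℂ}
    (hf : Filter.Tendsto f l (nhds A)) (hg : Filter.Tendsto g l (nhds B))
    (hh : Filter.Tendsto h l (nhds C)) (hk : Filter.Tendsto k l (nhds D)) :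
    Filter.Tendsto (fun x => fromBlocks (f x) (g x) (h x) (k x)) l
      (nhds (fromBlocks A B C D)) := by
  refine tendsto_pi_nhds.2 fun i => tendsto_pi_nhds.2 fun j => ?_
  rcases i with i | i <;> rcases j with j | j
  · exact tendsto_pi_nhds.1 (tendsto_pi_nhds.1 hf i) j
  · exact tendsto_pi_nhds.1 (tendsto_pi_nhds.1 hg i) j
  · exact tendsto_pi_nhds.1 (tendsto_pi_nhds.1 hh i) j
  · exact tendsto_pi_nhds.1 (tendsto_pi_nhds.1 hk i) j

theorem tendsto_entry {α m n : Type*} {l : Filter α} {f : α → Matrix m n ℂ} {A : Matrix m n ℂ}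
    (h : Filter.Tendsto f l (nhds A)) (i : m) (j : n) :
    Filter.Tendsto (fun x => f x i j) l (nhds (A i j)) :=
  tendsto_pi_nhds.1 (tendsto_pi_nhds.1 h i) j

theorem exists_tendsto_of_gram_re_le {α m n : Type*} [Fintype m] [Fintype n] (𝒰 : Ultrafilter α)
    {f : α → Matrix m n ℂ} {d : n → ℝ}
    (h : ∀ᶠ x in (𝒰 : Filter α), ∀ j, (((f x)ᴴ * f x) j j).re ≤ d j) :
    ∃ A, Filter.Tendsto f 𝒰 (nhds A) := by
  refine exists_tendsto_of_bounded 𝒰 (B := 1 + ∑ j, |d j|) ?_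
  filter_upwards [h] with x hx i j
  have h1 := (norm_sq_le_gram (f x) i j).trans (hx j)
  have h2 : d j ≤ ∑ j, |d j| := (le_abs_self _).trans
    (Finset.single_le_sum (f := fun j => |d j|) (fun _ _ => abs_nonneg _) (Finset.mem_univ j))
  nlinarith [norm_nonneg (f x i j)]

theorem exists_tendsto_of_gram_le {α m n : Type*} [Fintype m] [Fintype n] (𝒰 : Ultrafilter α)
    {f : α → Matrix m n ℂ} {D : Matrix n n ℂ} (h : ∀ x, (D - (f x)ᴴ * f x).PosSemidef) :
    ∃ A, Filter.Tendsto f 𝒰 (nhds A) := by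
  refine exists_tendsto_of_gram_re_le 𝒰 (d := fun j => (D j j).re) (.of_forall fun x j => ?_)
  have h1 : 0 ≤ (D - (f x)ᴴ * f x) j j := (h x).diag_nonneg
  have h2 := (Complex.le_def.1 h1).1
  rw [Matrix.sub_apply, sub_re, zero_re] at h2
  linarith

theorem exists_tendsto_of_gram_tendsto {α m n : Type*} [Fintype m] [Fintype n] (𝒰 : Ultrafilter α)
    {f : α → Matrix m n ℂ} {D : Matrix n n ℂ}
    (h : Filter.Tendsto (fun x => (f x)ᴴ * f x) 𝒰 (nhds D)) :
    ∃ A, Filter.Tendsto f 𝒰 (nhds A) := by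
  refine exists_tendsto_of_gram_re_le 𝒰 (d := fun j => (D j j).re + 1) ?_
  rw [Filter.eventually_all]
  intro j
  have h1 := (continuous_re.tendsto _).comp (tendsto_entry h j j)
  exact h1.eventually_le_const (lt_add_one _)

/-- Limits of normalised feasible points of bounded energy. -/
theorem exists_limit_feasible [Fintype κ] {α : Type} (𝒰 : Ultrafilter α) {kind : κ → Bool}
    {a : κ → Fin p → ℝ} {b : κ → Fin q → ℝ} {e : Datum p q κ} (he : IsFramed e)
    (hf : ∀ j, kind j = false → (∀ i, 0 ≤ a j i) ∧ ∀ i, b j i < 0)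
    {jf : κ} (hjf : kind jf = false) {A : α → Matrix (Fin p) (Fin p) ℂ}
    {Y : α → Matrix (Fin p) (Fin q) ℂ} {N : α → Matrix (Fin q) (Fin q) ℂ} {U : α → Datum p q κ}
    (hU : ∀ x, Feasible kind e (schurForm (A x) (Y x) (N x)) (U x)) {E₀ B : ℝ}
    (hE : ∀ x, energy a b (U x) ≤ E₀) (hA : ∀ x, (A x - 1).PosSemidef)
    (hA' : ∀ x, ((B : ℂ) • 1 - A x).PosSemidef) (hN : ∀ x, (N x - 1).PosSemidef)
    (hN' : ∀ x, ((B : ℂ) • 1 - N x).PosSemidef) :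
    ∃ P U', Feasible kind e P U' ∧
      Filter.Tendsto (fun x => energy a b (U x)) 𝒰 (nhds (energy a b U')) := by
  have hpd : ∀ {n : ℕ} {M : Matrix (Fin n) (Fin n) ℂ}, (M - 1).PosSemidef → M.PosDef := by
    intro n M hM
    simpa using PosDef.one.add_posSemidef hM
  have hconv : ∀ {n : ℕ} {M : α → Matrix (Fin n) (Fin n) ℂ}, (∀ x, (M x - 1).PosSemidef) →
      (∀ x, ((B : ℂ) • 1 - M x).PosSemidef) → ∃ M₀, Filter.Tendsto M 𝒰 (nhds M₀) := by
    intro n M h1 h2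
    choose L _ _ hL using fun x => exists_cholesky (hpd (h1 x))
    obtain ⟨L₀, hL₀⟩ := exists_tendsto_of_gram_le 𝒰 (f := L) (D := (B : ℂ) • 1)
      fun x => by rw [hL x]; exact h2 x
    refine ⟨L₀ᴴ * L₀, ?_⟩
    have := tendsto_mul (tendsto_conjTranspose hL₀) hL₀
    simpa only [hL] using this
  obtain ⟨A₀, hA₀⟩ := hconv hA hA'
  obtain ⟨N₀, hN₀⟩ := hconv hN hN'
  have hfac : ∀ j x, kind j = false → ∃ Q C R, U x j = fromBlocks Q 0 C R ∧
      Q.BlockTriangular id ∧ R.BlockTriangular id ∧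
      IsUnit Q.det ∧ IsUnit R.det ∧ Qᴴ * Q = (e j).toBlocks₁₁ᴴ * A x * (e j).toBlocks₁₁ + Cᴴ * C ∧
      C = -((Rᴴ)⁻¹ * ((e j).toBlocks₂₂ᴴ * (Y x + (e j).toBlocks₁₂)ᴴ * A x * (e j).toBlocks₁₁)) ∧
      Rᴴ * R = (e j).toBlocks₂₂ᴴ * (N x - (Y x + (e j).toBlocks₁₂)ᴴ * A x *
        (Y x + (e j).toBlocks₁₂)) * (e j).toBlocks₂₂ := by
    intro j x hk
    obtain ⟨h1, h2, h3⟩ := hU x j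
    rw [hk] at h1
    exact schur_factor_false h1 h2 h3
  obtain ⟨Y₀, hY₀⟩ : ∃ Y₀, Filter.Tendsto Y 𝒰 (nhds Y₀) := by
    obtain ⟨X₀, hX₀⟩ := exists_tendsto_of_gram_le 𝒰 (f := fun x => Y x + (e jf).toBlocks₁₂)
      (D := (B : ℂ) • 1) fun x => by
        obtain ⟨Q, C, R, -, -, -, -, hRd, -, -, hRR⟩ := hfac jf x hjf
        have h1 := (posDef_of_gram (he jf).2 hRd hRR).posSemidef
        have h2 := (h1.add (hN' x)).add ((hA x).conjTranspose_mul_mul_same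
          (Y x + (e jf).toBlocks₁₂))
        convert h2 using 1
        rw [Matrix.mul_sub, Matrix.sub_mul, Matrix.mul_one]
        abel
    refine ⟨X₀ - (e jf).toBlocks₁₂, ?_⟩
    have := hX₀.sub_const (e jf).toBlocks₁₂
    simpa only [add_sub_cancel_right] using this
  have hX : ∀ j, Filter.Tendsto (fun x => Y x + (e j).toBlocks₁₂) 𝒰
      (nhds (Y₀ + (e j).toBlocks₁₂)) := fun j => hY₀.add_const _
  have hg : ∀ {n m : ℕ} {M : α → Matrix (Fin n) (Fin n) ℂ} {M₀ : Matrix (Fin n) (Fin n) ℂ}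
      (g : Matrix (Fin n) (Fin m) ℂ), Filter.Tendsto M 𝒰 (nhds M₀) →
      Filter.Tendsto (fun x => gᴴ * M x * g) 𝒰 (nhds (gᴴ * M₀ * g)) := fun g h =>
    tendsto_mul (tendsto_mul tendsto_const_nhds h) tendsto_const_nhds
  have hone : ∀ {n : ℕ} {g : Matrix (Fin n) (Fin n) ℂ}, IsUnit g.det → (gᴴ * g).PosDef := by
    intro n g h
    simpa using posDef_conj PosDef.one h
  choose Q₀ hQ₀ hQ₀d hQ₀g using fun j => exists_cholesky (hone (he j).1)
  choose R₀ hR₀ hR₀d hR₀g using fun j => exists_cholesky (hone (he j).2)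
  have hge : ∀ {n : ℕ} {M g : Matrix (Fin n) (Fin n) ℂ}, (M - 1).PosSemidef →
      (gᴴ * M * g - gᴴ * g).PosSemidef := by
    intro n M g h
    have := h.conjTranspose_mul_mul_same g
    rwa [Matrix.mul_sub, Matrix.sub_mul, Matrix.mul_one] at this
  have hlim_ne : ∀ {f : α → ℂ} {z : ℂ} {c : ℝ}, 0 < c → Filter.Tendsto f 𝒰 (nhds z) →
      (∀ᶠ x in (𝒰 : Filter α), c ≤ ‖f x‖) → z ≠ 0 := by
    intro f z c hc h h' hz
    have := ge_of_tendsto h.norm h'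
    rw [hz, norm_zero] at this
    linarith
  have htrue : ∀ j, kind j = true → ∃ V, Filter.Tendsto (fun x => U x j) 𝒰 (nhds V) ∧
      ∀ k, V k k ≠ 0 := by
    intro j hk
    have hfac' : ∀ x, _ := fun x => schur_factor_true (he j) (hk ▸ (hU x j).1) (hU x j).2.1
      (hU x j).2.2
    choose Q C R h1 hQ hR hQd hRd hQQ hC hRR using hfac'
    obtain ⟨Q₁, hQ₁⟩ := exists_tendsto_of_gram_tendsto 𝒰 (f := Q) (by
      simp only [hQQ]; exact hg _ hA₀)
    obtain ⟨R₁, hR₁⟩ := exists_tendsto_of_gram_tendsto 𝒰 (f := R) (by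
      simp only [hRR]; exact hg _ hN₀)
    have hC₁ : Filter.Tendsto C 𝒰 (nhds (Q₁ * (e j).toBlocks₁₁⁻¹ * (Y₀ + (e j).toBlocks₁₂) *
        (e j).toBlocks₂₂)) := by
      rw [show C = _ from funext hC]
      exact tendsto_mul (tendsto_mul (tendsto_mul hQ₁ tendsto_const_nhds) (hX j))
        tendsto_const_nhds
    refine ⟨_, by rw [show (fun x => U x j) = _ from funext h1];
                  exact tendsto_fromBlocks hQ₁ hC₁ tendsto_const_nhds hR₁, ?_⟩
    rintro (k | k)
    · refine hlim_ne (norm_pos_iff.2 (diag_ne_zero_of_isUnit (hQ₀ j) (hQ₀d j) k))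
        (tendsto_entry hQ₁ k k) (.of_forall fun x => ?_)
      refine diag_norm_mono (hQ₀ j) (hQ x) (hQd x) ?_ k
      rw [hQQ, hQ₀g]; exact hge (hA x)
    · refine hlim_ne (norm_pos_iff.2 (diag_ne_zero_of_isUnit (hR₀ j) (hR₀d j) k))
        (tendsto_entry hR₁ k k) (.of_forall fun x => ?_)
      refine diag_norm_mono (hR₀ j) (hR x) (hRd x) ?_ k
      rw [hRR, hR₀g]; exact hge (hN x)
  have hlog : ∀ {f : α → Matrix (Fin p ⊕ Fin q) (Fin p ⊕ Fin q) ℂ}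
      {V : Matrix (Fin p ⊕ Fin q) (Fin p ⊕ Fin q) ℂ} (w : ℝ) (k), Filter.Tendsto f 𝒰 (nhds V) →
      V k k ≠ 0 → Filter.Tendsto (fun x => w * (2 * Real.log ‖f x k k‖)) 𝒰
        (nhds (w * (2 * Real.log ‖V k k‖))) := fun w k h h' =>
    (((tendsto_entry h k k).norm.log (norm_ne_zero_iff.2 h')).const_mul 2).const_mul w
  have hfalse : ∀ j, kind j = false →
      (∃ R₁, Filter.Tendsto (fun x => (U x j).toBlocks₂₂) 𝒰 (nhds R₁)) ∧
      (∀ x k, ‖Q₀ j k k‖ ≤ ‖U x j (Sum.inl k) (Sum.inl k)‖) ∧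
      ∀ δ : Fin q → ℝ, (∀ k, 0 < δ k) →
        (∀ k, ∀ᶠ x in (𝒰 : Filter α), δ k ≤ ‖U x j (Sum.inr k) (Sum.inr k)‖) →
        ∃ V, Filter.Tendsto (fun x => U x j) 𝒰 (nhds V) ∧ ∀ k, V k k ≠ 0 := by
    intro j hk
    choose Q C R h1 hQ hR hQd hRd hQQ hC hRR using fun x => hfac j x hk
    obtain ⟨R₁, hR₁⟩ := exists_tendsto_of_gram_tendsto 𝒰 (f := R) (by
      simp only [hRR]
      exact hg _ (hN₀.sub (tendsto_mul (tendsto_mul (tendsto_conjTranspose (hX j)) hA₀) (hX j))))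
    have hQle : ∀ x k, ‖Q₀ j k k‖ ≤ ‖Q x k k‖ := by
      intro x k
      refine diag_norm_mono (hQ₀ j) (hQ x) (hQd x) ?_ k
      rw [hQQ, hQ₀g, add_sub_right_comm]
      exact (hge (hA x)).add (posSemidef_conjTranspose_mul_self _)
    refine ⟨⟨R₁, by simpa only [h1, toBlocks_fromBlocks₂₂] using hR₁⟩,
      fun x k => by rw [h1]; exact hQle x k, fun δ hδ hδ' => ?_⟩
    have hR₁k : ∀ k, R₁ k k ≠ 0 := fun k => hlim_ne (hδ k) (tendsto_entry hR₁ k k) (by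
      filter_upwards [hδ' k] with x hx
      rwa [h1] at hx)
    have hR₁t : R₁.BlockTriangular id := by
      intro i k hik
      refine tendsto_nhds_unique (tendsto_entry hR₁ i k) ?_
      simp only [hR _ hik]
      exact tendsto_const_nhds
    have hR₁d : IsUnit (R₁ᴴ).det := by
      rw [det_conjTranspose]
      exact (isUnit_det_upper hR₁t hR₁k).star
    have hC₁ := (tendsto_mul (tendsto_nonsing_inv (tendsto_conjTranspose hR₁) hR₁d)
      (tendsto_mul (tendsto_mul (tendsto_mul (tendsto_const_nhds (x := (e j).toBlocks₂₂ᴴ))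
        (tendsto_conjTranspose (hX j))) hA₀)
        (tendsto_const_nhds (x := (e j).toBlocks₁₁)))).neg
    simp only [← hC] at hC₁
    obtain ⟨Q₁, hQ₁⟩ := exists_tendsto_of_gram_tendsto 𝒰 (f := Q) (by
      simp only [hQQ]
      exact (hg _ hA₀).add (tendsto_mul (tendsto_conjTranspose hC₁) hC₁))
    refine ⟨_, by rw [show (fun x => U x j) = _ from funext h1];
                  exact tendsto_fromBlocks hQ₁ tendsto_const_nhds hC₁ hR₁, ?_⟩
    rintro (k | k)
    · exact hlim_ne (norm_pos_iff.2 (diag_ne_zero_of_isUnit (hQ₀ j) (hQ₀d j) k))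
        (tendsto_entry hQ₁ k k) (.of_forall fun x => hQle x k)
    · exact hR₁k k
  have hpos : ∀ x j k, 0 < ‖U x j k k‖ := fun x j k => norm_pos_iff.2 ((hU x).diag_ne_zero j k)
  have hlow : ∀ z : κ × (Fin p ⊕ Fin q), ∃ K : ℝ, ∀ᶠ x in (𝒰 : Filter α),
      K ≤ Sum.elim (a z.1) (b z.1) z.2 * (2 * Real.log ‖U x z.1 z.2 z.2‖) := by
    rintro ⟨j, k⟩
    cases hk : kind j with
    | true =>
      obtain ⟨V, hV, hV'⟩ := htrue j hk
      exact ⟨_, (hlog _ k hV (hV' k)).eventually_const_le (sub_one_lt _)⟩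
    | false =>
      obtain ⟨⟨R₁, hR₁⟩, h2, -⟩ := hfalse j hk
      rcases k with k | k
      · refine ⟨a j k * (2 * Real.log ‖Q₀ j k k‖), .of_forall fun x => ?_⟩
        exact mul_le_mul_of_nonneg_left (mul_le_mul_of_nonneg_left (Real.log_le_log
          (norm_pos_iff.2 (diag_ne_zero_of_isUnit (hQ₀ j) (hQ₀d j) k)) (h2 x k)) zero_le_two)
          ((hf j hk).1 k)
      · refine ⟨b j k * (2 * Real.log (‖R₁ k k‖ + 1)), ?_⟩
        filter_upwards [(tendsto_entry hR₁ k k).norm.eventually_le_const (lt_add_one _)] with x hx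
        exact mul_le_mul_of_nonpos_left (mul_le_mul_of_nonneg_left (Real.log_le_log
          (hpos x j _) hx) zero_le_two) ((hf j hk).2 k).le
  choose K hK using hlow
  have hup : ∀ z : κ × (Fin p ⊕ Fin q), ∀ᶠ x in (𝒰 : Filter α),
      Sum.elim (a z.1) (b z.1) z.2 * (2 * Real.log ‖U x z.1 z.2 z.2‖) ≤
        E₀ - ∑ z, K z + K z := by
    intro z
    classical
    filter_upwards [Filter.eventually_all.2 hK] with x hx
    have h1 : ∑ z : κ × (Fin p ⊕ Fin q),
        (Sum.elim (a z.1) (b z.1) z.2 * (2 * Real.log ‖U x z.1 z.2 z.2‖) - K z) ≤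
          E₀ - ∑ z, K z := by
      rw [Finset.sum_sub_distrib, Fintype.sum_prod_type]
      exact sub_le_sub_right (hE x) _
    have h2 := Finset.single_le_sum (f := fun z : κ × (Fin p ⊕ Fin q) =>
      Sum.elim (a z.1) (b z.1) z.2 * (2 * Real.log ‖U x z.1 z.2 z.2‖) - K z)
      (fun z _ => sub_nonneg.2 (hx z)) (Finset.mem_univ z)
    beta_reduce at h2
    linarith
  have hall : ∀ j, ∃ V, Filter.Tendsto (fun x => U x j) 𝒰 (nhds V) ∧ ∀ k, V k k ≠ 0 := by
    intro j
    cases hk : kind j with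
    | true => exact htrue j hk
    | false =>
      refine (hfalse j hk).2.2
        (fun k => Real.exp ((E₀ - ∑ z, K z + K (j, Sum.inr k)) / (b j k * 2)))
        (fun k => Real.exp_pos _) fun k => ?_
      filter_upwards [hup (j, Sum.inr k)] with x hx
      have hb2 : b j k * 2 < 0 := by linarith [(hf j hk).2 k]
      rw [← Real.le_log_iff_exp_le (hpos x j _), div_le_iff_of_neg hb2]
      refine le_trans (le_of_eq ?_) hx
      change _ = b j k * _
      ring
  choose V hV hV' using hall
  refine ⟨schurForm A₀ Y₀ N₀, V, fun j => ⟨?_, ?_, ?_⟩, ?_⟩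
  · intro i k hik
    refine tendsto_nhds_unique (tendsto_entry (hV j) i k) ?_
    have : ∀ x, U x j i k = 0 := fun x => (hU x j).1 hik
    simp only [this]
    exact tendsto_const_nhds
  · have hVt : (V j).BlockTriangular (pos (kind j)) := by
      intro i k hik
      refine tendsto_nhds_unique (tendsto_entry (hV j) i k) ?_
      have : ∀ x, U x j i k = 0 := fun x => (hU x j).1 hik
      simp only [this]
      exact tendsto_const_nhds
    rw [det_of_blockTriangular_injective (pos_injective _) hVt, isUnit_iff_ne_zero,
      Finset.prod_ne_zero_iff]
    exact fun k _ => hV' j k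
  · refine tendsto_nhds_unique
      (tendsto_mul (tendsto_mul (tendsto_conjTranspose (hV j)) tendsto_const_nhds) (hV j)) ?_
    simp only [(hU _ j).2.2]
    refine tendsto_mul (tendsto_mul tendsto_const_nhds ?_) tendsto_const_nhds
    exact tendsto_fromBlocks hA₀ (tendsto_mul hA₀ hY₀) (tendsto_mul (tendsto_conjTranspose hY₀) hA₀)
      ((tendsto_mul (tendsto_mul (tendsto_conjTranspose hY₀) hA₀) hY₀).sub hN₀)
  · exact tendsto_finsetSum _ fun j _ => tendsto_finsetSum _ fun k _ =>
      hlog _ k (hV j) (hV' j k)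

end

section

variable {p q : ℕ} {κ : Type} [Fintype κ]

theorem exists_feasible {kind : κ → Bool} {e : Datum p q κ} (he : IsFramed e) :
    ∃ P U, Feasible kind e P U := by
  choose c hc0 hc _ using fun j => exists_bound_hermitian
    (isHermitian_conjTranspose_mul_self (e j).toBlocks₁₂)
  have hG : ∀ j, (((∑ j, c j + 1 : ℝ) : ℂ) • 1 - (e j).toBlocks₁₂ᴴ * (e j).toBlocks₁₂).PosDef := by
    intro j
    have h1 : c j ≤ ∑ j, c j :=
      Finset.single_le_sum (f := c) (fun j _ => hc0 j) (Finset.mem_univ j)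
    have h2 := (PosDef.one (n := Fin q) (R := ℂ)).smul
      (Complex.zero_lt_real.2 (by linarith : 0 < ∑ j, c j + 1 - c j))
    have h3 := h2.add_posSemidef (hc j)
    convert h3 using 1
    rw [add_sub_assoc', ← add_smul, ← ofReal_add, sub_add_cancel]
  have hfac : ∀ j, ∃ V : Matrix (Fin p ⊕ Fin q) (Fin p ⊕ Fin q) ℂ,
      V.BlockTriangular (pos (kind j)) ∧ IsUnit V.det ∧ Vᴴ * sgn p q * V =
        (frameMat (e j))ᴴ * schurForm 1 0 (((∑ j, c j + 1 : ℝ) : ℂ) • 1) * frameMat (e j) := by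
    intro j
    rw [frameMat_schurForm]
    obtain ⟨V, h1, h2, h3⟩ := exists_sgn_factor (kind j)
      (B := (e j).toBlocks₁₁ᴴ * (e j).toBlocks₁₂ * (e j).toBlocks₂₂)
      (posDef_conj PosDef.one (he j).1) (posDef_conj (hG j) (he j).2)
    refine ⟨V, h1, h2, h3.trans ?_⟩
    congr 1
    · simp
    · simp [Matrix.mul_assoc]
    · rw [zero_add, Matrix.mul_one, ← Matrix.neg_mul, ← Matrix.mul_neg, neg_sub]
  choose V hV using hfac
  exact ⟨_, V, hV⟩

theorem exists_minimizer [Nonempty (Fin p ⊕ Fin q)] {kind : κ → Bool}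
    {a : κ → Fin p → ℝ} {b : κ → Fin q → ℝ} {e : Datum p q κ}
    (ha : ∀ j, Antitone (a j)) (hb : ∀ j, Antitone (b j))
    (htr : ∑ j, (∑ i, a j i + ∑ i, b j i) = 0) (hst : Stable kind a b e)
    (hf : ∀ j, kind j = false → (∀ i, 0 ≤ a j i) ∧ ∀ i, b j i < 0)
    {jt jf : κ} (hjt : kind jt = true) (hjf : kind jf = false) :
    ∃ P U, Feasible kind e P U ∧ ∀ P' U', Feasible kind e P' U' → energy a b U ≤ energy a b U' := by
  set S : Set EReal := {s | ∃ P U, Feasible kind e P U ∧ s = (energy a b U : EReal)} with hS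
  obtain ⟨P₀, U₀, h₀⟩ := exists_feasible (kind := kind) hst.1
  obtain ⟨u, hu, hut, huS⟩ := exists_seq_tendsto_sInf (S := S)
    ⟨_, P₀, U₀, h₀, rfl⟩ (OrderBot.bddBelow _)
  choose P U hPU hEu using huS
  obtain ⟨B, hB, H⟩ := exists_normalized ha hb htr hst
    (fun j hj => ⟨(hf j hj).1, fun i => ((hf j hj).2 i).le⟩) hjt (energy a b (U 0))
  have hE : ∀ m, energy a b (U m) ≤ energy a b (U 0) := fun m => by
    rw [← EReal.coe_le_coe_iff, ← hEu, ← hEu]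
    exact hu (Nat.zero_le m)
  choose A Y N V hV hVE hA hA' hN hN' using fun m => H (P m) (U m) (hPU m) (hE m)
  obtain ⟨P₁, U₁, hF, hlim⟩ := exists_limit_feasible (Filter.hyperfilter ℕ) hst.1 hf hjf hV
    (fun m => (hVE m).trans_le (hE m)) hA hA' hN hN'
  refine ⟨P₁, U₁, hF, fun P' U' h' => ?_⟩
  have h1 : Filter.Tendsto u (Filter.hyperfilter ℕ) (nhds (energy a b U₁ : EReal)) := by
    have := (continuous_coe_real_ereal.tendsto _).comp hlim
    refine this.congr fun m => ?_
    rw [Function.comp_apply, hVE, hEu]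
  have h2 := tendsto_nhds_unique h1 (hut.mono_left Nat.hyperfilter_le_atTop)
  rw [← EReal.coe_le_coe_iff, h2]
  exact sInf_le ⟨P', U', h', rfl⟩

theorem exists_solution_of_stable [Nonempty (Fin p ⊕ Fin q)] {kind : κ → Bool}
    {a : κ → Fin p → ℝ} {b : κ → Fin q → ℝ} {e : Datum p q κ}
    (ha : ∀ j, Antitone (a j)) (hb : ∀ j, Antitone (b j))
    (htr : ∑ j, (∑ i, a j i + ∑ i, b j i) = 0) (hst : Stable kind a b e)
    (hf : ∀ j, kind j = false → (∀ i, 0 ≤ a j i) ∧ ∀ i, b j i < 0)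
    {jt jf : κ} (hjt : kind jt = true) (hjf : kind jf = false) :
    ∃ k : Datum p q κ, (∀ j, (k j)ᴴ * sgn p q * k j = sgn p q) ∧ k jt = 1 ∧
      ∑ j, k j * wt (a j) (b j) * (k j)ᴴ = 0 := by
  obtain ⟨P, U, hU, hmin⟩ := exists_minimizer ha hb htr hst hf hjt hjf
  obtain ⟨C, hC, hCP, hsum⟩ := exists_solution_of_minimizer hst.1 hU hmin
  have hP : ((C jt)⁻¹)ᴴ * sgn p q * (C jt)⁻¹ = P := by
    rw [← hCP jt, conjTranspose_nonsing_inv]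
    have h1 : ((C jt)ᴴ)⁻¹ * (C jt)ᴴ = 1 :=
      nonsing_inv_mul _ (by rw [det_conjTranspose]; exact (hC jt).star)
    calc _ = (((C jt)ᴴ)⁻¹ * (C jt)ᴴ) * P * (C jt * (C jt)⁻¹) := by simp only [Matrix.mul_assoc]
      _ = P := by rw [h1, mul_nonsing_inv _ (hC jt), Matrix.one_mul, Matrix.mul_one]
  refine ⟨fun j => (C jt)⁻¹ * C j, fun j => ?_, nonsing_inv_mul _ (hC jt), ?_⟩
  · calc ((C jt)⁻¹ * C j)ᴴ * sgn p q * ((C jt)⁻¹ * C j)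
        = (C j)ᴴ * (((C jt)⁻¹)ᴴ * sgn p q * (C jt)⁻¹) * C j := by
          rw [conjTranspose_mul]; simp only [Matrix.mul_assoc]
      _ = _ := by rw [hP, hCP]
  · calc ∑ j, (C jt)⁻¹ * C j * wt (a j) (b j) * ((C jt)⁻¹ * C j)ᴴ
        = (C jt)⁻¹ * (∑ j, C j * wt (a j) (b j) * (C j)ᴴ) * ((C jt)⁻¹)ᴴ := by
          rw [Matrix.mul_sum, Matrix.sum_mul]
          refine Finset.sum_congr rfl fun j _ => ?_
          rw [conjTranspose_mul]; simp only [Matrix.mul_assoc]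
      _ = 0 := by rw [hsum, Matrix.mul_zero, Matrix.zero_mul]

end

section

/-! ### The Horn cone in block form -/

variable {p q : ℕ}

/-- The first block of coordinates. -/
def fstBlock (x : Fin (p + q) → ℝ) (i : Fin p) : ℝ := x (Fin.castAdd q i)

/-- The second block of coordinates. -/
def sndBlock (x : Fin (p + q) → ℝ) (i : Fin q) : ℝ := x (Fin.natAdd p i)

/-- Passage to block matrices. -/
noncomputable def toSum (p q : ℕ) : Matrix (Fin (p + q)) (Fin (p + q)) ℂ ≃ₐ[ℂ]
    Matrix (Fin p ⊕ Fin q) (Fin p ⊕ Fin q) ℂ :=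
  Matrix.reindexAlgEquiv ℂ ℂ finSumFinEquiv.symm

theorem toSum_conjTranspose (M : Matrix (Fin (p + q)) (Fin (p + q)) ℂ) :
    toSum p q Mᴴ = (toSum p q M)ᴴ := by
  simp [toSum]

theorem toSum_Ipq : toSum p q (Ipq p q) = sgn p q := by
  ext (i | i) (j | j) <;> simp [toSum, Ipq, sgn, diagonal_apply, one_apply, Fin.ext_iff] <;>
    first | omega | grind

theorem toSum_dmat (x : Fin (p + q) → ℝ) :
    toSum p q (dmat x) = (I : ℂ) • (wt (fstBlock x) (sndBlock x) * sgn p q) := by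
  rw [wt, sgn, fromBlocks_multiply]
  ext (i | i) (j | j) <;> simp [toSum, dmat, diagonal_apply, fstBlock, sndBlock, Fin.ext_iff] <;>
    omega

theorem pseudo_iff {k : Matrix (Fin p ⊕ Fin q) (Fin p ⊕ Fin q) ℂ} :
    k * sgn p q * kᴴ = sgn p q ↔ kᴴ * sgn p q * k = sgn p q := by
  refine ⟨fun h => ?_, pseudo_mul⟩
  have := pseudo_mul (k := kᴴ) (by rwa [conjTranspose_conjTranspose])
  rwa [conjTranspose_conjTranspose] at this

theorem pseudo_mul_inv {k : Matrix (Fin p ⊕ Fin q) (Fin p ⊕ Fin q) ℂ}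
    (h : k * sgn p q * kᴴ = sgn p q) : k * (sgn p q * kᴴ * sgn p q) = 1 := by
  rw [← Matrix.mul_assoc, ← Matrix.mul_assoc, h, sgn_mul_sgn]

theorem mem_Upq_iff {g : Matrix (Fin (p + q)) (Fin (p + q)) ℂ} :
    g ∈ Upq p q ↔ (toSum p q g)ᴴ * sgn p q * toSum p q g = sgn p q := by
  rw [← pseudo_iff]
  constructor
  · rintro ⟨-, h⟩
    have := congrArg (toSum p q) h
    rwa [map_mul, map_mul, toSum_conjTranspose, toSum_Ipq] at this
  · intro h
    refine ⟨?_, (toSum p q).injective ?_⟩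
    · have h1 : IsUnit (toSum p q g) := IsUnit.of_mul_eq_one _ (pseudo_mul_inv h)
      simpa using h1.map (toSum p q).symm
    · rwa [map_mul, map_mul, toSum_conjTranspose, toSum_Ipq]

theorem mem_Orbit_iff {x : Fin (p + q) → ℝ} {Y : Matrix (Fin (p + q)) (Fin (p + q)) ℂ} :
    Y ∈ Orbit p q x ↔ ∃ k : Matrix (Fin p ⊕ Fin q) (Fin p ⊕ Fin q) ℂ,
      kᴴ * sgn p q * k = sgn p q ∧
      toSum p q Y = (I : ℂ) • (k * wt (fstBlock x) (sndBlock x) * kᴴ * sgn p q) := by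
  have key : ∀ g ∈ Upq p q, toSum p q (g * dmat x * g⁻¹) = (I : ℂ) • (toSum p q g *
      wt (fstBlock x) (sndBlock x) * (toSum p q g)ᴴ * sgn p q) := by
    intro g hg
    have h1 := pseudo_iff.2 (mem_Upq_iff.1 hg)
    have h2 : toSum p q g⁻¹ = sgn p q * (toSum p q g)ᴴ * sgn p q := by
      have h3 : toSum p q g⁻¹ * toSum p q g = 1 := by
        rw [← map_mul, nonsing_inv_mul _ ((Matrix.isUnit_iff_isUnit_det _).1 hg.1), map_one]
      exact left_inv_eq_right_inv h3 (pseudo_mul_inv h1)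
    rw [map_mul, map_mul, h2, toSum_dmat]
    simp only [Matrix.mul_smul, Matrix.smul_mul, Matrix.mul_assoc]
    congr 3
    rw [← Matrix.mul_assoc (sgn p q) (sgn p q), sgn_mul_sgn, Matrix.one_mul]
  constructor
  · rintro ⟨g, hg, rfl⟩
    exact ⟨toSum p q g, mem_Upq_iff.1 hg, key g hg⟩
  · rintro ⟨k, hk, hY⟩
    have hg : (toSum p q).symm k ∈ Upq p q := by
      rw [mem_Upq_iff, AlgEquiv.apply_symm_apply]; exact hk
    refine ⟨_, hg, (toSum p q).injective ?_⟩
    rw [key _ hg, AlgEquiv.apply_symm_apply, hY]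

theorem pseudo_comp {k l : Matrix (Fin p ⊕ Fin q) (Fin p ⊕ Fin q) ℂ}
    (hk : kᴴ * sgn p q * k = sgn p q) (hl : lᴴ * sgn p q * l = sgn p q) :
    (k * l)ᴴ * sgn p q * (k * l) = sgn p q := by
  calc (k * l)ᴴ * sgn p q * (k * l) = lᴴ * (kᴴ * sgn p q * k) * l := by
        rw [conjTranspose_mul]; simp only [Matrix.mul_assoc]
    _ = _ := by rw [hk, hl]

theorem mem_HornHolS_iff {s : ℕ} {x : Fin (s + 1) → Fin (p + q) → ℝ} :
    x ∈ HornHolS p q s ↔ (∀ j, x j ∈ Chol p q) ∧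
      ∃ k : Fin s → Matrix (Fin p ⊕ Fin q) (Fin p ⊕ Fin q) ℂ,
        (∀ j, (k j)ᴴ * sgn p q * k j = sgn p q) ∧
        ∑ j : Fin s, k j * wt (fstBlock (x j.castSucc)) (sndBlock (x j.castSucc)) * (k j)ᴴ
          = wt (fstBlock (x (Fin.last s))) (sndBlock (x (Fin.last s))) := by
  refine and_congr_right fun _ => ⟨fun h => ?_, ?_⟩
  · have h1 : dmat (x (Fin.last s)) ∈ Orbit p q (x (Fin.last s)) := by
      refine mem_Orbit_iff.2 ⟨1, by simp, ?_⟩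
      rw [toSum_dmat, conjTranspose_one, Matrix.mul_one, Matrix.one_mul]
    obtain ⟨Y, hY, hsum⟩ := (Set.mem_fintype_sum _ _).1 (h h1)
    choose k hk hkY using fun j => mem_Orbit_iff.1 (hY j)
    refine ⟨k, hk, ?_⟩
    have h2 := congrArg (toSum p q) hsum
    rw [map_sum, toSum_dmat] at h2
    simp only [hkY, ← Finset.smul_sum, ← Finset.sum_mul] at h2
    have h3 := congrArg (· * sgn p q) (smul_right_injective _ I_ne_zero h2)
    simpa only [Matrix.mul_assoc, sgn_mul_sgn, Matrix.mul_one] using h3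
  · rintro ⟨k, hk, hsum⟩ Y hY
    obtain ⟨g, hg, hgY⟩ := mem_Orbit_iff.1 hY
    refine (Set.mem_fintype_sum _ _).2 ⟨fun j => (toSum p q).symm ((I : ℂ) • ((g * k j) *
      wt (fstBlock (x j.castSucc)) (sndBlock (x j.castSucc)) * (g * k j)ᴴ * sgn p q)),
      fun j => mem_Orbit_iff.2 ⟨g * k j, pseudo_comp hg (hk j), by
        rw [AlgEquiv.apply_symm_apply]⟩, (toSum p q).injective ?_⟩
    rw [map_sum, hgY, ← hsum, Matrix.mul_sum, Matrix.sum_mul, Matrix.sum_mul, Finset.smul_sum]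
    refine Finset.sum_congr rfl fun j _ => ?_
    rw [AlgEquiv.apply_symm_apply, conjTranspose_mul]
    simp only [Matrix.mul_assoc]

theorem mem_Chol_iff {x : Fin (p + q) → ℝ} : x ∈ Chol p q ↔
    Antitone (fstBlock x) ∧ Antitone (sndBlock x) ∧ ∀ i j, sndBlock x j < fstBlock x i := by
  constructor
  · rintro ⟨h1, h2⟩
    exact ⟨fun i j hij => h1 _ _ hij (Or.inl j.2),
      fun i j hij => h1 _ _ (Nat.add_le_add_left hij p) (Or.inr (Nat.le_add_right p i)),
      fun i j => h2 _ _ i.2 (Nat.le_add_right p j)⟩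
  · rintro ⟨h1, h2, h3⟩
    refine ⟨fun i j => ?_, fun i j => ?_⟩
    · refine Fin.addCases (fun i => ?_) (fun i => ?_) i <;>
      refine Fin.addCases (fun j => ?_) (fun j => ?_) j <;> intro hij hp
      · exact h1 (Fin.mk_le_mk.2 hij : i ≤ j)
      · simp at hp; omega
      · simp at hij; omega
      · exact h2 (Fin.mk_le_mk.2 (by simpa using hij) : i ≤ j)
    · refine Fin.addCases (fun i => ?_) (fun i => ?_) i <;>
      refine Fin.addCases (fun j => ?_) (fun j => ?_) j <;> intro hi hj
      · simp at hj; omega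
      · exact h3 i j
      · simp at hi
      · simp at hi

end

section

variable {p q : ℕ}

theorem smul_mem_Chol {x : Fin (p + q) → ℝ} (hx : x ∈ Chol p q) {t : ℝ} (ht : 0 < t) :
    t • x ∈ Chol p q :=
  ⟨fun i j h h' => mul_le_mul_of_nonneg_left (hx.1 i j h h') ht.le,
    fun i j h h' => mul_lt_mul_of_pos_left (hx.2 i j h h') ht⟩

theorem add_mem_Chol {x y : Fin (p + q) → ℝ} (hx : x ∈ Chol p q) (hy : y ∈ Chol p q) :
    x + y ∈ Chol p q :=
  ⟨fun i j h h' => add_le_add (hx.1 i j h h') (hy.1 i j h h'),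
    fun i j h h' => add_lt_add (hx.2 i j h h') (hy.2 i j h h')⟩

theorem wt_smul (t : ℝ) (a : Fin p → ℝ) (b : Fin q → ℝ) :
    wt (t • a) (t • b) = (t : ℂ) • wt a b := by
  ext (i | i) (j | j) <;> simp [wt, diagonal_apply]

theorem smul_mem_HornHolS {s : ℕ} {t : ℝ} (ht : 0 < t) {x : Fin (s + 1) → Fin (p + q) → ℝ}
    (hx : x ∈ HornHolS p q s) : t • x ∈ HornHolS p q s := by
  obtain ⟨hc, k, hk, hsum⟩ := mem_HornHolS_iff.1 hx
  refine mem_HornHolS_iff.2 ⟨fun j => smul_mem_Chol (hc j) ht, k, hk, ?_⟩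
  have h1 : ∀ j, wt (fstBlock ((t • x) j)) (sndBlock ((t • x) j))
      = (t : ℂ) • wt (fstBlock (x j)) (sndBlock (x j)) := fun j => wt_smul t _ _
  simp only [h1, Matrix.mul_smul, Matrix.smul_mul, ← Finset.smul_sum, hsum]

theorem exists_gap [Nonempty (Fin p)] [Nonempty (Fin q)] {x : Fin (p + q) → ℝ}
    (hx : x ∈ Chol p q) : ∃ c δ : ℝ, 0 < δ ∧ (∀ i, c + δ < fstBlock x i) ∧
      ∀ i, sndBlock x i < c - δ := by
  obtain ⟨i₀, hi₀⟩ := Finite.exists_min (fstBlock x)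
  obtain ⟨j₀, hj₀⟩ := Finite.exists_max (sndBlock x)
  have h := (mem_Chol_iff.1 hx).2.2 i₀ j₀
  refine ⟨(fstBlock x i₀ + sndBlock x j₀) / 2, (fstBlock x i₀ - sndBlock x j₀) / 4, by linarith,
    fun i => ?_, fun i => ?_⟩
  · linarith [hi₀ i]
  · linarith [hj₀ i]

theorem wt_sub_smul_sgn (a : Fin p → ℝ) (b : Fin q → ℝ) (c : ℝ) :
    wt a b - (c : ℂ) • sgn p q
      = diagonal fun k => (Sum.elim (fun i => a i - c) (fun i => c - b i) k : ℂ) := by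
  ext (i | i) (j | j)
  · by_cases h : i = j <;> simp [wt, sgn, h]
  · simp [wt, sgn]
  · simp [wt, sgn]
  · by_cases h : i = j <;> simp [wt, sgn, h]
    ring

theorem smul_gram_re_le {ι : Type*} [Fintype ι] [DecidableEq ι] (k : Matrix ι ι ℂ) {d : ι → ℝ}
    {δ : ℝ} (hd : ∀ i, δ ≤ d i) (i : ι) :
    δ * ((k * kᴴ) i i).re ≤ ((k * diagonal (fun i => (d i : ℂ)) * kᴴ) i i).re := by
  have h1 : (diagonal (fun i => ((d i - δ : ℝ) : ℂ))).PosSemidef :=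
    PosSemidef.diagonal fun i => Complex.zero_le_real.2 (sub_nonneg.2 (hd i))
  have h2 := (h1.mul_mul_conjTranspose_same k).diag_nonneg (i := i)
  have h3 : diagonal (fun i => ((d i - δ : ℝ) : ℂ)) = diagonal (fun i => (d i : ℂ))
      - (δ : ℂ) • (1 : Matrix ι ι ℂ) := by
    ext i j
    by_cases h : i = j <;> simp [h]
  rw [h3, Matrix.mul_sub, Matrix.sub_mul, Matrix.mul_smul, Matrix.mul_one, Matrix.smul_mul,
    Matrix.sub_apply, Matrix.smul_apply, smul_eq_mul] at h2
  have h4 := (Complex.le_def.1 h2).1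
  rw [sub_re, re_ofReal_mul, zero_re] at h4
  linarith

theorem tendsto_wt {α : Type*} {l : Filter α} {y : α → Fin (p + q) → ℝ} {x : Fin (p + q) → ℝ}
    (h : Filter.Tendsto y l (nhds x)) :
    Filter.Tendsto (fun m => wt (fstBlock (y m)) (sndBlock (y m))) l
      (nhds (wt (fstBlock x) (sndBlock x))) := by
  have hc : Continuous fun x : Fin (p + q) → ℝ => wt (fstBlock x) (sndBlock x) := by
    unfold wt fstBlock sndBlock
    fun_prop
  exact (hc.tendsto x).comp h

/-- Limits of points of the Horn cone inside the chamber belong to the Horn cone. -/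
theorem mem_HornHolS_of_tendsto [Nonempty (Fin p)] [Nonempty (Fin q)] {s : ℕ} {α : Type*}
    (𝒰 : Ultrafilter α) {y : α → Fin (s + 1) → Fin (p + q) → ℝ}
    {x : Fin (s + 1) → Fin (p + q) → ℝ} (hy : ∀ᶠ m in (𝒰 : Filter α), y m ∈ HornHolS p q s)
    (hlim : Filter.Tendsto y 𝒰 (nhds x)) (hx : ∀ j, x j ∈ Chol p q) : x ∈ HornHolS p q s := by
  have hlj : ∀ j, Filter.Tendsto (fun m => y m j) 𝒰 (nhds (x j)) := tendsto_pi_nhds.1 hlim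
  have hli : ∀ j i, Filter.Tendsto (fun m => y m j i) 𝒰 (nhds (x j i)) :=
    fun j => tendsto_pi_nhds.1 (hlj j)
  choose c δ hδ hc1 hc2 using fun j => exists_gap (hx j)
  have hk : ∀ m, ∃ k : Fin s → Matrix (Fin p ⊕ Fin q) (Fin p ⊕ Fin q) ℂ,
      y m ∈ HornHolS p q s → (∀ j, (k j)ᴴ * sgn p q * k j = sgn p q) ∧
        ∑ j : Fin s, k j * wt (fstBlock (y m j.castSucc)) (sndBlock (y m j.castSucc)) * (k j)ᴴ
          = wt (fstBlock (y m (Fin.last s))) (sndBlock (y m (Fin.last s))) := by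
    intro m
    by_cases h : y m ∈ HornHolS p q s
    · obtain ⟨-, k, hk⟩ := mem_HornHolS_iff.1 h
      exact ⟨k, fun _ => hk⟩
    · exact ⟨1, fun h' => absurd h' h⟩
  choose k hk using hk
  have hgap : ∀ᶠ m in (𝒰 : Filter α), ∀ (j : Fin s) (l : Fin p ⊕ Fin q),
      δ j.castSucc ≤ Sum.elim (fun i => fstBlock (y m j.castSucc) i - c j.castSucc)
        (fun i => c j.castSucc - sndBlock (y m j.castSucc) i) l := by
    rw [Filter.eventually_all]; intro j
    rw [Filter.eventually_all]; rintro (i | i)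
    · have := (hli j.castSucc (Fin.castAdd q i)).eventually_const_le (hc1 j.castSucc i)
      filter_upwards [this] with m hm
      exact le_sub_iff_add_le'.2 hm
    · have := (hli j.castSucc (Fin.natAdd p i)).eventually_le_const (hc2 j.castSucc i)
      filter_upwards [this] with m hm
      exact le_sub_comm.1 hm
  have hDlim := (tendsto_wt (hlj (Fin.last s))).sub_const (((∑ j : Fin s, c j.castSucc : ℝ) : ℂ) •
    sgn p q)
  have hDb : ∀ᶠ m in (𝒰 : Filter α), ∀ l,
      ((wt (fstBlock (y m (Fin.last s))) (sndBlock (y m (Fin.last s))) -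
        ((∑ j : Fin s, c j.castSucc : ℝ) : ℂ) • sgn p q) l l).re ≤
      ((wt (fstBlock (x (Fin.last s))) (sndBlock (x (Fin.last s))) -
        ((∑ j : Fin s, c j.castSucc : ℝ) : ℂ) • sgn p q) l l).re + 1 := by
    rw [Filter.eventually_all]
    intro l
    have h1 := (continuous_re.tendsto _).comp (tendsto_entry hDlim l l)
    exact h1.eventually_le_const (lt_add_one _)
  have hkl : ∀ j, ∃ K, Filter.Tendsto (fun m => (k m j)ᴴ) 𝒰 (nhds K) := by
    intro j
    refine exists_tendsto_of_gram_re_le 𝒰 (d := fun l => (δ j.castSucc)⁻¹ *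
      (((wt (fstBlock (x (Fin.last s))) (sndBlock (x (Fin.last s))) -
        ((∑ j : Fin s, c j.castSucc : ℝ) : ℂ) • sgn p q) l l).re + 1)) ?_
    filter_upwards [hy, hgap, hDb] with m hm hg hD l
    obtain ⟨h1, h2⟩ := hk m hm
    have h3 : ∑ j : Fin s, k m j * (wt (fstBlock (y m j.castSucc)) (sndBlock (y m j.castSucc))
        - (c j.castSucc : ℂ) • sgn p q) * (k m j)ᴴ =
        wt (fstBlock (y m (Fin.last s))) (sndBlock (y m (Fin.last s))) -
        ((∑ j : Fin s, c j.castSucc : ℝ) : ℂ) • sgn p q := by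
      rw [← h2, ofReal_sum, Finset.sum_smul, ← Finset.sum_sub_distrib]
      refine Finset.sum_congr rfl fun j _ => ?_
      rw [Matrix.mul_sub, Matrix.sub_mul, Matrix.mul_smul, Matrix.smul_mul,
        pseudo_iff.2 (h1 j)]
    have h4 := congrArg (fun M => (M l l).re) h3
    beta_reduce at h4
    rw [Matrix.sum_apply, re_sum] at h4
    have h5 : ∀ j : Fin s, δ j.castSucc * ((k m j * (k m j)ᴴ) l l).re ≤ ((k m j *
        (wt (fstBlock (y m j.castSucc)) (sndBlock (y m j.castSucc))
        - (c j.castSucc : ℂ) • sgn p q) * (k m j)ᴴ) l l).re := by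
      intro j
      have := smul_gram_re_le (k m j) (hg j) l
      rw [wt_sub_smul_sgn]
      convert this using 6
      rename_i l
      rcases l with l | l <;> simp
    have h6 : ∀ j, 0 ≤ ((k m j * (k m j)ᴴ) l l).re := fun j =>
      (Complex.le_def.1 (posSemidef_self_mul_conjTranspose (k m j)).diag_nonneg).1
    have h7 := (h5 j).trans ((Finset.single_le_sum (fun j _ =>
      (mul_nonneg (hδ j.castSucc).le (h6 j)).trans (h5 j)) (Finset.mem_univ j)).trans
        (h4.le.trans (hD l)))
    rw [conjTranspose_conjTranspose]
    exact (le_inv_mul_iff₀ (hδ _)).2 h7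
  choose K hK using hkl
  have hK' : ∀ j, Filter.Tendsto (fun m => k m j) 𝒰 (nhds (K j)ᴴ) := fun j => by
    simpa only [conjTranspose_conjTranspose] using tendsto_conjTranspose (hK j)
  refine mem_HornHolS_iff.2 ⟨hx, fun j => (K j)ᴴ, fun j => ?_, ?_⟩
  · refine tendsto_nhds_unique_of_eventuallyEq (tendsto_mul (tendsto_mul (tendsto_conjTranspose
      (hK' j)) tendsto_const_nhds) (hK' j)) (tendsto_const_nhds (x := sgn p q)) ?_
    filter_upwards [hy] with m hm
    exact (hk m hm).1 j
  · refine tendsto_nhds_unique_of_eventuallyEq (tendsto_finsetSum _ fun j _ =>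
      tendsto_mul (tendsto_mul (hK' j) (tendsto_wt (hlj j.castSucc)))
        (tendsto_conjTranspose (hK' j))) (tendsto_wt (hlj (Fin.last s))) ?_
    filter_upwards [hy] with m hm
    exact (hk m hm).2

end

section

/-! ### Weights attached to a tuple of spectra -/

variable {p q : ℕ}

/-- The kind function singling out the last index. -/
def lastKind (s : ℕ) (j : Fin (s + 1)) : Bool := decide (j = Fin.last s)

@[simp] theorem lastKind_castSucc {s : ℕ} (j : Fin s) : lastKind s j.castSucc = false := by
  simp [lastKind, (Fin.castSucc_lt_last j).ne]

@[simp] theorem lastKind_last (s : ℕ) : lastKind s (Fin.last s) = true := by simp [lastKind]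

/-- The dual weight when `t` holds, the weight itself otherwise. -/
def twist {n : ℕ} (t : Bool) (a : Fin n → ℝ) : Fin n → ℝ :=
  bif t then fun i => -a (Fin.rev i) else a

@[simp] theorem twist_false {n : ℕ} (a : Fin n → ℝ) : twist false a = a := rfl

theorem twist_true {n : ℕ} (a : Fin n → ℝ) : twist true a = fun i => -a (Fin.rev i) := rfl

theorem twist_add {n : ℕ} (t : Bool) (a b : Fin n → ℝ) :
    twist t (a + b) = twist t a + twist t b := by
  cases t
  · rfl
  · funext i; simp [twist_true, add_comm]

theorem twist_smul {n : ℕ} (t : Bool) (c : ℝ) (a : Fin n → ℝ) :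
    twist t (c • a) = c • twist t a := by
  cases t
  · rfl
  · funext i; simp [twist_true]

theorem antitone_twist {n : ℕ} (t : Bool) {a : Fin n → ℝ} (ha : Antitone a) :
    Antitone (twist t a) := by
  cases t
  · exact ha
  · exact fun i j h => neg_le_neg (ha (Fin.rev_le_rev.2 h))

/-- The weights on the first block attached to a tuple of spectra. -/
def fstWeight {s : ℕ} (x : Fin (s + 1) → Fin (p + q) → ℝ) (j : Fin (s + 1)) : Fin p → ℝ :=
  twist (lastKind s j) (fstBlock (x j))

/-- The weights on the second block attached to a tuple of spectra. -/
def sndWeight {s : ℕ} (x : Fin (s + 1) → Fin (p + q) → ℝ) (j : Fin (s + 1)) : Fin q → ℝ :=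
  twist (lastKind s j) (sndBlock (x j))

theorem fstWeight_add {s : ℕ} (x y : Fin (s + 1) → Fin (p + q) → ℝ) :
    fstWeight (x + y) = fstWeight x + fstWeight y := funext fun _ => twist_add _ _ _

theorem sndWeight_add {s : ℕ} (x y : Fin (s + 1) → Fin (p + q) → ℝ) :
    sndWeight (x + y) = sndWeight x + sndWeight y := funext fun _ => twist_add _ _ _

theorem fstWeight_smul {s : ℕ} (c : ℝ) (x : Fin (s + 1) → Fin (p + q) → ℝ) :
    fstWeight (c • x) = c • fstWeight x := funext fun _ => twist_smul _ _ _

theorem sndWeight_smul {s : ℕ} (c : ℝ) (x : Fin (s + 1) → Fin (p + q) → ℝ) :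
    sndWeight (c • x) = c • sndWeight x := funext fun _ => twist_smul _ _ _

theorem antitone_fstWeight {s : ℕ} {x : Fin (s + 1) → Fin (p + q) → ℝ}
    (hx : ∀ j, x j ∈ Chol p q) (j) : Antitone (fstWeight x j) :=
  antitone_twist _ (mem_Chol_iff.1 (hx j)).1

theorem antitone_sndWeight {s : ℕ} {x : Fin (s + 1) → Fin (p + q) → ℝ}
    (hx : ∀ j, x j ∈ Chol p q) (j) : Antitone (sndWeight x j) :=
  antitone_twist _ (mem_Chol_iff.1 (hx j)).2.1

theorem slope_add {n : ℕ} (a b : Fin n → ℝ) (g : Matrix (Fin n) (Fin n) ℂ)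
    (V : Submodule ℂ (Fin n → ℂ)) : slope (a + b) g V = slope a g V + slope b g V := by
  simp only [slope, Pi.add_apply, add_mul, Finset.sum_add_distrib]

theorem slope_smul {n : ℕ} (c : ℝ) (a : Fin n → ℝ) (g : Matrix (Fin n) (Fin n) ℂ)
    (V : Submodule ℂ (Fin n → ℂ)) : slope (c • a) g V = c * slope a g V := by
  simp only [slope, Pi.smul_apply, smul_eq_mul, Finset.mul_sum, mul_assoc]

theorem slope_const {n : ℕ} (c : ℝ) {g : Matrix (Fin n) (Fin n) ℂ} (hg : IsUnit g.det)
    (V : Submodule ℂ (Fin n → ℂ)) : slope (fun _ => c) g V = c * Module.finrank ℂ V := by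
  rw [slope, ← Finset.mul_sum, Fin.sum_univ_eq_sum_range
    (fun k => (flagDim g V (k + 1) : ℝ) - flagDim g V k), Finset.sum_range_sub
    (fun k => (flagDim g V k : ℝ)), flagDim_zero, flagDim_last hg]
  simp

theorem totalSlope_add {κ : Type} [Fintype κ] (a a' : κ → Fin p → ℝ) (b b' : κ → Fin q → ℝ)
    (e : Datum p q κ) (V W) :
    totalSlope (a + a') (b + b') e V W = totalSlope a b e V W + totalSlope a' b' e V W := by
  simp only [totalSlope, Pi.add_apply, slope_add, ← Finset.sum_add_distrib]
  exact Finset.sum_congr rfl fun j _ => by ring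

theorem totalSlope_smul {κ : Type} [Fintype κ] (c : ℝ) (a : κ → Fin p → ℝ) (b : κ → Fin q → ℝ)
    (e : Datum p q κ) (V W) :
    totalSlope (c • a) (c • b) e V W = c * totalSlope a b e V W := by
  simp only [totalSlope, Pi.smul_apply, slope_smul, ← mul_add, Finset.mul_sum]

/-- Translating the weights by constants with vanishing sum does not change the slopes. -/
theorem totalSlope_shift {κ : Type} [Fintype κ] (a : κ → Fin p → ℝ) (b : κ → Fin q → ℝ)
    {c : κ → ℝ} (hc : ∑ j, c j = 0) {e : Datum p q κ} (he : IsFramed e) (V W) :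
    totalSlope (a + fun j _ => c j) (b + fun j _ => c j) e V W = totalSlope a b e V W := by
  rw [totalSlope_add, add_eq_left, totalSlope]
  simp only [slope_const _ (he _).1, slope_const _ (he _).2, ← mul_add, ← Finset.sum_mul, hc,
    zero_mul]

/-- A block preserving permutation matrix. -/
noncomputable def permMatrix (π : Equiv.Perm (Fin p)) (τ : Equiv.Perm (Fin q)) :
    Matrix (Fin p ⊕ Fin q) (Fin p ⊕ Fin q) ℂ :=
  fromBlocks (π.permMatrix ℂ) 0 0 (τ.permMatrix ℂ)

theorem perm_mul_diagonal {n : ℕ} (π : Equiv.Perm (Fin n)) (d : Fin n → ℂ) :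
    π.permMatrix ℂ * diagonal d * (π.permMatrix ℂ)ᴴ = diagonal (d ∘ π) := by
  rw [conjTranspose_permMatrix, Equiv.Perm.permMatrix, Equiv.Perm.permMatrix,
    PEquiv.toMatrix_toPEquiv_mul, PEquiv.mul_toMatrix_toPEquiv, submatrix_submatrix]
  exact submatrix_diagonal_equiv d π

theorem permMatrix_mul_wt (π : Equiv.Perm (Fin p)) (τ : Equiv.Perm (Fin q)) (a : Fin p → ℝ)
    (b : Fin q → ℝ) :
    permMatrix π τ * wt a b * (permMatrix π τ)ᴴ = wt (a ∘ π) (b ∘ τ) := by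
  rw [permMatrix, wt, wt, fromBlocks_conjTranspose, fromBlocks_multiply, fromBlocks_multiply]
  simp only [Matrix.zero_mul, Matrix.mul_zero, conjTranspose_zero, add_zero, zero_add,
    Matrix.mul_neg, Matrix.neg_mul, perm_mul_diagonal, neg_zero]
  rfl

theorem permMatrix_pseudo (π : Equiv.Perm (Fin p)) (τ : Equiv.Perm (Fin q)) :
    (permMatrix π τ)ᴴ * sgn p q * permMatrix π τ = sgn p q := by
  rw [← pseudo_iff]
  have h : sgn p q = wt (fun _ => 1) (fun _ => 1) := by
    simp [wt, sgn]
  rw [h, permMatrix_mul_wt]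
  rfl

end

section

/-! ### Horn tuples and semistable data -/

variable {p q s : ℕ}

theorem wt_add_const (a : Fin p → ℝ) (b : Fin q → ℝ) (c : ℝ) :
    wt (a + fun _ => c) (b + fun _ => c) = wt a b + (c : ℂ) • sgn p q := by
  ext (i | i) (j | j)
  · by_cases h : i = j <;> simp [wt, sgn, h]
  · simp [wt, sgn]
  · simp [wt, sgn]
  · by_cases h : i = j <;> simp [wt, sgn, h]
    ring

theorem wt_neg (a : Fin p → ℝ) (b : Fin q → ℝ) :
    wt (fun i => -a i) (fun i => -b i) = -wt a b := by
  ext (i | i) (j | j)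
  · by_cases h : i = j <;> simp [wt, h]
  · simp [wt]
  · simp [wt]
  · by_cases h : i = j <;> simp [wt, h]

/-- Reversal of both blocks. -/
noncomputable def revMatrix (p q : ℕ) : Matrix (Fin p ⊕ Fin q) (Fin p ⊕ Fin q) ℂ :=
  permMatrix Fin.revPerm Fin.revPerm

theorem revMatrix_pseudo (p q : ℕ) :
    (revMatrix p q)ᴴ * sgn p q * revMatrix p q = sgn p q := permMatrix_pseudo _ _

theorem wt_weight_last (x : Fin (s + 1) → Fin (p + q) → ℝ) :
    wt (fstWeight x (Fin.last s)) (sndWeight x (Fin.last s)) =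
      -(revMatrix p q * wt (fstBlock (x (Fin.last s))) (sndBlock (x (Fin.last s))) *
        (revMatrix p q)ᴴ) := by
  rw [fstWeight, sndWeight, lastKind_last, twist_true, twist_true, revMatrix, permMatrix_mul_wt,
    ← wt_neg]
  rfl

/-- Gaps of the summands produce bounds on the sum. -/
theorem sum_gap_le {a : Fin s → Fin p → ℝ} {b : Fin s → Fin q → ℝ} {c : Fin s → ℝ}
    {k : Fin s → Matrix (Fin p ⊕ Fin q) (Fin p ⊕ Fin q) ℂ} {a' : Fin p → ℝ} {b' : Fin q → ℝ}
    (hk : ∀ j, (k j)ᴴ * sgn p q * k j = sgn p q) (ha : ∀ j i, c j ≤ a j i)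
    (hb : ∀ j i, b j i ≤ c j) (hsum : ∑ j, k j * wt (a j) (b j) * (k j)ᴴ = wt a' b') :
    (∀ i, ∑ j, c j ≤ a' i) ∧ ∀ i, b' i ≤ ∑ j, c j := by
  have h1 : ∑ j, k j * (wt (a j) (b j) - (c j : ℂ) • sgn p q) * (k j)ᴴ =
      wt a' b' - ((∑ j, c j : ℝ) : ℂ) • sgn p q := by
    rw [← hsum, ofReal_sum, Finset.sum_smul, ← Finset.sum_sub_distrib]
    refine Finset.sum_congr rfl fun j _ => ?_
    rw [Matrix.mul_sub, Matrix.sub_mul, Matrix.mul_smul, Matrix.smul_mul, pseudo_iff.2 (hk j)]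
  have h2 : (wt a' b' - ((∑ j, c j : ℝ) : ℂ) • sgn p q).PosSemidef := by
    rw [← h1]
    refine posSemidef_sum _ fun j _ => PosSemidef.mul_mul_conjTranspose_same ?_ _
    rw [wt_sub_smul_sgn]
    refine PosSemidef.diagonal ?_
    rintro (i | i)
    · simpa using ha j i
    · simpa using hb j i
  rw [wt_sub_smul_sgn] at h2
  constructor <;> intro i
  · have := h2.diag_nonneg (i := Sum.inl i)
    simp only [diagonal_apply_eq, Sum.elim_inl, sub_nonneg] at this
    exact_mod_cast this
  · have := h2.diag_nonneg (i := Sum.inr i)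
    simp only [diagonal_apply_eq, Sum.elim_inr, sub_nonneg] at this
    exact_mod_cast this

theorem Semistable.congr_slope {κ : Type} [Fintype κ] {kind : κ → Bool} {a a' : κ → Fin p → ℝ}
    {b b' : κ → Fin q → ℝ} {e : Datum p q κ} (h : Semistable kind a b e)
    (heq : ∀ V W, totalSlope a b e V W = totalSlope a' b' e V W) : Semistable kind a' b' e :=
  ⟨h.1, fun V W hi => heq V W ▸ h.2 V W hi⟩

/-- Points of the Horn cone admit semistable data. -/
theorem exists_semistable_of_mem [Nonempty (Fin p)] [Nonempty (Fin q)] (hs : 0 < s)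
    {x : Fin (s + 1) → Fin (p + q) → ℝ} (hx : x ∈ HornHolS p q s) :
    ∃ e : Datum p q (Fin (s + 1)), Semistable (lastKind s) (fstWeight x) (sndWeight x) e := by
  obtain ⟨hc, k, hk, hsum⟩ := mem_HornHolS_iff.1 hx
  choose c δ hδ hc1 hc2 using fun j => exists_gap (hc j)
  set sh : Fin (s + 1) → ℝ := Fin.snoc (α := fun _ => ℝ) (fun j : Fin s => -c j.castSucc)
    (∑ j : Fin s, c j.castSucc) with hsh
  have hsh0 : ∑ j, sh j = 0 := by
    rw [Fin.sum_univ_castSucc]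
    simp [hsh]
  have hgap := sum_gap_le (c := fun j : Fin s => c j.castSucc) hk
    (fun j i => by linarith [hc1 j.castSucc i, hδ j.castSucc])
    (fun j i => by linarith [hc2 j.castSucc i, hδ j.castSucc]) hsum
  obtain ⟨e, he⟩ := exists_semistable_of_solution (kind := lastKind s)
    (a := fstWeight x + fun j _ => sh j) (b := sndWeight x + fun j _ => sh j)
    (k := Fin.snoc (α := fun _ => Matrix (Fin p ⊕ Fin q) (Fin p ⊕ Fin q) ℂ)
      (fun j => revMatrix p q * k j) 1)
    (fun j => (antitone_fstWeight hc j).add antitone_const)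
    (fun j => (antitone_sndWeight hc j).add antitone_const)
    (fun j => by
      refine Fin.lastCases ?_ (fun j => ?_) j
      · simp
      · intro _
        have h1 : sh j.castSucc = -c j.castSucc := by simp [hsh]
        constructor <;> intro i
        · have := hc1 j.castSucc i
          have := hδ j.castSucc
          simp only [Pi.add_apply, fstWeight, lastKind_castSucc, twist_false, h1]
          linarith
        · have := hc2 j.castSucc i
          have := hδ j.castSucc
          simp only [Pi.add_apply, sndWeight, lastKind_castSucc, twist_false, h1]
          linarith)
    (fun j => by
      refine Fin.lastCases ?_ (fun j => ?_) j
      · intro _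
        have h1 : sh (Fin.last s) = ∑ j : Fin s, c j.castSucc := by simp [hsh]
        constructor <;> intro i
        · simp only [Pi.add_apply, fstWeight, lastKind_last, twist_true, h1]
          linarith [hgap.1 i.rev]
        · simp only [Pi.add_apply, sndWeight, lastKind_last, twist_true, h1]
          linarith [hgap.2 i.rev]
      · simp)
    (fun j => by
      refine Fin.lastCases ?_ (fun j => ?_) j
      · simp
      · simpa using pseudo_comp (revMatrix_pseudo p q) (hk j))
    (fun j => by
      refine Fin.lastCases ?_ (fun j => ?_) j
      · simp
      · simp)
    (j₀ := (⟨0, hs⟩ : Fin s).castSucc) (lastKind_castSucc _)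
    (by
      have h1 : ∀ j, wt ((fstWeight x + fun j (_ : Fin p) => sh j : Fin (s + 1) → Fin p → ℝ) j)
          ((sndWeight x + fun j (_ : Fin q) => sh j : Fin (s + 1) → Fin q → ℝ) j)
          = wt (fstWeight x j) (sndWeight x j) + (sh j : ℂ) • sgn p q := fun j =>
        wt_add_const _ _ _
      simp only [h1]
      rw [Fin.sum_univ_castSucc, Fin.snoc_last, conjTranspose_one, Matrix.mul_one, Matrix.one_mul,
        wt_weight_last, ← hsum]
      have h2 : ∀ j : Fin s, revMatrix p q * k j * (wt (fstWeight x j.castSucc)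
          (sndWeight x j.castSucc) + (sh j.castSucc : ℂ) • sgn p q) * (revMatrix p q * k j)ᴴ
          = revMatrix p q * (k j * wt (fstBlock (x j.castSucc)) (sndBlock (x j.castSucc)) *
            (k j)ᴴ) * (revMatrix p q)ᴴ + (sh j.castSucc : ℂ) • sgn p q := by
        intro j
        rw [Matrix.mul_add, Matrix.add_mul, Matrix.mul_smul, Matrix.smul_mul,
          pseudo_iff.2 (pseudo_comp (revMatrix_pseudo p q) (hk j)), conjTranspose_mul]
        simp only [Matrix.mul_assoc, fstWeight, sndWeight, lastKind_castSucc, twist_false]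
      simp only [Fin.snoc_castSucc, h2, Finset.sum_add_distrib, ← Finset.sum_smul,
        ← Finset.mul_sum, ← Finset.sum_mul]
      have h3 : ∑ j : Fin s, ((sh j.castSucc : ℝ) : ℂ) = -(sh (Fin.last s) : ℂ) := by
        rw [← ofReal_sum, ← ofReal_neg]
        congr 1
        rw [Fin.sum_univ_castSucc] at hsh0
        linarith
      rw [h3, neg_smul]
      abel)
  exact ⟨e, he.congr_slope fun V W => totalSlope_shift _ _ hsh0 he.1 V W⟩

end

section

variable {p q s : ℕ}

/-- The total trace of the weights attached to a tuple of spectra. -/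
noncomputable def weightSum (x : Fin (s + 1) → Fin (p + q) → ℝ) : ℝ :=
  ∑ j, (∑ i, fstWeight x j i + ∑ i, sndWeight x j i)

theorem weightSum_add (x y : Fin (s + 1) → Fin (p + q) → ℝ) :
    weightSum (x + y) = weightSum x + weightSum y := by
  simp only [weightSum, fstWeight_add, sndWeight_add, Pi.add_apply, Finset.sum_add_distrib]
  ring

theorem weightSum_smul (c : ℝ) (x : Fin (s + 1) → Fin (p + q) → ℝ) :
    weightSum (c • x) = c * weightSum x := by
  simp only [weightSum, fstWeight_smul, sndWeight_smul, Pi.smul_apply, smul_eq_mul,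
    Finset.mul_sum, mul_add]

theorem trace_wt_mul_sgn (a : Fin p → ℝ) (b : Fin q → ℝ) :
    (wt a b * sgn p q).trace = ((∑ i, a i + ∑ i, b i : ℝ) : ℂ) := by
  rw [wt, sgn, fromBlocks_multiply, trace_fromBlocks']
  simp [trace_diagonal]

theorem trace_conj_wt_mul_sgn {k : Matrix (Fin p ⊕ Fin q) (Fin p ⊕ Fin q) ℂ}
    (hk : kᴴ * sgn p q * k = sgn p q) (a : Fin p → ℝ) (b : Fin q → ℝ) :
    (k * wt a b * kᴴ * sgn p q).trace = ((∑ i, a i + ∑ i, b i : ℝ) : ℂ) := by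
  rw [Matrix.mul_assoc, Matrix.mul_assoc, trace_mul_comm, Matrix.mul_assoc, hk,
    trace_wt_mul_sgn]

theorem weightSum_eq_zero {x : Fin (s + 1) → Fin (p + q) → ℝ} (hx : x ∈ HornHolS p q s) :
    weightSum x = 0 := by
  obtain ⟨hc, k, hk, hsum⟩ := mem_HornHolS_iff.1 hx
  have h := congrArg (fun M => (M * sgn p q).trace) hsum
  simp only [Finset.sum_mul, trace_sum, trace_conj_wt_mul_sgn (hk _), trace_wt_mul_sgn] at h
  rw [← ofReal_sum, ofReal_inj] at h
  rw [weightSum, Fin.sum_univ_castSucc]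
  simp only [fstWeight, sndWeight, lastKind_castSucc, twist_false, lastKind_last, twist_true,
    Finset.sum_neg_distrib, h]
  have h1 : ∑ i, fstBlock (x (Fin.last s)) (Fin.rev i) = ∑ i, fstBlock (x (Fin.last s)) i :=
    Equiv.sum_comp Fin.revPerm _
  have h2 : ∑ i, sndBlock (x (Fin.last s)) (Fin.rev i) = ∑ i, sndBlock (x (Fin.last s)) i :=
    Equiv.sum_comp Fin.revPerm _
  rw [h1, h2]
  ring

theorem revMatrix_mul_wt_weight_last (x : Fin (s + 1) → Fin (p + q) → ℝ) :
    revMatrix p q * wt (fstWeight x (Fin.last s)) (sndWeight x (Fin.last s)) * (revMatrix p q)ᴴ =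
      -wt (fstBlock (x (Fin.last s))) (sndBlock (x (Fin.last s))) := by
  rw [revMatrix, permMatrix_mul_wt, ← wt_neg, fstWeight, sndWeight, lastKind_last, twist_true,
    twist_true]
  congr 1 <;> funext i <;> simp

/-- A tuple of spectra in the chamber with a stable datum belongs to the Horn cone. -/
theorem mem_of_stable [Nonempty (Fin p)] [Nonempty (Fin q)] (hs : 0 < s)
    {x : Fin (s + 1) → Fin (p + q) → ℝ} (hc : ∀ j, x j ∈ Chol p q) (htr : weightSum x = 0)
    {e : Datum p q (Fin (s + 1))} (hst : Stable (lastKind s) (fstWeight x) (sndWeight x) e) :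
    x ∈ HornHolS p q s := by
  choose c δ hδ hc1 hc2 using fun j => exists_gap (hc j)
  set sh : Fin (s + 1) → ℝ := Fin.snoc (α := fun _ => ℝ) (fun j : Fin s => -c j.castSucc)
    (∑ j : Fin s, c j.castSucc) with hsh
  have hsh0 : ∑ j, sh j = 0 := by
    rw [Fin.sum_univ_castSucc]
    simp [hsh]
  obtain ⟨k, hk, hk1, hsum⟩ := exists_solution_of_stable (kind := lastKind s)
    (a := fstWeight x + fun j _ => sh j) (b := sndWeight x + fun j _ => sh j) (e := e)
    (fun j => (antitone_fstWeight hc j).add antitone_const)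
    (fun j => (antitone_sndWeight hc j).add antitone_const)
    (by
      simp only [Pi.add_apply, Finset.sum_add_distrib, Finset.sum_const, Finset.card_univ,
        Fintype.card_fin, nsmul_eq_mul, ← Finset.mul_sum, hsh0, mul_zero, add_zero]
      simpa only [weightSum, Finset.sum_add_distrib] using htr)
    ⟨hst.1, fun V W hi h0 h1 => by
      rw [totalSlope_shift _ _ hsh0 hst.1]
      exact hst.2 V W hi h0 h1⟩
    (fun j => by
      refine Fin.lastCases ?_ (fun j => ?_) j
      · simp
      · intro _
        have h1 : sh j.castSucc = -c j.castSucc := by simp [hsh]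
        constructor <;> intro i
        · have := hc1 j.castSucc i
          have := hδ j.castSucc
          simp only [Pi.add_apply, fstWeight, lastKind_castSucc, twist_false, h1]
          linarith
        · have := hc2 j.castSucc i
          have := hδ j.castSucc
          simp only [Pi.add_apply, sndWeight, lastKind_castSucc, twist_false, h1]
          linarith)
    (lastKind_last s) (lastKind_castSucc ⟨0, hs⟩)
  have h1 : ∀ j, k j * wt ((fstWeight x + fun j (_ : Fin p) => sh j : Fin (s + 1) → Fin p → ℝ) j)
      ((sndWeight x + fun j (_ : Fin q) => sh j : Fin (s + 1) → Fin q → ℝ) j) * (k j)ᴴ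
      = k j * wt (fstWeight x j) (sndWeight x j) * (k j)ᴴ + (sh j : ℂ) • sgn p q := fun j => by
    have h2 := wt_add_const (fstWeight x j) (sndWeight x j) (sh j)
    change k j * wt (fstWeight x j + fun _ => sh j) (sndWeight x j + fun _ => sh j) * (k j)ᴴ = _
    rw [h2, Matrix.mul_add, Matrix.add_mul, Matrix.mul_smul, Matrix.smul_mul,
      pseudo_iff.2 (hk j)]
  simp only [h1, Finset.sum_add_distrib, ← Finset.sum_smul, ← ofReal_sum, hsh0, ofReal_zero,
    zero_smul, add_zero] at hsum
  rw [Fin.sum_univ_castSucc, hk1, conjTranspose_one, Matrix.mul_one, Matrix.one_mul] at hsum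
  refine mem_HornHolS_iff.2 ⟨hc, fun j => revMatrix p q * k j.castSucc,
    fun j => pseudo_comp (revMatrix_pseudo p q) (hk _), ?_⟩
  rw [← neg_neg (wt (fstBlock (x (Fin.last s))) _), ← revMatrix_mul_wt_weight_last,
    ← Matrix.neg_mul, ← Matrix.mul_neg, ← eq_neg_of_add_eq_zero_left hsum, Finset.mul_sum,
    Finset.sum_mul]
  refine Finset.sum_congr rfl fun j _ => ?_
  rw [conjTranspose_mul]
  simp only [Matrix.mul_assoc, fstWeight, sndWeight, lastKind_castSucc, twist_false]

end

section

/-! ### Explicit points of the Horn cone -/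

variable {p q s : ℕ}

theorem mem_Chol_of_strictAnti {x : Fin (p + q) → ℝ} (hx : StrictAnti x) : x ∈ Chol p q :=
  ⟨fun _ _ h _ => hx.antitone h, fun _ _ h h' => hx (Fin.lt_def.2 (h.trans_le h'))⟩

theorem wt_block_sum {ι : Type*} (t : Finset ι) (x : ι → Fin (p + q) → ℝ) :
    wt (fstBlock (∑ j ∈ t, x j)) (sndBlock (∑ j ∈ t, x j)) =
      ∑ j ∈ t, wt (fstBlock (x j)) (sndBlock (x j)) := by
  ext (i | i) (j | j)
  · by_cases h : i = j <;> simp [wt, h, fstBlock, Matrix.sum_apply]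
  · simp [wt, Matrix.sum_apply]
  · simp [wt, Matrix.sum_apply]
  · by_cases h : i = j <;> simp [wt, h, sndBlock, Matrix.sum_apply]

theorem wt_block_add (x y : Fin (p + q) → ℝ) :
    wt (fstBlock (x + y)) (sndBlock (x + y)) =
      wt (fstBlock x) (sndBlock x) + wt (fstBlock y) (sndBlock y) := by
  simpa using wt_block_sum Finset.univ ![x, y]

theorem wt_block_neg (x : Fin (p + q) → ℝ) :
    wt (fstBlock (-x)) (sndBlock (-x)) = -wt (fstBlock x) (sndBlock x) :=
  wt_neg (fstBlock x) (sndBlock x)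

/-- Construction of points of the Horn cone. -/
theorem snoc_mem_HornHolS {x : Fin s → Fin (p + q) → ℝ} {y : Fin (p + q) → ℝ}
    (hx : ∀ j, x j ∈ Chol p q) (hy : y ∈ Chol p q)
    {k : Fin s → Matrix (Fin p ⊕ Fin q) (Fin p ⊕ Fin q) ℂ}
    (hk : ∀ j, (k j)ᴴ * sgn p q * k j = sgn p q)
    (hsum : ∑ j, k j * wt (fstBlock (x j)) (sndBlock (x j)) * (k j)ᴴ =
      wt (fstBlock y) (sndBlock y)) :
    (Fin.snoc x y : Fin (s + 1) → Fin (p + q) → ℝ) ∈ HornHolS p q s := by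
  refine mem_HornHolS_iff.2 ⟨fun j => ?_, k, hk, ?_⟩
  · refine Fin.lastCases ?_ (fun j => ?_) j
    · simpa using hy
    · simpa using hx j
  · simpa using hsum

theorem snoc_sum_mem_HornHolS (hs : 0 < s) {x : Fin s → Fin (p + q) → ℝ}
    (hx : ∀ j, StrictAnti (x j)) :
    (Fin.snoc x (∑ j, x j) : Fin (s + 1) → Fin (p + q) → ℝ) ∈ HornHolS p q s := by
  refine snoc_mem_HornHolS (fun j => mem_Chol_of_strictAnti (hx j))
    (mem_Chol_of_strictAnti fun i i' h => ?_)
    (k := fun _ => 1) (fun _ => by simp) ?_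
  · rw [Finset.sum_apply, Finset.sum_apply]
    exact Finset.sum_lt_sum_of_nonempty ⟨⟨0, hs⟩, Finset.mem_univ _⟩ fun j _ => hx j h
  · simp [wt_block_sum]

/-- The extension of a pair of permutations to all coordinates. -/
def blockPerm (π : Equiv.Perm (Fin p)) (τ : Equiv.Perm (Fin q)) : Equiv.Perm (Fin (p + q)) :=
  finSumFinEquiv.permCongr (Equiv.sumCongr π τ)

theorem fstBlock_comp_blockPerm (π : Equiv.Perm (Fin p)) (τ : Equiv.Perm (Fin q))
    (x : Fin (p + q) → ℝ) : fstBlock (x ∘ blockPerm π τ) = fstBlock x ∘ π := by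
  funext i; simp [fstBlock, blockPerm, Equiv.permCongr_apply]

theorem sndBlock_comp_blockPerm (π : Equiv.Perm (Fin p)) (τ : Equiv.Perm (Fin q))
    (x : Fin (p + q) → ℝ) : sndBlock (x ∘ blockPerm π τ) = sndBlock x ∘ τ := by
  funext i; simp [sndBlock, blockPerm, Equiv.permCongr_apply]

/-- Permuting one of the summands inside the blocks. -/
theorem snoc_perm_mem_HornHolS {x : Fin s → Fin (p + q) → ℝ} (hx : ∀ j, x j ∈ Chol p q)
    (j₁ : Fin s) (π : Equiv.Perm (Fin p)) (τ : Equiv.Perm (Fin q))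
    (hy : ∑ j, x j + (x j₁ ∘ blockPerm π τ + -x j₁) ∈ Chol p q) :
    (Fin.snoc x (∑ j, x j + (x j₁ ∘ blockPerm π τ + -x j₁)) : Fin (s + 1) → Fin (p + q) → ℝ)
      ∈ HornHolS p q s := by
  refine snoc_mem_HornHolS hx hy (k := Function.update 1 j₁ (permMatrix π τ)) (fun j => ?_) ?_
  · by_cases h : j = j₁
    · subst h
      simpa using permMatrix_pseudo π τ
    · simp [h]
  · rw [wt_block_add, wt_block_add, wt_block_neg, fstBlock_comp_blockPerm,
      sndBlock_comp_blockPerm, ← permMatrix_mul_wt, wt_block_sum, ← sub_eq_iff_eq_add',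
      ← Finset.sum_sub_distrib, Fintype.sum_eq_single j₁]
    · rw [Function.update_self, sub_eq_add_neg]
    · intro j h
      simp [h]

theorem sum_swap_sub_mul {n : ℕ} (u g : Fin n → ℝ) (a b : Fin n) :
    ∑ i, (u (Equiv.swap a b i) - u i) * g i = (u b - u a) * (g a - g b) := by
  by_cases hab : a = b
  · subst hab; simp
  · rw [Fintype.sum_eq_add a b hab fun i hi => by
      rw [Equiv.swap_apply_of_ne_of_ne hi.1 hi.2, sub_self, zero_mul]]
    rw [Equiv.swap_apply_left, Equiv.swap_apply_right]
    ring

end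

section

variable {p q s : ℕ}

/-- The projection to the plane of two coordinates. -/
def planeProj (i : Fin p) (l : Fin q) : Matrix (Fin p ⊕ Fin q) (Fin p ⊕ Fin q) ℂ :=
  Matrix.single (Sum.inl i) (Sum.inl i) 1 + Matrix.single (Sum.inr l) (Sum.inr l) 1

/-- The exchange of two coordinates in their plane. -/
def planeSwap (i : Fin p) (l : Fin q) : Matrix (Fin p ⊕ Fin q) (Fin p ⊕ Fin q) ℂ :=
  Matrix.single (Sum.inl i) (Sum.inr l) 1 + Matrix.single (Sum.inr l) (Sum.inl i) 1

theorem planeProj_mul_self (i : Fin p) (l : Fin q) :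
    planeProj i l * planeProj i l = planeProj i l := by
  simp [planeProj, Matrix.mul_add, Matrix.add_mul]

theorem planeSwap_mul_self (i : Fin p) (l : Fin q) :
    planeSwap i l * planeSwap i l = planeProj i l := by
  simp [planeProj, planeSwap, Matrix.mul_add, Matrix.add_mul, add_comm]

theorem planeProj_mul_planeSwap (i : Fin p) (l : Fin q) :
    planeProj i l * planeSwap i l = planeSwap i l := by
  simp [planeProj, planeSwap, Matrix.mul_add, Matrix.add_mul, add_comm]

theorem planeSwap_mul_planeProj (i : Fin p) (l : Fin q) :
    planeSwap i l * planeProj i l = planeSwap i l := by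
  simp [planeProj, planeSwap, Matrix.mul_add, Matrix.add_mul, add_comm]

theorem sgn_mul_planeProj (i : Fin p) (l : Fin q) :
    sgn p q * planeProj i l = planeProj i l * sgn p q := by
  ext (a | a) (b | b) <;> simp [sgn_eq_diagonal, planeProj, Matrix.single_apply]
  split_ifs <;> simp

theorem sgn_mul_planeSwap (i : Fin p) (l : Fin q) :
    sgn p q * planeSwap i l = -(planeSwap i l * sgn p q) := by
  ext (a | a) (b | b) <;> simp [sgn_eq_diagonal, planeSwap, Matrix.single_apply]
  split_ifs <;> simp

/-- A hyperbolic rotation mixing a coordinate of the first block and one of the second. -/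
noncomputable def boost (i : Fin p) (l : Fin q) (t : ℝ) :
    Matrix (Fin p ⊕ Fin q) (Fin p ⊕ Fin q) ℂ :=
  1 + (1 / 4 : ℂ) • planeProj i l + (t : ℂ) • planeSwap i l

theorem boost_conjTranspose (i : Fin p) (l : Fin q) (t : ℝ) :
    (boost i l t)ᴴ = boost i l t := by
  simp [boost, planeProj, planeSwap, add_comm]

theorem boost_mul (i : Fin p) (l : Fin q) (t u : ℝ) :
    boost i l t * boost i l u = 1 + (9 / 16 + t * u : ℂ) • planeProj i l +
      (5 / 4 * (t + u) : ℂ) • planeSwap i l := by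
  simp only [boost, Matrix.add_mul, Matrix.mul_add, Matrix.one_mul, Matrix.mul_one,
    Matrix.smul_mul, Matrix.mul_smul, planeProj_mul_self, planeSwap_mul_self,
    planeProj_mul_planeSwap, planeSwap_mul_planeProj]
  module

theorem sgn_mul_boost (i : Fin p) (l : Fin q) (t : ℝ) :
    sgn p q * boost i l t = boost i l (-t) * sgn p q := by
  simp only [boost, Matrix.add_mul, Matrix.mul_add, Matrix.one_mul, Matrix.mul_one,
    Matrix.smul_mul, Matrix.mul_smul, sgn_mul_planeProj, sgn_mul_planeSwap, ofReal_neg]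
  module

theorem boost_pseudo (i : Fin p) (l : Fin q) {t : ℝ} (ht : t * t = 9 / 16) :
    (boost i l t)ᴴ * sgn p q * boost i l t = sgn p q := by
  have h : (9 / 16 + t * (-t : ℝ) : ℂ) = 0 := by
    rw [← ofReal_mul, mul_neg, ht]; norm_num
  rw [boost_conjTranspose, Matrix.mul_assoc, sgn_mul_boost, ← Matrix.mul_assoc, boost_mul, h]
  simp

end

section

variable {p q s : ℕ}

/-- The spectrum with all coordinates `t` on the first block and `-t` on the second, moved away
from zero by `u` at the extreme coordinates. -/
def extremeSpectrum (p q : ℕ) (t u : ℝ) (m : Fin (p + q)) : ℝ :=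
  (if (m : ℕ) < p then t else -t) +
    ((if (m : ℕ) = 0 then u else 0) - if (m : ℕ) + 1 = p + q then u else 0)

theorem extremeSpectrum_mem_Chol (hp : 0 < p) (hq : 0 < q) {t u : ℝ} (ht : 0 < t) (hu : 0 ≤ u) :
    extremeSpectrum p q t u ∈ Chol p q := by
  refine ⟨fun i j h h' => ?_, fun i j h h' => ?_⟩ <;> unfold extremeSpectrum <;> split_ifs <;>
    first | linarith | omega

theorem wt_extremeSpectrum (i : Fin p) (l : Fin q) (hi : (i : ℕ) = 0) (hl : (l : ℕ) + 1 = q)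
    (t u : ℝ) :
    wt (fstBlock (extremeSpectrum p q t u)) (sndBlock (extremeSpectrum p q t u)) =
      (t : ℂ) • 1 + (u : ℂ) • planeProj i l := by
  have hi' : ∀ a : Fin p, (a : ℕ) = 0 ↔ i = a := fun a => by rw [Fin.ext_iff, hi, eq_comm]
  have hl' : ∀ b : Fin q, p + (b : ℕ) + 1 = p + q ↔ l = b := fun b => by
    rw [Fin.ext_iff]; omega
  have hp : ∀ a : Fin p, (a : ℕ) + 1 ≠ p + q := fun a => by omega
  ext (a | a) (b | b)
  · by_cases h : a = b
    · subst h
      simp [wt, planeProj, fstBlock, extremeSpectrum, Matrix.single_apply, hi', hp]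
      split_ifs <;> simp
    · have : ¬ (i = a ∧ i = b) := fun h' => h (h'.1.symm.trans h'.2)
      simp [wt, planeProj, h, this]
  · simp [wt, planeProj]
  · simp [wt, planeProj]
  · by_cases h : a = b
    · subst h
      have : p ≠ 0 := by have := i.2; omega
      simp [wt, planeProj, sndBlock, extremeSpectrum, Matrix.single_apply, hl', this]
      split_ifs <;> simp [add_comm]
    · have : ¬ (l = a ∧ l = b) := fun h' => h (h'.1.symm.trans h'.2)
      simp [wt, planeProj, h, this]

/-- A point of the Horn cone for which the summands are not simultaneously diagonalised. -/
theorem snoc_boost_mem_HornHolS (hp : 0 < p) (hq : 0 < q) {j₀ j₁ : Fin s} (hj : j₀ ≠ j₁) :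
    (Fin.snoc (fun _ => extremeSpectrum p q 1 0) (extremeSpectrum p q s (9 / 4)) :
      Fin (s + 1) → Fin (p + q) → ℝ) ∈ HornHolS p q s := by
  have hs : (0 : ℝ) < s := Nat.cast_pos.2 (Fin.pos j₀)
  set i : Fin p := ⟨0, hp⟩
  set l : Fin q := ⟨q - 1, by omega⟩ with hl
  have hl1 : (l : ℕ) + 1 = q := by simp only [hl]; omega
  refine snoc_mem_HornHolS (fun _ => extremeSpectrum_mem_Chol hp hq one_pos le_rfl)
    (extremeSpectrum_mem_Chol hp hq hs (by norm_num))
    (k := fun j => if j = j₀ then boost i l (3 / 4) else if j = j₁ then boost i l (-(3 / 4))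
      else 1) (fun j => ?_) ?_
  · split_ifs
    · exact boost_pseudo i l (by norm_num)
    · exact boost_pseudo i l (by norm_num)
    · simp
  · simp only [wt_extremeSpectrum i l rfl hl1, ofReal_one, one_smul, ofReal_zero, zero_smul,
      add_zero, Matrix.mul_one]
    have h1 : ∑ j : Fin s, ((if j = j₀ then boost i l (3 / 4) else if j = j₁ then
        boost i l (-(3 / 4)) else 1) * (if j = j₀ then boost i l (3 / 4) else if j = j₁ then
        boost i l (-(3 / 4)) else 1)ᴴ - 1) = ((9 / 4 : ℝ) : ℂ) • planeProj i l := by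
      rw [Fintype.sum_eq_add j₀ j₁ hj fun j h => by simp [h.1, h.2]]
      simp only [if_true, hj.symm, if_false, boost_conjTranspose, boost_mul]
      push_cast
      module
    rw [Finset.sum_sub_distrib, sub_eq_iff_eq_add] at h1
    rw [h1]
    simp [add_comm, Nat.cast_smul_eq_nsmul]

end

section

variable {p q s : ℕ}

/-- A strictly decreasing spectrum. -/
def staircase (n : ℕ) (i : Fin n) : ℝ := -(i : ℝ)

theorem strictAnti_staircase (n : ℕ) : StrictAnti (staircase n) := fun i j h => by
  have : (i : ℝ) < j := Nat.cast_lt.2 h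
  simpa [staircase] using this

theorem strictAnti_staircase_add_single {n : ℕ} (i₀ : Fin n) :
    StrictAnti (staircase n + Pi.single i₀ (1 / 2)) := fun i j h => by
  have h1 : (i : ℝ) + 1 ≤ j := by exact_mod_cast Fin.lt_def.1 h
  have h2 : ∀ m, (0 : ℝ) ≤ (Pi.single i₀ (1 / 2) : Fin n → ℝ) m ∧
      (Pi.single i₀ (1 / 2) : Fin n → ℝ) m ≤ 1 / 2 := fun m => by
    by_cases hm : m = i₀
    · subst hm; norm_num
    · simp [hm]
  simp only [staircase, Pi.add_apply]
  linarith [h2 i, h2 j]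

theorem strictAnti_smul_staircase_add {n : ℕ} {t : ℝ} (ht : (n : ℝ) ≤ t)
    (σ : Equiv.Perm (Fin n)) :
    StrictAnti (t • staircase n + staircase n ∘ σ) := fun i j h => by
  have h1 : (i : ℝ) + 1 ≤ j := by exact_mod_cast Fin.lt_def.1 h
  have h2 : ((σ i : ℕ) : ℝ) < n := Nat.cast_lt.2 (σ i).2
  have h3 : (0 : ℝ) ≤ ((σ j : ℕ) : ℝ) := Nat.cast_nonneg _
  simp only [staircase, Pi.add_apply, Pi.smul_apply, smul_eq_mul, Function.comp_apply]
  nlinarith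

/-- Linear forms vanishing on the Horn cone are multiples of the trace. -/
theorem eq_const_of_forall_mem (hp : 0 < p) (hq : 0 < q) (hs : 2 ≤ s)
    {B : Fin s → Fin (p + q) → ℝ} {Γ : Fin (p + q) → ℝ}
    (H : ∀ x ∈ HornHolS p q s,
      ∑ j : Fin s, ∑ i, x j.castSucc i * B j i = ∑ i, x (Fin.last s) i * Γ i) :
    (∀ j i, B j i = Γ i) ∧ ∀ i i', Γ i = Γ i' := by
  have H' : ∀ (x : Fin s → Fin (p + q) → ℝ) (y : Fin (p + q) → ℝ),
      (Fin.snoc x y : Fin (s + 1) → Fin (p + q) → ℝ) ∈ HornHolS p q s →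
        ∑ j, ∑ i, x j i * B j i = ∑ i, y i * Γ i := fun x y h => by
    simpa using H _ h
  have hB : ∀ j i, B j i = Γ i := by
    have h1 : ∀ x : Fin s → Fin (p + q) → ℝ, (∀ j, StrictAnti (x j)) →
        ∑ j, ∑ i, x j i * (B j i - Γ i) = 0 := fun x hx => by
      have := H' x _ (snoc_sum_mem_HornHolS (by omega) hx)
      simp only [Finset.sum_apply, Finset.sum_mul] at this
      simp only [mul_sub, Finset.sum_sub_distrib]
      rw [sub_eq_zero, this]
      exact Finset.sum_comm
    intro j i
    have h2 := h1 (fun _ => staircase (p + q)) fun _ => strictAnti_staircase _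
    have h3 := h1 ((fun _ => staircase (p + q)) + Pi.single j (Pi.single i (1 / 2))) fun j' => by
      by_cases h : j' = j
      · subst h
        simpa using strictAnti_staircase_add_single i
      · simpa [h] using strictAnti_staircase _
    simp only [Pi.add_apply, add_mul, Finset.sum_add_distrib, h2, zero_add] at h3
    rw [Fintype.sum_eq_single j fun j' h => by simp [h], Fintype.sum_eq_single i fun i' h => by
      simp [h]] at h3
    simp only [Pi.single_eq_same] at h3
    linarith
  refine ⟨hB, ?_⟩
  simp only [hB] at H'
  have hperm : ∀ (π : Equiv.Perm (Fin p)) (τ : Equiv.Perm (Fin q)),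
      ∑ i, (fstBlock (staircase (p + q)) (π i) - fstBlock (staircase (p + q)) i) * fstBlock Γ i +
      ∑ i, (sndBlock (staircase (p + q)) (τ i) - sndBlock (staircase (p + q)) i) * sndBlock Γ i
        = 0 := by
    intro π τ
    set j₀ : Fin s := ⟨0, by omega⟩
    set j₁ : Fin s := ⟨1, by omega⟩
    have hj : j₁ ≠ j₀ := by simp [j₀, j₁]
    set r := staircase (p + q)
    set x : Fin s → Fin (p + q) → ℝ := (fun _ => r) + Pi.single j₀ (((p + q : ℕ) : ℝ) • r)
    have hx1 : x j₁ = r := by simp [x, hj]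
    have hx : ∀ j, x j ∈ Chol p q := fun j => by
      by_cases h : j = j₀
      · subst h
        have : x j₀ = ((p + q : ℕ) : ℝ) • r + r ∘ (1 : Equiv.Perm (Fin (p + q))) := by
          simp [x, add_comm]
        rw [this]
        exact mem_Chol_of_strictAnti (strictAnti_smul_staircase_add le_rfl _)
      · have : x j = r := by simp [x, h]
        rw [this]
        exact mem_Chol_of_strictAnti (strictAnti_staircase _)
    have hsum : ∑ j, x j + (r ∘ blockPerm π τ + -r) =
        (s - 1 + (p + q : ℕ) : ℝ) • r + r ∘ blockPerm π τ := by
      simp only [x, Finset.sum_add_distrib, Pi.add_apply, Finset.sum_pi_single', Finset.mem_univ,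
        if_true, Finset.sum_const, Finset.card_univ, Fintype.card_fin]
      rw [← Nat.cast_smul_eq_nsmul ℝ]
      module
    have h1 := H' x _ (snoc_perm_mem_HornHolS hx j₁ π τ (by
      rw [hx1, hsum]
      refine mem_Chol_of_strictAnti (strictAnti_smul_staircase_add ?_ _)
      have : (2 : ℝ) ≤ s := by exact_mod_cast hs
      linarith))
    rw [hx1] at h1
    simp only [Pi.add_apply, add_mul, Finset.sum_add_distrib, Finset.sum_apply,
      Finset.sum_mul] at h1
    rw [Finset.sum_comm (γ := Fin s), left_eq_add, ← Finset.sum_add_distrib, Fin.sum_univ_add] at h1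
    rw [← h1]
    congr 1 <;> refine Finset.sum_congr rfl fun i _ => ?_
    · rw [← Function.comp_apply (f := fstBlock r), ← fstBlock_comp_blockPerm π τ]
      simp only [fstBlock, Pi.neg_apply]
      ring
    · rw [← Function.comp_apply (f := sndBlock r), ← sndBlock_comp_blockPerm π τ]
      simp only [sndBlock, Pi.neg_apply]
      ring
  have hfst : ∀ i i', fstBlock Γ i = fstBlock Γ i' := fun i i' => by
    have h := hperm (Equiv.swap i i') 1
    rw [sum_swap_sub_mul] at h
    simp only [Equiv.Perm.coe_one, id_eq, sub_self, zero_mul, Finset.sum_const_zero, add_zero,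
      mul_eq_zero, sub_eq_zero] at h
    rcases h with h | h
    · exact congrArg _ (Fin.castAdd_injective p q ((strictAnti_staircase _).injective h)).symm
    · exact h
  have hsnd : ∀ i i', sndBlock Γ i = sndBlock Γ i' := fun i i' => by
    have h := hperm 1 (Equiv.swap i i')
    rw [sum_swap_sub_mul] at h
    simp only [Equiv.Perm.coe_one, id_eq, sub_self, zero_mul, Finset.sum_const_zero, zero_add,
      mul_eq_zero, sub_eq_zero] at h
    rcases h with h | h
    · exact congrArg _ (Fin.natAdd_injective q p ((strictAnti_staircase _).injective h)).symm
    · exact h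
  have hmix : Γ ⟨0, by omega⟩ = Γ ⟨p + q - 1, by omega⟩ := by
    have h := H' _ _ (snoc_boost_mem_HornHolS hp hq
      (show (⟨0, by omega⟩ : Fin s) ≠ ⟨1, by omega⟩ by simp))
    have h1 : extremeSpectrum p q s (9 / 4) = (s : ℝ) • extremeSpectrum p q 1 0 +
        (Pi.single ⟨0, by omega⟩ (9 / 4) - Pi.single ⟨p + q - 1, by omega⟩ (9 / 4)) := by
      funext m
      simp only [extremeSpectrum, Pi.add_apply, Pi.smul_apply, Pi.sub_apply, Pi.single_apply,
        Fin.ext_iff, smul_eq_mul]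
      have h2 : ((m : ℕ) + 1 = p + q) = ((m : ℕ) = p + q - 1) := propext (by omega)
      simp only [h2]
      split_ifs <;> ring
    rw [h1] at h
    simp only [Pi.add_apply, Pi.sub_apply, Pi.smul_apply, add_mul, sub_mul, smul_eq_mul,
      mul_assoc, Finset.sum_add_distrib, Finset.sum_sub_distrib, Finset.sum_const,
      Finset.card_univ, Fintype.card_fin, nsmul_eq_mul, ← Finset.mul_sum, left_eq_add] at h
    rw [Fintype.sum_eq_single ⟨0, by omega⟩ fun i' h => by simp [h],
      Fintype.sum_eq_single ⟨p + q - 1, by omega⟩ fun i' h => by simp [h]] at h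
    simp only [Pi.single_eq_same] at h
    linarith
  have hall : ∀ i, Γ i = Γ ⟨0, by omega⟩ := by
    intro i
    refine Fin.addCases (fun i => ?_) (fun i => ?_) i
    · exact hfst i ⟨0, hp⟩
    · rw [hmix]
      have := hsnd i ⟨q - 1, by omega⟩
      refine this.trans (congrArg Γ (Fin.ext ?_))
      simp only [Fin.natAdd_mk]
      omega
  exact fun i i' => (hall i).trans (hall i').symm

end

section

/-! ### Convexity and closedness -/

variable {p q s : ℕ}

/-- The jumps of the dimensions along the flag. -/
noncomputable def jump {n : ℕ} (g : Matrix (Fin n) (Fin n) ℂ) (V : Submodule ℂ (Fin n → ℂ))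
    (k : Fin n) : ℝ :=
  (flagDim g V (k + 1) : ℝ) - flagDim g V k

theorem finrank_eq_of_jump {n : ℕ} {g : Matrix (Fin n) (Fin n) ℂ} (hg : IsUnit g.det)
    {V : Submodule ℂ (Fin n → ℂ)} {γ : ℝ} (h : ∀ k, jump g V k = γ) :
    (Module.finrank ℂ V : ℝ) = n * γ := by
  have h1 := slope_const 1 hg V
  have h2 : slope (fun _ => (1 : ℝ)) g V = ∑ k, (1 : ℝ) * jump g V k := rfl
  simp only [h2, one_mul, h, Finset.sum_const, Finset.card_univ, Fintype.card_fin,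
    nsmul_eq_mul] at h1
  exact h1.symm

/-- The total slope of a pair of subspaces for the weights attached to a tuple of spectra. -/
noncomputable def hornSlope (e : Datum p q (Fin (s + 1))) (V : Submodule ℂ (Fin p → ℂ))
    (W : Submodule ℂ (Fin q → ℂ)) (x : Fin (s + 1) → Fin (p + q) → ℝ) : ℝ :=
  totalSlope (fstWeight x) (sndWeight x) e V W

theorem hornSlope_add (e : Datum p q (Fin (s + 1))) (V W)
    (x y : Fin (s + 1) → Fin (p + q) → ℝ) :
    hornSlope e V W (x + y) = hornSlope e V W x + hornSlope e V W y := by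
  rw [hornSlope, fstWeight_add, sndWeight_add, totalSlope_add, hornSlope, hornSlope]

theorem hornSlope_smul (e : Datum p q (Fin (s + 1))) (V W) (c : ℝ)
    (x : Fin (s + 1) → Fin (p + q) → ℝ) :
    hornSlope e V W (c • x) = c * hornSlope e V W x := by
  rw [hornSlope, fstWeight_smul, sndWeight_smul, totalSlope_smul, hornSlope]

theorem sum_mul_append (x : Fin (p + q) → ℝ) (u : Fin p → ℝ) (v : Fin q → ℝ) :
    ∑ m, x m * Fin.append u v m = ∑ i, fstBlock x i * u i + ∑ i, sndBlock x i * v i := by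
  rw [Fin.sum_univ_add]
  simp [fstBlock, sndBlock]

theorem hornSlope_eq (e : Datum p q (Fin (s + 1))) (V W) (x : Fin (s + 1) → Fin (p + q) → ℝ) :
    hornSlope e V W x =
      ∑ j : Fin s, ∑ m, x j.castSucc m * Fin.append (jump (e j.castSucc).toBlocks₁₁ V)
        (jump (e j.castSucc).toBlocks₂₂ W) m -
      ∑ m, x (Fin.last s) m * Fin.append (jump (e (Fin.last s)).toBlocks₁₁ V ∘ Fin.rev)
        (jump (e (Fin.last s)).toBlocks₂₂ W ∘ Fin.rev) m := by
  simp only [sum_mul_append]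
  rw [hornSlope, totalSlope, Fin.sum_univ_castSucc, sub_eq_add_neg]
  simp only [fstWeight, sndWeight, lastKind_castSucc, lastKind_last, twist_false, twist_true]
  congr 1
  rw [neg_add, ← Finset.sum_neg_distrib, ← Finset.sum_neg_distrib,
    ← Equiv.sum_comp Fin.revPerm, ← Equiv.sum_comp Fin.revPerm (fun i : Fin q => -_)]
  simp [slope, jump]

/-- Only trivial pairs of subspaces have vanishing slope on the whole Horn cone. -/
theorem exists_hornSlope_ne_zero (hp : 0 < p) (hq : 0 < q) (hs : 2 ≤ s)
    {e : Datum p q (Fin (s + 1))} (he : IsFramed e) {V : Submodule ℂ (Fin p → ℂ)}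
    {W : Submodule ℂ (Fin q → ℂ)} (h0 : ¬ (V = ⊥ ∧ W = ⊥)) (h1 : ¬ (V = ⊤ ∧ W = ⊤)) :
    ∃ x ∈ HornHolS p q s, hornSlope e V W x ≠ 0 := by
  by_contra! H
  obtain ⟨hB, hΓ⟩ := eq_const_of_forall_mem hp hq hs fun x hx => by
    have := H x hx
    rw [hornSlope_eq, sub_eq_zero] at this
    exact this
  set j₀ : Fin s := ⟨0, by omega⟩
  set γ := jump (e j₀.castSucc).toBlocks₁₁ V ⟨0, hp⟩ with hγ
  have hj : ∀ m m', Fin.append (jump (e j₀.castSucc).toBlocks₁₁ V)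
      (jump (e j₀.castSucc).toBlocks₂₂ W) m = Fin.append (jump (e j₀.castSucc).toBlocks₁₁ V)
      (jump (e j₀.castSucc).toBlocks₂₂ W) m' := fun m m' => by
    rw [hB, hB, hΓ]
  have hV : ∀ k, jump (e j₀.castSucc).toBlocks₁₁ V k = γ := fun k => by
    have h := hj (Fin.castAdd q k) (Fin.castAdd q ⟨0, hp⟩)
    rwa [Fin.append_left, Fin.append_left] at h
  have hW : ∀ k, jump (e j₀.castSucc).toBlocks₂₂ W k = γ := fun k => by
    have h := hj (Fin.natAdd p k) (Fin.castAdd q ⟨0, hp⟩)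
    rwa [Fin.append_right, Fin.append_left] at h
  have hγ' : γ = (flagDim (e j₀.castSucc).toBlocks₁₁ V 1 : ℝ) := by
    simp [hγ, jump, flagDim_zero]
  have hVr := finrank_eq_of_jump (he _).1 hV
  have hWr := finrank_eq_of_jump (he _).2 hW
  rw [hγ'] at hVr hWr
  generalize flagDim (e j₀.castSucc).toBlocks₁₁ V 1 = d at hVr hWr
  have hVr' : Module.finrank ℂ V = p * d := by exact_mod_cast hVr
  have hWr' : Module.finrank ℂ W = q * d := by exact_mod_cast hWr
  have hle : p * d ≤ p := by
    rw [← hVr']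
    simpa using Submodule.finrank_le V
  have hd : d ≤ 1 := Nat.le_of_mul_le_mul_left (by simpa using hle) hp
  interval_cases d
  · exact h0 ⟨Submodule.finrank_eq_zero.1 (by simpa using hVr'),
      Submodule.finrank_eq_zero.1 (by simpa using hWr')⟩
  · exact h1 ⟨Submodule.eq_top_of_finrank_eq (by simpa using hVr'),
      Submodule.eq_top_of_finrank_eq (by simpa using hWr')⟩

theorem flagDim_lt {n : ℕ} (g : Matrix (Fin n) (Fin n) ℂ) (V : Submodule ℂ (Fin n → ℂ)) (k : ℕ) :
    flagDim g V k < n + 1 := by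
  have := Submodule.finrank_le (coordFlag n k ⊓ V.comap g.mulVecLin)
  rw [Module.finrank_fin_fun] at this
  exact Nat.lt_succ_of_le this

theorem finite_hornSlope (e : Datum p q (Fin (s + 1))) :
    (Set.range fun P : Submodule ℂ (Fin p → ℂ) × Submodule ℂ (Fin q → ℂ) =>
      hornSlope e P.1 P.2).Finite := by
  let G : (Fin (s + 1) → Fin (p + 1) → Fin (p + 1)) × (Fin (s + 1) → Fin (q + 1) → Fin (q + 1)) →
      (Fin (s + 1) → Fin (p + q) → ℝ) → ℝ := fun c x =>
    ∑ j, (∑ i : Fin p, fstWeight x j i * (((c.1 j i.succ : ℕ) : ℝ) - (c.1 j i.castSucc : ℕ)) +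
      ∑ i : Fin q, sndWeight x j i * (((c.2 j i.succ : ℕ) : ℝ) - (c.2 j i.castSucc : ℕ)))
  refine (Set.finite_range G).subset ?_
  rintro _ ⟨⟨V, W⟩, rfl⟩
  exact ⟨(fun j k => ⟨_, flagDim_lt (e j).toBlocks₁₁ V k⟩,
    fun j k => ⟨_, flagDim_lt (e j).toBlocks₂₂ W k⟩), rfl⟩

/-- If all points of the Horn cone are semistable at `e`, some point of the chamber is stable
at `e`. -/
theorem exists_stable (hp : 0 < p) (hq : 0 < q) (hs : 2 ≤ s) {e : Datum p q (Fin (s + 1))}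
    (he : ∀ x ∈ HornHolS p q s, Semistable (lastKind s) (fstWeight x) (sndWeight x) e) :
    ∃ y : Fin (s + 1) → Fin (p + q) → ℝ, (∀ j, y j ∈ Chol p q) ∧ weightSum y = 0 ∧
      Stable (lastKind s) (fstWeight y) (sndWeight y) e := by
  have hbase := snoc_sum_mem_HornHolS (p := p) (q := q) (s := s) (by omega)
    (fun _ => strictAnti_staircase (p + q))
  have hfr : IsFramed e := (he _ hbase).1
  set T := {f | ∃ V W, Inv (lastKind s) e V W ∧ ¬ (V = ⊥ ∧ W = ⊥) ∧ ¬ (V = ⊤ ∧ W = ⊤) ∧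
    hornSlope e V W = f} with hT
  have hTfin : T.Finite := (finite_hornSlope e).subset fun f ⟨V, W, _, _, _, h⟩ => ⟨(V, W), h⟩
  have key : ∃ y : Fin (s + 1) → Fin (p + q) → ℝ, (∀ j, y j ∈ Chol p q) ∧ weightSum y = 0 ∧
      (∀ f ∈ T, f y ≤ 0) ∧ ∀ f ∈ T, f y < 0 := by
    refine hTfin.induction_on_subset (motive := fun T' _ => ∃ y : Fin (s + 1) → Fin (p + q) → ℝ,
      (∀ j, y j ∈ Chol p q) ∧ weightSum y = 0 ∧ (∀ f ∈ T, f y ≤ 0) ∧ ∀ f ∈ T', f y < 0) _ ?_ ?_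
    · refine ⟨_, (mem_HornHolS_iff.1 hbase).1, weightSum_eq_zero hbase, ?_, by simp⟩
      rintro _ ⟨V, W, hi, -, -, rfl⟩
      exact (he _ hbase).2 V W hi
    · rintro f T' hf hsub - ⟨y, hy1, hy2, hy3, hy4⟩
      obtain ⟨V, W, hi, h0, h1, rfl⟩ := hf
      obtain ⟨x, hx, hne⟩ := exists_hornSlope_ne_zero hp hq hs hfr h0 h1
      have hxT : ∀ f ∈ T, f x ≤ 0 := by
        rintro _ ⟨V, W, hi, -, -, rfl⟩
        exact (he x hx).2 V W hi
      have hadd : ∀ f ∈ T, f (y + x) = f y + f x := by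
        rintro _ ⟨V, W, -, -, -, rfl⟩
        exact hornSlope_add e V W y x
      have hf : hornSlope e V W ∈ T := ⟨V, W, hi, h0, h1, rfl⟩
      refine ⟨y + x, fun j => add_mem_Chol (hy1 j) ((mem_HornHolS_iff.1 hx).1 j), ?_, ?_, ?_⟩
      · rw [weightSum_add, hy2, weightSum_eq_zero hx, add_zero]
      · intro f hf
        rw [hadd f hf]
        exact add_nonpos (hy3 f hf) (hxT f hf)
      · rintro f (rfl | hfT')
        · rw [hadd _ hf]
          exact add_neg_of_nonpos_of_neg (hy3 _ hf) (lt_of_le_of_ne (hxT _ hf) hne)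
        · rw [hadd _ (hsub hfT')]
          exact add_neg_of_neg_of_nonpos (hy4 f hfT') (hxT f (hsub hfT'))
  obtain ⟨y, hy1, hy2, -, hy4⟩ := key
  exact ⟨y, hy1, hy2, hfr, fun V W hi h0 h1 => hy4 _ ⟨V, W, hi, h0, h1, rfl⟩⟩

/-- The holomorphic Horn cone is convex. -/
theorem convex_HornHolS (hp : 0 < p) (hq : 0 < q) (hs : 2 ≤ s) :
    Convex ℝ (HornHolS p q s) := by
  have : Nonempty (Fin p) := ⟨⟨0, hp⟩⟩
  have : Nonempty (Fin q) := ⟨⟨0, hq⟩⟩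
  obtain ⟨e, he⟩ := exists_generic_datum p q (Fin (s + 1))
  have hss : ∀ x ∈ HornHolS p q s, Semistable (lastKind s) (fstWeight x) (sndWeight x) e := by
    intro x hx
    have hc := (mem_HornHolS_iff.1 hx).1
    obtain ⟨e₀, he₀⟩ := exists_semistable_of_mem (by omega) hx
    exact he _ _ _ (antitone_fstWeight hc) (antitone_sndWeight hc) e₀ he₀
  obtain ⟨y₀, hy1, hy2, hy3⟩ := exists_stable hp hq hs hss
  rw [convex_iff_forall_pos]
  intro x hx y hy a b ha hb _
  have hcx := (mem_HornHolS_iff.1 hx).1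
  have hcy := (mem_HornHolS_iff.1 hy).1
  have hcz : ∀ j, (a • x + b • y) j ∈ Chol p q := fun j =>
    add_mem_Chol (smul_mem_Chol (hcx j) ha) (smul_mem_Chol (hcy j) hb)
  have hmem : ∀ ε : ℝ, 0 < ε → a • x + b • y + ε • y₀ ∈ HornHolS p q s := by
    intro ε hε
    refine mem_of_stable (by omega) (e := e)
      (fun j => add_mem_Chol (hcz j) (smul_mem_Chol (hy1 j) hε)) ?_ ⟨hy3.1, ?_⟩
    · simp [weightSum_add, weightSum_smul, weightSum_eq_zero hx, weightSum_eq_zero hy, hy2]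
    · intro V W hi h0 h1
      change hornSlope e V W _ < 0
      rw [hornSlope_add, hornSlope_add, hornSlope_smul, hornSlope_smul, hornSlope_smul]
      have hx' : hornSlope e V W x ≤ 0 := (hss x hx).2 V W hi
      have hy' : hornSlope e V W y ≤ 0 := (hss y hy).2 V W hi
      have hy₀ : hornSlope e V W y₀ < 0 := hy3.2 V W hi h0 h1
      have := mul_nonpos_of_nonneg_of_nonpos ha.le hx'
      have := mul_nonpos_of_nonneg_of_nonpos hb.le hy'
      have := mul_neg_of_pos_of_neg hε hy₀
      linarith
  refine mem_HornHolS_of_tendsto (Filter.hyperfilter ℕ)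
    (y := fun m : ℕ => a • x + b • y + (1 / ((m : ℝ) + 1)) • y₀)
    (Filter.Eventually.of_forall fun m => hmem _ Nat.one_div_pos_of_nat) ?_ hcz
  have h := ((tendsto_one_div_add_atTop_nhds_zero_nat (𝕜 := ℝ)).smul_const y₀).const_add
    (a • x + b • y)
  rw [zero_smul, add_zero] at h
  exact h.mono_left Nat.hyperfilter_le_atTop

/-- The holomorphic Horn cone is closed in the product of chambers. -/
theorem isClosed_HornHolS (hp : 0 < p) (hq : 0 < q) :
    IsClosed ((Subtype.val : {y : Fin (s + 1) → Fin (p + q) → ℝ // ∀ j, y j ∈ Chol p q} →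
      Fin (s + 1) → Fin (p + q) → ℝ) ⁻¹' HornHolS p q s) := by
  have : Nonempty (Fin p) := ⟨⟨0, hp⟩⟩
  have : Nonempty (Fin q) := ⟨⟨0, hq⟩⟩
  rw [isClosed_iff_ultrafilter]
  intro x 𝒰 hlim hmem
  exact mem_HornHolS_of_tendsto 𝒰 (y := Subtype.val) hmem
    ((continuous_subtype_val.tendsto x).mono_left hlim) x.2

end

end HolomorphicHorn

theorem statement0 (p q : ℕ) (hq : 1 ≤ q) (hpq : q ≤ p) (s : ℕ) (hs : 2 ≤ s) :
    Convex ℝ (HornHolS p q s) ∧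
    (∀ t : ℝ, 0 < t → ∀ a ∈ HornHolS p q s, t • a ∈ HornHolS p q s) ∧
    IsClosed ((Subtype.val : {y : Fin (s + 1) → Fin (p + q) → ℝ // ∀ j, y j ∈ Chol p q} →
        Fin (s + 1) → Fin (p + q) → ℝ) ⁻¹' HornHolS p q s) := by
  exact ⟨HolomorphicHorn.convex_HornHolS (by omega) (by omega) hs,
    fun t ht a ha => HolomorphicHorn.smul_mem_HornHolS ht ha,
    HolomorphicHorn.isClosed_HornHolS (by omega) (by omega)⟩
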